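/- Let f ∈ H²(𝔹) and assume that for every I ∈ 𝕊 the radial limits f_I*(θ) = lim_{r→1⁻} f(r·e^{Iθ}) exist for almost every θ ∈ ℝ. Then ‖f‖_{BMOA(𝔹)} < ∞ if and only if the measure dμ_f(q) = |∂_c f(q)|² (1 − |q|²) dVol_𝔹(q) is a Carleson measure for H²(𝔹), i.e. there exists a constant C such that for every g ∈ H²(𝔹), (1/4)∫_{𝕊} ∫_{x²+y²<1} |g(x+yI)|² |∂_c f(x+yI)|² (1 − x² − y²) dx dy dA_𝕊(I) ≤ C·‖g‖²_{H²(𝔹)}. -/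

import Mathlib

open scoped Quaternion ENNReal Topology
open MeasureTheory Filter

/-- `e^{Iθ} = cos θ + I sin θ` for an imaginary unit `I`. -/
noncomputable def expQ (I : ℍ[ℝ]) (θ : ℝ) : ℍ[ℝ] := Real.cos θ • (1 : ℍ[ℝ]) + Real.sin θ • I

/-- The BMO seminorm of a function `g : ℝ → ℍ`. -/
noncomputable def bmoSeminorm (g : ℝ → ℍ[ℝ]) : ℝ≥0∞ :=
  ⨆ (α : ℝ) (β : ℝ) (_ : α < β) (_ : β - α ≤ 2 * Real.pi),
    ENNReal.ofReal
      (((β - α)⁻¹ * ∫ θ in α..β, ‖g θ - (β - α)⁻¹ • ∫ t in α..β, g t‖ ^ 2) ^ (1 / 2 : ℝ))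

/-- The Cullen (slice) derivative of `f(q) = ∑ₙ qⁿ aₙ`. -/
noncomputable def cullenDeriv (a : ℕ → ℍ[ℝ]) (q : ℍ[ℝ]) : ℍ[ℝ] :=
  ∑' n : ℕ, ((n + 1 : ℕ) : ℝ) • (q ^ n * a (n + 1))

/-- The identification of `ℝ³` with the imaginary quaternions. -/
def iQ (v : EuclideanSpace ℝ (Fin 3)) : ℍ[ℝ] := ⟨0, v 0, v 1, v 2⟩

/-- The sum of the power series with coefficients `a`. -/
noncomputable def powSeries (a : ℕ → ℂ) (z : ℂ) : ℂ := ∑' n : ℕ, a n * z ^ n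

/-- Absolute convergence of the power series with coefficients `a` on the open unit disc. -/
def DiscSummable (a : ℕ → ℂ) : Prop := ∀ r : ℝ, 0 ≤ r → r < 1 → Summable fun n => ‖a n‖ * r ^ n

lemma integral_circleMap_pow_mul_conj (t : ℝ) (m n : ℕ) :
    ∫ θ in t..t + 2 * Real.pi, circleMap 0 1 θ ^ m * (starRingEnd ℂ) (circleMap 0 1 θ ^ n) =
      if m = n then (2 * Real.pi : ℂ) else 0 := by
  have h1 : ∀ θ : ℝ, circleMap 0 1 θ ^ m * (starRingEnd ℂ) (circleMap 0 1 θ ^ n) =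
      Complex.exp (((m : ℂ) - n) * Complex.I * θ) := by
    intro θ
    simp only [circleMap, zero_add, Complex.ofReal_one, one_mul,
      ← Complex.exp_conj, map_mul, Complex.conj_ofReal, Complex.conj_I,
      ← Complex.exp_nat_mul, ← Complex.exp_add, Complex.conj_natCast]
    congr 1; ring
  simp_rw [h1]
  split_ifs with h
  · subst h; simp
  · have hc : ((m : ℂ) - n) * Complex.I ≠ 0 :=
      mul_ne_zero (sub_ne_zero.2 (by exact_mod_cast h)) Complex.I_ne_zero
    rw [integral_exp_mul_complex hc]
    have : Complex.exp (((m : ℂ) - n) * Complex.I * ((t + 2 * Real.pi : ℝ) : ℂ)) =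
        Complex.exp (((m : ℂ) - n) * Complex.I * t) := by
      have e : ((m : ℂ) - n) * Complex.I * ((t + 2 * Real.pi : ℝ) : ℂ) =
          ((m : ℂ) - n) * Complex.I * t + (((m : ℤ) - n : ℤ) : ℂ) * (2 * Real.pi * Complex.I) := by
        push_cast; ring
      rw [e, Complex.exp_add, Complex.exp_int_mul_two_pi_mul_I, mul_one]
    rw [this]; simp

/-- **Parseval's identity** for absolutely convergent trigonometric series. -/
lemma integral_norm_sq_tsum_circleMap {c : ℕ → ℂ} (hc : Summable fun n => ‖c n‖) (t : ℝ) :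
    ∫ θ in t..t + 2 * Real.pi, ‖∑' n, c n * circleMap 0 1 θ ^ n‖ ^ 2 =
      2 * Real.pi * ∑' n, ‖c n‖ ^ 2 := by
  have hpi := Real.pi_pos
  have hle : t ≤ t + 2 * Real.pi := by linarith
  set F : ℝ → ℂ := fun θ => ∑' n, c n * circleMap 0 1 θ ^ n with hF
  have hbd : ∀ n θ, ‖c n * circleMap 0 1 θ ^ n‖ ≤ ‖c n‖ := by intro n θ; simp
  have hFc : Continuous F := continuous_tsum (fun n => by fun_prop) hc hbd
  have hsum : ∀ θ, HasSum (fun n => c n * circleMap 0 1 θ ^ n) (F θ) := fun θ =>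
    (Summable.of_norm_bounded hc (fun n => hbd n θ)).hasSum
  have hconst : ∀ b : ℝ, ∫ θ in Set.Ioc t (t + 2 * Real.pi), b = 2 * Real.pi * b := by
    intro b
    rw [← intervalIntegral.integral_of_le hle]; simp
  have inner : ∀ n, ∫ θ in t..t + 2 * Real.pi, F θ * (starRingEnd ℂ) (circleMap 0 1 θ ^ n) =
      2 * Real.pi * c n := by
    intro n
    rw [intervalIntegral.integral_of_le hle]
    have key := hasSum_integral_of_summable_integral_norm
      (μ := volume.restrict (Set.Ioc t (t + 2 * Real.pi)))
      (F := fun m θ => c m * circleMap 0 1 θ ^ m * (starRingEnd ℂ) (circleMap 0 1 θ ^ n))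
      (fun m => (Continuous.integrableOn_Ioc (by fun_prop))) (by
        simp only [norm_mul, norm_pow, norm_circleMap_zero, RCLike.norm_conj, abs_one, one_pow,
          mul_one]
        simp_rw [hconst]
        exact hc.mul_left _)
    have e1 : ∀ θ, ∑' m, c m * circleMap 0 1 θ ^ m * (starRingEnd ℂ) (circleMap 0 1 θ ^ n) =
        F θ * (starRingEnd ℂ) (circleMap 0 1 θ ^ n) := fun θ => tsum_mul_right
    simp_rw [e1] at key
    rw [← key.tsum_eq]
    simp_rw [← intervalIntegral.integral_of_le hle, mul_assoc,
      intervalIntegral.integral_const_mul, integral_circleMap_pow_mul_conj]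
    rw [tsum_eq_single n]
    · simp; ring
    · intro m hm; simp [hm]
  obtain ⟨M, hM⟩ : ∃ M, ∀ θ, ‖F θ‖ ≤ M :=
    ⟨∑' n, ‖c n‖, fun θ => tsum_of_norm_bounded hc.hasSum (fun n => hbd n θ)⟩
  have hM0 : 0 ≤ M := (norm_nonneg _).trans (hM 0)
  have key := hasSum_integral_of_summable_integral_norm
      (μ := volume.restrict (Set.Ioc t (t + 2 * Real.pi)))
      (F := fun n θ => F θ * (starRingEnd ℂ) (c n * circleMap 0 1 θ ^ n))
      (fun m => (Continuous.integrableOn_Ioc (by fun_prop))) (by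
        refine Summable.of_nonneg_of_le (fun n => integral_nonneg fun θ => norm_nonneg _)
          (fun n => ?_) (hc.mul_left (2 * Real.pi * M))
        have : ∫ θ in Set.Ioc t (t + 2 * Real.pi), ‖F θ * (starRingEnd ℂ) (c n * circleMap 0 1 θ ^ n)‖
            ≤ ∫ θ in Set.Ioc t (t + 2 * Real.pi), M * ‖c n‖ := by
          refine integral_mono (Continuous.integrableOn_Ioc (by fun_prop))
            (Continuous.integrableOn_Ioc (by fun_prop)) (fun θ => ?_)
          simp only [norm_mul, RCLike.norm_conj, norm_pow, norm_circleMap_zero, abs_one, one_pow,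
            mul_one]
          gcongr; exact hM θ
        rw [hconst] at this; linarith)
  have e2 : ∀ θ, ∑' n, F θ * (starRingEnd ℂ) (c n * circleMap 0 1 θ ^ n) =
      ((‖F θ‖ ^ 2 : ℝ) : ℂ) := by
    intro θ
    rw [tsum_mul_left]
    have := (Complex.hasSum_conj'.2 (by simpa using (hsum θ))).tsum_eq
    rw [this, Complex.mul_conj, Complex.normSq_eq_norm_sq]
  simp_rw [e2] at key
  have e3 : ∀ n, ∫ θ in Set.Ioc t (t + 2 * Real.pi),
      F θ * (starRingEnd ℂ) (c n * circleMap 0 1 θ ^ n) = ((2 * Real.pi * ‖c n‖ ^ 2 : ℝ) : ℂ) := by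
    intro n
    rw [← intervalIntegral.integral_of_le hle]
    have : ∀ θ : ℝ, F θ * (starRingEnd ℂ) (c n * circleMap 0 1 θ ^ n) =
      (starRingEnd ℂ) (c n) * (F θ * (starRingEnd ℂ) (circleMap 0 1 θ ^ n)) := by
      intro θ; rw [map_mul]; ring
    simp_rw [this, intervalIntegral.integral_const_mul, inner]
    have := Complex.mul_conj (c n)
    rw [Complex.normSq_eq_norm_sq] at this
    push_cast at this ⊢
    linear_combination (2 * (Real.pi : ℂ)) * this
  simp_rw [e3, integral_complex_ofReal] at key
  have k2 := Complex.hasSum_ofReal.1 key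
  rw [← intervalIntegral.integral_of_le hle] at k2
  rw [← k2.tsum_eq, tsum_mul_left]

lemma lintegral_enorm_sq_tsum_circleMap {c : ℕ → ℂ} (hc : Summable fun n => ‖c n‖) (t : ℝ) :
    ∫⁻ θ in Set.Ioc t (t + 2 * Real.pi), ‖∑' n, c n * circleMap 0 1 θ ^ n‖ₑ ^ 2 =
      ENNReal.ofReal (2 * Real.pi) * ∑' n, ‖c n‖ₑ ^ 2 := by
  have hpi := Real.pi_pos
  have hFc : Continuous fun θ : ℝ => ∑' n, c n * circleMap 0 1 θ ^ n :=
    continuous_tsum (fun n => by fun_prop) hc (fun n θ => by simp)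
  have h2 : Summable fun n => ‖c n‖ ^ 2 := by
    refine Summable.of_nonneg_of_le (fun n => by positivity) (fun n => ?_)
      (hc.mul_left (∑' n, ‖c n‖))
    rw [pow_two]
    gcongr
    exact hc.le_tsum n fun m _ => norm_nonneg _
  have h := integral_norm_sq_tsum_circleMap hc t
  rw [intervalIntegral.integral_of_le (by linarith)] at h
  have h3 := congrArg ENNReal.ofReal h
  rw [ofReal_integral_eq_lintegral_ofReal (Continuous.integrableOn_Ioc (by fun_prop))
    (ae_of_all _ fun θ => by positivity), ENNReal.ofReal_mul (by positivity),
    ENNReal.ofReal_tsum_of_nonneg (fun n => by positivity) h2] at h3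
  simpa [ENNReal.ofReal_pow, ofReal_norm] using h3

lemma discSummable_of_summable_sq {a : ℕ → ℂ} (ha : Summable fun n => ‖a n‖ ^ 2) :
    DiscSummable a := by
  intro r hr0 hr1
  have h2 : Summable fun n => (r ^ 2) ^ n :=
    summable_geometric_of_lt_one (by positivity) (by nlinarith)
  refine Summable.of_nonneg_of_le (fun n => by positivity) (fun n => ?_) (ha.add h2)
  have : (r ^ 2) ^ n = (r ^ n) ^ 2 := by ring
  rw [this]
  nlinarith [sq_nonneg (‖a n‖ - r ^ n), sq_nonneg (‖a n‖), sq_nonneg (r ^ n)]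

namespace DiscSummable

variable {a : ℕ → ℂ}

lemma hasSum (ha : DiscSummable a) {z : ℂ} (hz : ‖z‖ < 1) :
    HasSum (fun n => a n * z ^ n) (powSeries a z) :=
  (Summable.of_norm (by simpa using ha ‖z‖ (norm_nonneg z) hz)).hasSum

lemma differentiableOn (ha : DiscSummable a) :
    DifferentiableOn ℂ (powSeries a) (Metric.ball 0 1) := by
  intro z hz
  rw [mem_ball_zero_iff] at hz
  obtain ⟨r, hr, hr1⟩ := exists_between hz
  have h := Complex.differentiableOn_tsum_of_summable_norm (F := fun n z => a n * z ^ n)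
    (ha r ((norm_nonneg z).trans hr.le) hr1) (fun n => by fun_prop) Metric.isOpen_ball
    (U := Metric.ball 0 r) (fun n w hw => by
      rw [mem_ball_zero_iff] at hw
      rw [norm_mul, norm_pow]; gcongr)
  exact (h.differentiableAt (Metric.isOpen_ball.mem_nhds (by simpa using hr))).differentiableWithinAt

lemma hasSum_deriv (ha : DiscSummable a) {z : ℂ} (hz : ‖z‖ < 1) :
    HasSum (fun n : ℕ => ((n + 1 : ℕ) * a (n + 1)) * z ^ n) (deriv (powSeries a) z) := by
  obtain ⟨r, hr, hr1⟩ := exists_between hz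
  have h := Complex.hasSum_deriv_of_summable_norm (F := fun n z => a n * z ^ n)
    (ha r ((norm_nonneg z).trans hr.le) hr1) (fun n => by fun_prop) Metric.isOpen_ball
    (U := Metric.ball 0 r) (fun n w hw => by
      rw [mem_ball_zero_iff] at hw
      rw [norm_mul, norm_pow]; gcongr) (z := z) (by simpa using hr)
  rw [← hasSum_nat_add_iff' 1] at h
  simp only [deriv_const_mul_field, deriv_pow_field, Finset.range_one, Finset.sum_singleton,
    Nat.cast_zero, zero_mul, mul_zero, sub_zero, Nat.add_sub_cancel] at h
  rw [show (fun n : ℕ => ((n + 1 : ℕ) * a (n + 1)) * z ^ n) =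
    fun n => a (n + 1) * ((n + 1 : ℕ) * z ^ n) from funext fun n => by ring]
  exact h

lemma deriv_coeff (ha : DiscSummable a) :
    DiscSummable fun n : ℕ => (n + 1 : ℕ) * a (n + 1) := by
  intro r hr0 hr1
  have h := (ha.hasSum_deriv (z := r) (by simpa [abs_of_nonneg hr0] using hr1)).summable.norm
  simpa [abs_of_nonneg hr0] using h

lemma deriv_eq (ha : DiscSummable a) {z : ℂ} (hz : ‖z‖ < 1) :
    deriv (powSeries a) z = powSeries (fun n : ℕ => (n + 1 : ℕ) * a (n + 1)) z :=
  (ha.hasSum_deriv hz).tsum_eq.symm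

end DiscSummable

lemma exists_powSeries {p : ℂ → ℂ} (hp : DifferentiableOn ℂ p (Metric.ball 0 1)) :
    ∃ a, DiscSummable a ∧ Set.EqOn p (powSeries a) (Metric.ball 0 1) := by
  have key : ∀ z ∈ Metric.ball (0 : ℂ) 1,
      HasSum (fun n : ℕ => ((n.factorial : ℂ)⁻¹ * iteratedDeriv n p 0) * z ^ n) (p z) := by
    intro z hz
    have := Complex.hasSum_taylorSeries_on_ball hp hz
    rw [show (fun n : ℕ => ((n.factorial : ℂ)⁻¹ * iteratedDeriv n p 0) * z ^ n) =
      fun n : ℕ => (n.factorial : ℂ)⁻¹ • (z - 0) ^ n • iteratedDeriv n p 0 from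
        funext fun n => by simp only [sub_zero, smul_eq_mul]; ring]
    exact this
  refine ⟨_, fun r hr0 hr1 => ?_, fun z hz => (key z hz).tsum_eq.symm⟩
  have h := (key r (by simpa [abs_of_nonneg hr0] using hr1)).summable.norm
  simpa [abs_of_nonneg hr0] using h

/-- The radial moments entering the area formula below. -/
lemma integral_radial_moment (m : ℕ) (ρ : ℝ) :
    ∫ s in (0 : ℝ)..ρ, s * (ρ ^ 2 - s ^ 2) * (s ^ m) ^ 2 =
      ρ ^ (2 * m + 4) / (2 * (m + 1) * (m + 2)) := by
  have : ∀ s : ℝ, s * (ρ ^ 2 - s ^ 2) * (s ^ m) ^ 2 =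
      ρ ^ 2 * s ^ (2 * m + 1) - s ^ (2 * m + 3) := by intro s; ring
  simp_rw [this]
  rw [intervalIntegral.integral_sub (Continuous.intervalIntegrable (by fun_prop) _ _)
    (Continuous.intervalIntegrable (by fun_prop) _ _), intervalIntegral.integral_const_mul,
    integral_pow, integral_pow]
  push_cast
  have h1 : (2 * (m : ℝ) + 1 + 1) ≠ 0 := by positivity
  have h2 : (2 * (m : ℝ) + 3 + 1) ≠ 0 := by positivity
  have h3 : ((m : ℝ) + 1) ≠ 0 := by positivity
  have h4 : ((m : ℝ) + 2) ≠ 0 := by positivity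
  field_simp
  ring

/-- **Littlewood–Paley identity** on the disc of radius `ρ ≤ 1`. -/
lemma lintegral_deriv_powSeries {a : ℕ → ℂ} (ha : DiscSummable a) {ρ : ℝ} (hρ0 : 0 < ρ)
    (hρ1 : ρ ≤ 1) :
    ∫⁻ z in Metric.ball (0 : ℂ) ρ, ‖deriv (powSeries a) z‖ₑ ^ 2 * ENNReal.ofReal (ρ ^ 2 - ‖z‖ ^ 2) =
      ∑' m : ℕ, ENNReal.ofReal (Real.pi * ((m + 1) / (m + 2)) * ρ ^ (2 * m + 4)) *
        ‖a (m + 1)‖ₑ ^ 2 := by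
  have hpi := Real.pi_pos
  set b : ℕ → ℂ := fun n : ℕ => (n + 1 : ℕ) * a (n + 1) with hb
  have hbs : DiscSummable b := ha.deriv_coeff
  have hcont : ContinuousOn (powSeries b) (Metric.ball 0 1) := hbs.differentiableOn.continuousOn
  set G : ℂ → ℝ≥0∞ := (Metric.ball (0 : ℂ) ρ).indicator
    (fun z => ‖powSeries b z‖ₑ ^ 2 * ENNReal.ofReal (ρ ^ 2 - ‖z‖ ^ 2)) with hG
  have hGm : Measurable G := by
    have hc : ContinuousOn (powSeries b) (Metric.ball 0 ρ) :=
      hcont.mono (Metric.ball_subset_ball hρ1)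
    have e : G = (fun z => ‖(Metric.ball (0 : ℂ) ρ).indicator (powSeries b) z‖ₑ ^ 2 *
        ENNReal.ofReal (ρ ^ 2 - ‖z‖ ^ 2)) := by
      funext z
      by_cases hz : z ∈ Metric.ball (0 : ℂ) ρ <;> simp [hG, hz]
    rw [e]
    have : Measurable ((Metric.ball (0 : ℂ) ρ).indicator (powSeries b)) :=
      by
      classical
      rw [← Set.piecewise_eq_indicator]
      exact hc.measurable_piecewise continuousOn_const measurableSet_ball
    fun_prop
  have h1 : ∫⁻ z in Metric.ball (0 : ℂ) ρ, ‖deriv (powSeries a) z‖ₑ ^ 2 *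
      ENNReal.ofReal (ρ ^ 2 - ‖z‖ ^ 2) = ∫⁻ z, G z := by
    rw [hG, lintegral_indicator measurableSet_ball]
    refine setLIntegral_congr_fun measurableSet_ball fun z hz => ?_
    rw [mem_ball_zero_iff] at hz
    rw [ha.deriv_eq (hz.trans_le hρ1)]
  have hsymm : ∀ p : ℝ × ℝ, Complex.polarCoord.symm p = p.1 * circleMap 0 1 p.2 := by
    intro p
    rw [Complex.polarCoord_symm_apply, circleMap, zero_add, Complex.ofReal_one, one_mul,
      Complex.exp_mul_I, Complex.ofReal_cos, Complex.ofReal_sin]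
  have inner : ∀ s ∈ Set.Ioi (0 : ℝ), ∫⁻ θ in Set.Ioo (-Real.pi) Real.pi,
      ENNReal.ofReal s • G (s * circleMap 0 1 θ) =
      (Set.Ioo 0 ρ).indicator (fun s => ∑' m : ℕ, ENNReal.ofReal (s * (ρ ^ 2 - s ^ 2) * (s ^ m) ^ 2) *
        (ENNReal.ofReal (2 * Real.pi) * ‖b m‖ₑ ^ 2)) s := by
    intro s hs
    have hs0 : 0 < s := hs
    have hn : ∀ θ, ‖(s : ℂ) * circleMap 0 1 θ‖ = s := by
      intro θ; simp [abs_of_pos hs0]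
    by_cases hsρ : s < ρ
    · have hs2 : 0 ≤ ρ ^ 2 - s ^ 2 := by nlinarith
      rw [Set.indicator_of_mem (show s ∈ Set.Ioo 0 ρ from ⟨hs0, hsρ⟩)]
      have hcs : Summable fun n => ‖b n * (s : ℂ) ^ n‖ := by
        simpa [abs_of_pos hs0] using hbs s hs0.le (hsρ.trans_le hρ1)
      have e : ∀ θ, ENNReal.ofReal s • G (s * circleMap 0 1 θ) =
          ENNReal.ofReal (s * (ρ ^ 2 - s ^ 2)) *
            ‖∑' n, (b n * (s : ℂ) ^ n) * circleMap 0 1 θ ^ n‖ₑ ^ 2 := by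
        intro θ
        have hmem : (s : ℂ) * circleMap 0 1 θ ∈ Metric.ball (0 : ℂ) ρ := by
          rw [mem_ball_zero_iff, hn]; exact hsρ
        rw [hG, Set.indicator_of_mem hmem, hn, powSeries, smul_eq_mul,
          ENNReal.ofReal_mul hs0.le]
        simp_rw [mul_pow, ← mul_assoc]
        ring
      simp_rw [e]
      rw [lintegral_const_mul' _ _ ENNReal.ofReal_ne_top, Measure.restrict_congr_set
        Ioo_ae_eq_Ioc]
      have := lintegral_enorm_sq_tsum_circleMap hcs (-Real.pi)
      rw [show -Real.pi + 2 * Real.pi = Real.pi by ring] at this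
      rw [this, ← ENNReal.tsum_mul_left, ← ENNReal.tsum_mul_left]
      refine tsum_congr fun m => ?_
      rw [ENNReal.ofReal_mul (by positivity : 0 ≤ s * (ρ ^ 2 - s ^ 2)), enorm_mul, mul_pow]
      have : ‖(s : ℂ) ^ m‖ₑ ^ 2 = ENNReal.ofReal ((s ^ m) ^ 2) := by
        rw [ENNReal.ofReal_pow (by positivity), ← ofReal_norm]
        simp [abs_of_pos hs0]
      rw [this]; ring
    · rw [Set.indicator_of_notMem (by simp [hsρ])]
      have : ∀ θ, G (s * circleMap 0 1 θ) = 0 := by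
        intro θ
        rw [hG, Set.indicator_of_notMem (by rw [mem_ball_zero_iff, hn]; exact hsρ)]
      simp [this]
  have hprod : ∫⁻ z, G z = ∫⁻ s in Set.Ioi (0 : ℝ), ∫⁻ θ in Set.Ioo (-Real.pi) Real.pi,
      ENNReal.ofReal s • G (s * circleMap 0 1 θ) := by
    rw [← Complex.lintegral_comp_polarCoord_symm, polarCoord_target, Measure.volume_eq_prod,
      ← Measure.prod_restrict, lintegral_prod _ (by
        simp_rw [hsymm, smul_eq_mul]
        refine Measurable.aemeasurable ?_
        have : Measurable fun p : ℝ × ℝ => (p.1 : ℂ) * circleMap 0 1 p.2 := by fun_prop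
        have h2 := hGm.comp this
        exact (by fun_prop : Measurable fun p : ℝ × ℝ => ENNReal.ofReal p.1).mul h2)]
    simp_rw [hsymm]
  rw [h1, hprod, setLIntegral_congr_fun measurableSet_Ioi inner,
    setLIntegral_indicator measurableSet_Ioo, Set.inter_eq_left.2 Set.Ioo_subset_Ioi_self,
    lintegral_tsum (fun m => by fun_prop)]
  refine tsum_congr fun m => ?_
  rw [lintegral_mul_const' _ _ (by finiteness), Measure.restrict_congr_set Ioo_ae_eq_Ioc,
    ← ofReal_integral_eq_lintegral_ofReal (Continuous.integrableOn_Ioc (by fun_prop)) (by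
      filter_upwards [ae_restrict_mem measurableSet_Ioc] with s hs
      have : 0 ≤ ρ ^ 2 - s ^ 2 := by nlinarith [hs.1, hs.2]
      have := hs.1
      simp only [Pi.zero_apply]
      positivity),
    ← intervalIntegral.integral_of_le hρ0.le, integral_radial_moment]
  have hbm : ‖b m‖ₑ ^ 2 = ENNReal.ofReal (((m : ℝ) + 1) ^ 2) * ‖a (m + 1)‖ₑ ^ 2 := by
    have h0 : (0 : ℝ) ≤ (m : ℝ) + 1 := by positivity
    simp only [hb, enorm_mul, mul_pow]
    congr 1
    rw [ENNReal.ofReal_pow h0, ← ofReal_norm, Complex.norm_natCast]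
    push_cast; rfl
  rw [hbm, ← mul_assoc, ← mul_assoc, ← ENNReal.ofReal_mul (by positivity),
    ← ENNReal.ofReal_mul (by positivity)]
  congr 2
  have h3 : ((m : ℝ) + 1) ≠ 0 := by positivity
  have h4 : ((m : ℝ) + 2) ≠ 0 := by positivity
  field_simp

lemma lintegral_enorm_sq_circle {a : ℕ → ℂ} (ha : DiscSummable a) {ρ : ℝ} (hρ0 : 0 ≤ ρ)
    (hρ1 : ρ < 1) :
    ∫⁻ θ in Set.Ioc 0 (2 * Real.pi), ‖powSeries a (ρ * circleMap 0 1 θ)‖ₑ ^ 2 =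
      ENNReal.ofReal (2 * Real.pi) * ∑' n, ENNReal.ofReal (ρ ^ (2 * n)) * ‖a n‖ₑ ^ 2 := by
  have hcs : Summable fun n => ‖a n * (ρ : ℂ) ^ n‖ := by
    simpa [abs_of_nonneg hρ0] using ha ρ hρ0 hρ1
  have := lintegral_enorm_sq_tsum_circleMap hcs 0
  rw [zero_add] at this
  simp_rw [powSeries, mul_pow, ← mul_assoc]
  rw [this]
  congr 1
  refine tsum_congr fun n => ?_
  have : ‖(ρ : ℂ) ^ n‖ₑ ^ 2 = ENNReal.ofReal (ρ ^ (2 * n)) := by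
    rw [mul_comm 2 n, pow_mul, ENNReal.ofReal_pow (by positivity), ← ofReal_norm]
    simp [abs_of_nonneg hρ0]
  rw [enorm_mul, mul_pow, this, mul_comm]

/-- Upper Littlewood–Paley estimate. -/
lemma lintegral_deriv_le {p : ℂ → ℂ} (hp : DifferentiableOn ℂ p (Metric.ball 0 1)) {ρ : ℝ}
    (hρ0 : 0 < ρ) (hρ1 : ρ < 1) :
    ∫⁻ z in Metric.ball (0 : ℂ) ρ, ‖deriv p z‖ₑ ^ 2 * ENNReal.ofReal (ρ ^ 2 - ‖z‖ ^ 2) ≤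
      ∫⁻ θ in Set.Ioc 0 (2 * Real.pi), ‖p (ρ * circleMap 0 1 θ)‖ₑ ^ 2 := by
  have hpi := Real.pi_pos
  obtain ⟨a, ha, hpa⟩ := exists_powSeries hp
  have hsub := Metric.ball_subset_ball (x := (0 : ℂ)) hρ1.le
  have e1 : ∫⁻ z in Metric.ball (0 : ℂ) ρ, ‖deriv p z‖ₑ ^ 2 * ENNReal.ofReal (ρ ^ 2 - ‖z‖ ^ 2) =
    ∫⁻ z in Metric.ball (0 : ℂ) ρ, ‖deriv (powSeries a) z‖ₑ ^ 2 *
      ENNReal.ofReal (ρ ^ 2 - ‖z‖ ^ 2) :=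
    setLIntegral_congr_fun measurableSet_ball fun z hz => by
      rw [hpa.deriv Metric.isOpen_ball (hsub hz)]
  have e2 : ∀ θ, p (ρ * circleMap 0 1 θ) = powSeries a (ρ * circleMap 0 1 θ) := fun θ =>
    hpa (by simp [abs_of_pos hρ0, hρ1])
  simp_rw [e1, e2, lintegral_enorm_sq_circle ha hρ0.le hρ1,
    lintegral_deriv_powSeries ha hρ0 hρ1.le, ← ENNReal.tsum_mul_left]
  rw [tsum_eq_zero_add' (f := fun n => ENNReal.ofReal (2 * Real.pi) *
    (ENNReal.ofReal (ρ ^ (2 * n)) * ‖a n‖ₑ ^ 2)) ENNReal.summable]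
  refine le_add_left (ENNReal.tsum_le_tsum fun m => ?_)
  rw [← mul_assoc, ← ENNReal.ofReal_mul (by positivity)]
  gcongr ENNReal.ofReal ?_ * _
  have h1 : ((m : ℝ) + 1) / (m + 2) ≤ 1 := by
    rw [div_le_one (by positivity)]; linarith
  have h2 : ρ ^ (2 * m + 4) ≤ ρ ^ (2 * (m + 1)) :=
    pow_le_pow_of_le_one hρ0.le hρ1.le (by omega)
  calc Real.pi * (((m : ℝ) + 1) / (m + 2)) * ρ ^ (2 * m + 4)
      ≤ Real.pi * 1 * ρ ^ (2 * (m + 1)) := by gcongr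
    _ ≤ 2 * Real.pi * ρ ^ (2 * (m + 1)) := by
        rw [mul_one]
        have := pow_nonneg hρ0.le (2 * (m + 1))
        nlinarith

/-- Lower Littlewood–Paley estimate. -/
lemma lintegral_circle_sub_le {p : ℂ → ℂ} (hp : DifferentiableOn ℂ p (Metric.ball 0 1)) {ρ : ℝ}
    (hρ0 : 0 ≤ ρ) (hρ1 : ρ < 1) :
    ∫⁻ θ in Set.Ioc 0 (2 * Real.pi), ‖p (ρ * circleMap 0 1 θ) - p 0‖ₑ ^ 2 ≤
      4 * ∫⁻ z in Metric.ball (0 : ℂ) 1, ‖deriv p z‖ₑ ^ 2 * ENNReal.ofReal (1 - ‖z‖ ^ 2) := by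
  have hpi := Real.pi_pos
  set q : ℂ → ℂ := fun z => p z - p 0 with hq
  have hqd : DifferentiableOn ℂ q (Metric.ball 0 1) := hp.sub_const _
  obtain ⟨a, ha, hpa⟩ := exists_powSeries hqd
  have ha0 : a 0 = 0 := by
    have h1 := hpa (Metric.mem_ball_self one_pos)
    have h2 : powSeries a 0 = a 0 := by
      rw [powSeries, tsum_eq_single 0 (fun n hn => by simp [hn])]; simp
    rw [← h2, ← h1]; simp [hq]
  have e1 : ∫⁻ z in Metric.ball (0 : ℂ) 1, ‖deriv p z‖ₑ ^ 2 * ENNReal.ofReal (1 - ‖z‖ ^ 2) =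
    ∫⁻ z in Metric.ball (0 : ℂ) 1, ‖deriv (powSeries a) z‖ₑ ^ 2 *
      ENNReal.ofReal (1 ^ 2 - ‖z‖ ^ 2) :=
    setLIntegral_congr_fun measurableSet_ball fun z hz => by
      rw [← hpa.deriv Metric.isOpen_ball hz, one_pow, hq, deriv_sub_const]
  have e2 : ∀ θ, p (ρ * circleMap 0 1 θ) - p 0 = powSeries a (ρ * circleMap 0 1 θ) := fun θ =>
    hpa (by simp [abs_of_nonneg hρ0, hρ1])
  simp_rw [e1, e2, lintegral_enorm_sq_circle ha hρ0 hρ1,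
    lintegral_deriv_powSeries ha one_pos le_rfl, ← ENNReal.tsum_mul_left]
  rw [tsum_eq_zero_add' (f := fun n => ENNReal.ofReal (2 * Real.pi) *
    (ENNReal.ofReal (ρ ^ (2 * n)) * ‖a n‖ₑ ^ 2)) ENNReal.summable]
  simp only [ha0, enorm_zero, ne_eq, OfNat.ofNat_ne_zero, not_false_eq_true, zero_pow, mul_zero,
    zero_add, one_pow, mul_one]
  refine ENNReal.tsum_le_tsum fun m => ?_
  rw [← mul_assoc, ← mul_assoc, ← ENNReal.ofReal_mul (by positivity),
    show (4 : ℝ≥0∞) = ENNReal.ofReal 4 by simp, ← ENNReal.ofReal_mul (by positivity)]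
  gcongr ENNReal.ofReal ?_ * _
  have h1 : 1 / 2 ≤ ((m : ℝ) + 1) / (m + 2) := by
    rw [div_le_div_iff₀ (by positivity) (by positivity)]; linarith [(Nat.cast_nonneg m : (0 : ℝ) ≤ m)]
  have h2 : ρ ^ (2 * (m + 1)) ≤ 1 := pow_le_one₀ hρ0 hρ1.le
  calc 2 * Real.pi * ρ ^ (2 * (m + 1)) ≤ 2 * Real.pi * 1 := by gcongr
    _ = 4 * (Real.pi * (1 / 2)) := by ring
    _ ≤ _ := by gcongr

lemma hasSum_exp_term (x : ℝ) : HasSum (fun n : ℕ => x ^ n / n.factorial) (Real.exp x) := by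
  rw [Real.exp_eq_exp_ℝ]; exact NormedSpace.expSeries_div_hasSum_exp x

lemma HasSum.congr_fun_eq {f g : ℕ → ℝ} {s : ℝ} (h : HasSum f s) (hfg : ∀ n, g n = f n) :
    HasSum g s := (funext hfg : g = f) ▸ h

lemma hasSum_nat_mul_exp_term (x : ℝ) :
    HasSum (fun n : ℕ => n * (x ^ n / n.factorial)) (x * Real.exp x) := by
  rw [← hasSum_nat_add_iff' 1]
  simp only [Finset.range_one, Finset.sum_singleton, Nat.cast_zero, zero_mul, sub_zero]
  refine ((hasSum_exp_term x).mul_left x).congr_fun_eq fun n => ?_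
  rw [Nat.factorial_succ]; push_cast
  have : (n.factorial : ℝ) ≠ 0 := by positivity
  field_simp
  ring

lemma hasSum_weighted_norm_sq (A D h : ℂ) (t : ℝ) :
    HasSum (fun j : ℕ => t ^ j / j.factorial * ‖A * h ^ j + D * (j * h ^ (j - 1))‖ ^ 2)
      (Real.exp (t * ‖h‖ ^ 2) *
        (‖A + t * (starRingEnd ℂ) h * D‖ ^ 2 + t * ‖D‖ ^ 2)) := by
  set y : ℝ := ‖h‖ ^ 2 with hy
  set R : ℝ := (A * h * (starRingEnd ℂ) D).re with hR
  have h0 := (hasSum_exp_term (t * y)).mul_left (‖A‖ ^ 2)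
  have h12 : HasSum (fun j : ℕ => t ^ j / j.factorial *
      (j * y ^ (j - 1) * (2 * R) + j ^ 2 * y ^ (j - 1) * ‖D‖ ^ 2))
      (t * Real.exp (t * y) * (2 * R + ‖D‖ ^ 2) + t * (t * y * Real.exp (t * y)) * ‖D‖ ^ 2) := by
    rw [← hasSum_nat_add_iff' 1]
    simp only [Finset.range_one, Finset.sum_singleton, Nat.cast_zero, zero_mul, ne_eq,
      OfNat.ofNat_ne_zero, not_false_eq_true, zero_pow, add_zero, mul_zero, sub_zero]
    refine ((((hasSum_exp_term (t * y)).mul_left t).mul_right (2 * R + ‖D‖ ^ 2)).add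
      (((hasSum_nat_mul_exp_term (t * y)).mul_left t).mul_right (‖D‖ ^ 2))).congr_fun_eq
      fun n => ?_
    rw [Nat.factorial_succ, Nat.add_sub_cancel]; push_cast
    have : (n.factorial : ℝ) ≠ 0 := by positivity
    field_simp
    ring
  have hnorm : ‖A + t * (starRingEnd ℂ) h * D‖ ^ 2 = ‖A‖ ^ 2 + 2 * t * R + t ^ 2 * y * ‖D‖ ^ 2 := by
    simp only [hy, hR, ← Complex.normSq_eq_norm_sq, Complex.normSq_apply]
    simp; ring
  have hterm : ∀ j : ℕ, t ^ j / j.factorial * ‖A * h ^ j + D * (j * h ^ (j - 1))‖ ^ 2 =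
      ‖A‖ ^ 2 * ((t * y) ^ j / j.factorial) + t ^ j / j.factorial *
      (j * y ^ (j - 1) * (2 * R) + j ^ 2 * y ^ (j - 1) * ‖D‖ ^ 2) := by
    intro j
    rcases j with _ | m
    · simp
    · have e : A * h ^ (m + 1) + D * ((m + 1 : ℕ) * h ^ (m + 1 - 1)) =
          h ^ m * (A * h + ((m + 1 : ℝ) : ℂ) * D) := by
        simp only [Nat.add_sub_cancel]; push_cast; ring
      have e2 : ‖A * h + ((m + 1 : ℝ) : ℂ) * D‖ ^ 2 =
          ‖A‖ ^ 2 * y + 2 * (m + 1) * R + (m + 1) ^ 2 * ‖D‖ ^ 2 := by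
        simp only [hy, hR, ← Complex.normSq_eq_norm_sq, Complex.normSq_apply]
        simp; ring
      rw [e, norm_mul, mul_pow, norm_pow, ← pow_mul, mul_comm m 2, pow_mul, ← hy]
      rw [e2, Nat.add_sub_cancel, mul_pow]
      push_cast
      ring
  simp_rw [hterm]
  rw [show Real.exp (t * y) * (‖A + t * (starRingEnd ℂ) h * D‖ ^ 2 + t * ‖D‖ ^ 2) =
    ‖A‖ ^ 2 * Real.exp (t * y) + (t * Real.exp (t * y) * (2 * R + ‖D‖ ^ 2) +
      t * (t * y * Real.exp (t * y)) * ‖D‖ ^ 2) by rw [hnorm]; ring]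
  exact h0.add h12

lemma le_tsum_weighted_enorm_sq (A G d h : ℂ) {t : ℝ} (ht : 0 ≤ t) :
    ENNReal.ofReal (t * Real.exp (t * ‖h‖ ^ 2)) * (‖G‖ₑ ^ 2 * ‖d‖ₑ ^ 2) ≤
      ∑' j : ℕ, ENNReal.ofReal (t ^ j / j.factorial) *
        ‖A * h ^ j + G * (j * h ^ (j - 1) * d)‖ₑ ^ 2 := by
  have hs := hasSum_weighted_norm_sq A (G * d) h t
  have e : ∀ j : ℕ, ENNReal.ofReal (t ^ j / j.factorial) *
        ‖A * h ^ j + G * (j * h ^ (j - 1) * d)‖ₑ ^ 2 =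
      ENNReal.ofReal (t ^ j / j.factorial * ‖A * h ^ j + G * d * (j * h ^ (j - 1))‖ ^ 2) := by
    intro j
    rw [ENNReal.ofReal_mul (by positivity), ENNReal.ofReal_pow (by positivity), ofReal_norm]
    congr 4; ring
  simp_rw [e]
  rw [← ENNReal.ofReal_tsum_of_nonneg (fun j => by positivity) hs.summable, hs.tsum_eq,
    ← ofReal_norm, ← ofReal_norm, ← ENNReal.ofReal_pow (by positivity),
    ← ENNReal.ofReal_pow (by positivity), ← ENNReal.ofReal_mul (by positivity),
    ← ENNReal.ofReal_mul (by positivity)]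
  apply ENNReal.ofReal_le_ofReal
  rw [norm_mul, mul_pow]
  have := Real.exp_pos (t * ‖h‖ ^ 2)
  nlinarith [mul_nonneg this.le (sq_nonneg ‖A + t * (starRingEnd ℂ) h * (G * d)‖)]

/-- Carleson embedding on `ball 0 ρ` for the measure `|h'|² (ρ² - |z|²) dA`, when `|h|²` admits a
harmonic majorant at bounded distance. -/
lemma lintegral_carleson_le {g h K : ℂ → ℂ} (hg : DifferentiableOn ℂ g (Metric.ball 0 1))
    (hh : DifferentiableOn ℂ h (Metric.ball 0 1)) (hK : DifferentiableOn ℂ K (Metric.ball 0 1))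
    {B : ℝ} (hB : 0 < B) (h0 : ∀ z ∈ Metric.ball (0 : ℂ) 1, ‖h z‖ ^ 2 ≤ (K z).re)
    (h1 : ∀ z ∈ Metric.ball (0 : ℂ) 1, (K z).re ≤ ‖h z‖ ^ 2 + B)
    {ρ : ℝ} (hρ0 : 0 < ρ) (hρ1 : ρ < 1) :
    ∫⁻ z in Metric.ball (0 : ℂ) ρ, ‖g z‖ₑ ^ 2 * ‖deriv h z‖ₑ ^ 2 *
        ENNReal.ofReal (ρ ^ 2 - ‖z‖ ^ 2) ≤
      ENNReal.ofReal (B * Real.exp 1) *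
        ∫⁻ θ in Set.Ioc 0 (2 * Real.pi), ‖g (ρ * circleMap 0 1 θ)‖ₑ ^ 2 := by
  have hsub := Metric.ball_subset_ball (x := (0 : ℂ)) hρ1.le
  set t : ℝ := 1 / B with ht
  have ht0 : 0 < t := by positivity
  set G : ℂ → ℂ := fun z => g z * Complex.exp (-(t / 2) * K z) with hG
  have hGd : DifferentiableOn ℂ G (Metric.ball 0 1) := by fun_prop
  have hGn : ∀ z, ‖G z‖ ^ 2 = ‖g z‖ ^ 2 * Real.exp (-(t * (K z).re)) := by
    intro z
    have : (-((t : ℂ) / 2) * K z).re = -(t / 2) * (K z).re := by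
      have : (-((t : ℂ) / 2) * K z) = ((-(t / 2) : ℝ) : ℂ) * K z := by push_cast; ring
      rw [this, Complex.re_ofReal_mul]
    rw [hG, norm_mul, Complex.norm_exp, mul_pow, this, ← Real.exp_nat_mul]
    congr 2; push_cast; ring
  set p : ℕ → ℂ → ℂ := fun j z => G z * h z ^ j with hp
  have hpd : ∀ j, DifferentiableOn ℂ (p j) (Metric.ball 0 1) := fun j => by fun_prop
  have hderiv : ∀ j, ∀ z ∈ Metric.ball (0 : ℂ) 1, deriv (p j) z =
      deriv G z * h z ^ j + G z * (j * h z ^ (j - 1) * deriv h z) := by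
    intro j z hz
    have hn := Metric.isOpen_ball.mem_nhds hz
    exact ((hGd.differentiableAt hn).hasDerivAt.mul
      ((hh.differentiableAt hn).hasDerivAt.pow j)).deriv
  have hcirc : ∀ θ, (ρ : ℂ) * circleMap 0 1 θ ∈ Metric.ball (0 : ℂ) 1 := by
    intro θ; simp [abs_of_pos hρ0, hρ1]
  have hcont : ∀ j, Continuous fun θ : ℝ => p j (ρ * circleMap 0 1 θ) := fun j =>
    (hpd j).continuousOn.comp_continuous (by fun_prop) hcirc
  have hle : ∀ z ∈ Metric.ball (0 : ℂ) ρ,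
      ENNReal.ofReal (t * Real.exp (-1)) * (‖g z‖ₑ ^ 2 * ‖deriv h z‖ₑ ^ 2 *
        ENNReal.ofReal (ρ ^ 2 - ‖z‖ ^ 2)) ≤
      ∑' j : ℕ, ENNReal.ofReal (t ^ j / j.factorial) *
        (‖deriv (p j) z‖ₑ ^ 2 * ENNReal.ofReal (ρ ^ 2 - ‖z‖ ^ 2)) := by
    intro z hz
    have hz1 := hsub hz
    simp_rw [hderiv _ z hz1, ← mul_assoc (ENNReal.ofReal _), ENNReal.tsum_mul_right]
    gcongr
    refine le_trans ?_ (le_tsum_weighted_enorm_sq (deriv G z) (G z) (deriv h z) (h z) ht0.le)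
    rw [← mul_assoc]
    gcongr ?_ * _
    rw [← ofReal_norm, ← ofReal_norm, ← ENNReal.ofReal_pow (by positivity),
      ← ENNReal.ofReal_pow (by positivity), ← ENNReal.ofReal_mul (by positivity),
      ← ENNReal.ofReal_mul (by positivity), hGn]
    apply ENNReal.ofReal_le_ofReal
    have e : t * Real.exp (t * ‖h z‖ ^ 2) * (‖g z‖ ^ 2 * Real.exp (-(t * (K z).re))) =
        t * Real.exp (t * ‖h z‖ ^ 2 + -(t * (K z).re)) * ‖g z‖ ^ 2 := by
      rw [Real.exp_add]; ring
    rw [e]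
    gcongr
    have : t * (K z).re ≤ t * (‖h z‖ ^ 2 + B) := by gcongr; exact h1 z hz1
    have : t * B = 1 := by rw [ht]; field_simp
    linarith
  have hcirc_le : ∀ θ, ∑' j : ℕ, ENNReal.ofReal (t ^ j / j.factorial) *
      ‖p j (ρ * circleMap 0 1 θ)‖ₑ ^ 2 ≤ ‖g (ρ * circleMap 0 1 θ)‖ₑ ^ 2 := by
    intro θ
    set z := (ρ : ℂ) * circleMap 0 1 θ with hz
    have e : ∀ j : ℕ, ENNReal.ofReal (t ^ j / j.factorial) * ‖p j z‖ₑ ^ 2 =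
        ENNReal.ofReal (‖G z‖ ^ 2 * ((t * ‖h z‖ ^ 2) ^ j / j.factorial)) := by
      intro j
      rw [← ofReal_norm, ← ENNReal.ofReal_pow (by positivity), ← ENNReal.ofReal_mul (by positivity)]
      congr 1
      simp only [hp, norm_mul, norm_pow]; ring
    have hs := (hasSum_exp_term (t * ‖h z‖ ^ 2)).mul_left (‖G z‖ ^ 2)
    simp_rw [e]
    rw [← ENNReal.ofReal_tsum_of_nonneg (fun j => by positivity) hs.summable, hs.tsum_eq,
      ← ofReal_norm, ← ENNReal.ofReal_pow (by positivity), hGn, mul_assoc, ← Real.exp_add]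
    apply ENNReal.ofReal_le_ofReal
    have : t * ‖h z‖ ^ 2 ≤ t * (K z).re := by gcongr; exact h0 z (hcirc θ)
    have : Real.exp (-(t * (K z).re) + t * ‖h z‖ ^ 2) ≤ 1 := Real.exp_le_one_iff.2 (by linarith)
    nlinarith [sq_nonneg ‖g z‖]
  have main : ENNReal.ofReal (t * Real.exp (-1)) *
      ∫⁻ z in Metric.ball (0 : ℂ) ρ, ‖g z‖ₑ ^ 2 * ‖deriv h z‖ₑ ^ 2 *
        ENNReal.ofReal (ρ ^ 2 - ‖z‖ ^ 2) ≤
      ∫⁻ θ in Set.Ioc 0 (2 * Real.pi), ‖g (ρ * circleMap 0 1 θ)‖ₑ ^ 2 := by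
    rw [← lintegral_const_mul' _ _ ENNReal.ofReal_ne_top]
    calc _ ≤ ∫⁻ z in Metric.ball (0 : ℂ) ρ, ∑' j : ℕ, ENNReal.ofReal (t ^ j / j.factorial) *
          (‖deriv (p j) z‖ₑ ^ 2 * ENNReal.ofReal (ρ ^ 2 - ‖z‖ ^ 2)) :=
          setLIntegral_mono' measurableSet_ball hle
      _ = ∑' j : ℕ, ENNReal.ofReal (t ^ j / j.factorial) *
          ∫⁻ z in Metric.ball (0 : ℂ) ρ,
            ‖deriv (p j) z‖ₑ ^ 2 * ENNReal.ofReal (ρ ^ 2 - ‖z‖ ^ 2) := by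
          rw [lintegral_tsum (fun j => by
            have := measurable_deriv (p j)
            fun_prop)]
          exact tsum_congr fun j => lintegral_const_mul' _ _ ENNReal.ofReal_ne_top
      _ ≤ ∑' j : ℕ, ENNReal.ofReal (t ^ j / j.factorial) *
          ∫⁻ θ in Set.Ioc 0 (2 * Real.pi), ‖p j (ρ * circleMap 0 1 θ)‖ₑ ^ 2 := by
          refine ENNReal.tsum_le_tsum fun j => ?_
          gcongr ENNReal.ofReal _ * ?_
          exact lintegral_deriv_le (hpd j) hρ0 hρ1
      _ = ∫⁻ θ in Set.Ioc 0 (2 * Real.pi), ∑' j : ℕ, ENNReal.ofReal (t ^ j / j.factorial) *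
            ‖p j (ρ * circleMap 0 1 θ)‖ₑ ^ 2 := by
          rw [lintegral_tsum (fun j => by
            exact (((hcont j).measurable.enorm.pow_const 2).const_mul _).aemeasurable)]
          exact tsum_congr fun j => (lintegral_const_mul' _ _ ENNReal.ofReal_ne_top).symm
      _ ≤ _ := lintegral_mono hcirc_le
  have hone : ENNReal.ofReal (B * Real.exp 1) * ENNReal.ofReal (t * Real.exp (-1)) = 1 := by
    rw [← ENNReal.ofReal_mul (by positivity)]
    have : B * Real.exp 1 * (t * Real.exp (-1)) = 1 := by
      rw [ht, Real.exp_neg]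
      have := Real.exp_pos 1
      field_simp
    rw [this, ENNReal.ofReal_one]
  calc _ = ENNReal.ofReal (B * Real.exp 1) * (ENNReal.ofReal (t * Real.exp (-1)) *
      ∫⁻ z in Metric.ball (0 : ℂ) ρ, ‖g z‖ₑ ^ 2 * ‖deriv h z‖ₑ ^ 2 *
        ENNReal.ofReal (ρ ^ 2 - ‖z‖ ^ 2)) := by rw [← mul_assoc, hone, one_mul]
    _ ≤ _ := by gcongr

/-- Carleson embedding for `|h'|² (1 - |z|²) dA` on the unit disc, when `|h|²` admits a
harmonic majorant at bounded distance. -/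
lemma lintegral_carleson_powSeries_le {c : ℕ → ℂ} (hc : DiscSummable c) {h K : ℂ → ℂ}
    (hh : DifferentiableOn ℂ h (Metric.ball 0 1)) (hK : DifferentiableOn ℂ K (Metric.ball 0 1))
    {B : ℝ} (hB : 0 < B) (h0 : ∀ z ∈ Metric.ball (0 : ℂ) 1, ‖h z‖ ^ 2 ≤ (K z).re)
    (h1 : ∀ z ∈ Metric.ball (0 : ℂ) 1, (K z).re ≤ ‖h z‖ ^ 2 + B) :
    ∫⁻ z in Metric.ball (0 : ℂ) 1, ‖powSeries c z‖ₑ ^ 2 * ‖deriv h z‖ₑ ^ 2 *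
        ENNReal.ofReal (1 - ‖z‖ ^ 2) ≤
      ENNReal.ofReal (B * Real.exp 1 * (2 * Real.pi)) * ∑' n, ‖c n‖ₑ ^ 2 := by
  have hpi := Real.pi_pos
  have hg := hc.differentiableOn
  set F : ℝ → ℂ → ℝ≥0∞ := fun ρ => (Metric.ball (0 : ℂ) ρ).indicator fun z =>
    ‖powSeries c z‖ₑ ^ 2 * ‖deriv h z‖ₑ ^ 2 * ENNReal.ofReal (ρ ^ 2 - ‖z‖ ^ 2) with hF
  have hmeas : ∀ ρ, AEMeasurable (F ρ) (volume.restrict (Metric.ball (0 : ℂ) 1)) := by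
    intro ρ
    have m1 : AEMeasurable (powSeries c) (volume.restrict (Metric.ball (0 : ℂ) 1)) :=
      hg.continuousOn.aemeasurable measurableSet_ball
    have m2 := measurable_deriv h
    exact AEMeasurable.indicator (by fun_prop) measurableSet_ball
  have hlim : ∀ z ∈ Metric.ball (0 : ℂ) 1, ‖powSeries c z‖ₑ ^ 2 * ‖deriv h z‖ₑ ^ 2 *
        ENNReal.ofReal (1 - ‖z‖ ^ 2) = liminf (fun ρ => F ρ z) (𝓝[<] 1) := by
    intro z hz
    rw [mem_ball_zero_iff] at hz
    refine (Tendsto.liminf_eq ?_).symm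
    have ev : ∀ᶠ ρ : ℝ in 𝓝[<] 1, ‖powSeries c z‖ₑ ^ 2 * ‖deriv h z‖ₑ ^ 2 *
        ENNReal.ofReal (ρ ^ 2 - ‖z‖ ^ 2) = F ρ z := by
      filter_upwards [nhdsWithin_le_nhds (Ioi_mem_nhds hz)] with ρ hρ
      have hm : z ∈ Metric.ball (0 : ℂ) ρ := mem_ball_zero_iff.2 hρ
      simp only [hF, Set.indicator_of_mem hm]
    refine Tendsto.congr' ev (ENNReal.Tendsto.const_mul ?_ (Or.inr (by finiteness)))
    have : Continuous fun ρ : ℝ => ENNReal.ofReal (ρ ^ 2 - ‖z‖ ^ 2) :=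
      ENNReal.continuous_ofReal.comp (by fun_prop)
    have h := this.tendsto 1
    rw [one_pow] at h
    exact h.mono_left nhdsWithin_le_nhds
  rw [setLIntegral_congr_fun measurableSet_ball hlim]
  refine (lintegral_liminf_le' hmeas).trans ?_
  refine liminf_le_of_frequently_le' (Eventually.frequently ?_)
  filter_upwards [self_mem_nhdsWithin, nhdsWithin_le_nhds (Ioi_mem_nhds (zero_lt_one (α := ℝ)))]
    with ρ (hρ1 : ρ < 1) (hρ0 : 0 < ρ)
  rw [hF, setLIntegral_indicator measurableSet_ball,
    Set.inter_eq_left.2 (Metric.ball_subset_ball hρ1.le)]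
  refine (lintegral_carleson_le hg hh hK hB h0 h1 hρ0 hρ1).trans ?_
  rw [lintegral_enorm_sq_circle hc hρ0.le hρ1, ← mul_assoc, ← ENNReal.ofReal_mul (by positivity)]
  gcongr with n
  calc ENNReal.ofReal (ρ ^ (2 * n)) * ‖c n‖ₑ ^ 2 ≤ 1 * ‖c n‖ₑ ^ 2 := by
        gcongr; exact ENNReal.ofReal_le_one.2 (pow_le_one₀ hρ0.le hρ1.le)
    _ = _ := one_mul _

/-- `b` is a.e. the radial boundary function of the power series with coefficients `a`. -/
def IsRadialLimit (a : ℕ → ℂ) (b : ℂ → ℂ) : Prop :=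
  ∀ᵐ θ : ℝ, Tendsto (fun r : ℝ => powSeries a (r * circleMap 0 1 θ)) (𝓝[<] 1)
    (𝓝 (b (circleMap 0 1 θ)))

lemma radial_mem_ball {r : ℝ} (hr0 : 0 ≤ r) (hr1 : r < 1) (θ : ℝ) :
    (r : ℂ) * circleMap 0 1 θ ∈ Metric.ball (0 : ℂ) 1 := by
  simp [abs_of_nonneg hr0, hr1]

lemma DiscSummable.continuous_radial {a : ℕ → ℂ} (ha : DiscSummable a) {r : ℝ} (hr0 : 0 ≤ r)
    (hr1 : r < 1) : Continuous fun θ : ℝ => powSeries a (r * circleMap 0 1 θ) :=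
  ha.differentiableOn.continuousOn.comp_continuous (by fun_prop) (radial_mem_ball hr0 hr1)

lemma eventually_radius : ∀ᶠ r : ℝ in 𝓝[<] 1, 0 ≤ r ∧ r < 1 := by
  filter_upwards [self_mem_nhdsWithin, nhdsWithin_le_nhds (Ioi_mem_nhds (zero_lt_one (α := ℝ)))]
    with r h1 h2
  exact ⟨le_of_lt h2, h1⟩

lemma lintegral_radial_sub_radial {a : ℕ → ℂ} (ha : DiscSummable a) {r s : ℝ} (hr0 : 0 ≤ r)
    (hr1 : r < 1) (hs0 : 0 ≤ s) (hs1 : s < 1) :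
    ∫⁻ θ in Set.Ioc 0 (2 * Real.pi),
      ‖powSeries a (s * circleMap 0 1 θ) - powSeries a (r * circleMap 0 1 θ)‖ₑ ^ 2 =
      ENNReal.ofReal (2 * Real.pi) * ∑' n, ENNReal.ofReal ((s ^ n - r ^ n) ^ 2) * ‖a n‖ₑ ^ 2 := by
  have hs := (ha s hs0 hs1).add (ha r hr0 hr1)
  have hc : Summable fun n => ‖a n * ((s ^ n - r ^ n : ℝ) : ℂ)‖ := by
    refine Summable.of_nonneg_of_le (fun _ => norm_nonneg _) (fun n => ?_) hs
    rw [norm_mul, ← mul_add, Complex.norm_real, Real.norm_eq_abs]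
    gcongr
    rw [abs_le]
    constructor <;> nlinarith [pow_nonneg hs0 n, pow_nonneg hr0 n]
  have h := lintegral_enorm_sq_tsum_circleMap hc 0
  rw [zero_add] at h
  convert h using 3 with θ n
  · congr 2
    have h1 := (ha.hasSum (z := s * circleMap 0 1 θ) (by simpa [abs_of_nonneg hs0] using hs1)).sub
      (ha.hasSum (z := r * circleMap 0 1 θ) (by simpa [abs_of_nonneg hr0] using hr1))
    rw [← h1.tsum_eq]
    refine tsum_congr fun n => ?_
    push_cast
    ring
  · ext n
    rw [enorm_mul, mul_pow, mul_comm]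
    congr 1
    rw [← ofReal_norm, ← ENNReal.ofReal_pow (by positivity), Complex.norm_real, Real.norm_eq_abs,
      sq_abs]


/-- Fatou's lemma for a uniform bound. -/
lemma lintegral_le_of_tendsto {α : Type*} [MeasurableSpace α] {μ : Measure α} {l : Filter ℝ}
    [l.IsCountablyGenerated] [l.NeBot] {F : ℝ → α → ℝ≥0∞} {G : α → ℝ≥0∞} {C : ℝ≥0∞}
    (hm : ∀ᶠ s in l, AEMeasurable (F s) μ)
    (hl : ∀ᵐ x ∂μ, Tendsto (fun s => F s x) l (𝓝 (G x)))
    (hC : ∀ᶠ s in l, ∫⁻ x, F s x ∂μ ≤ C) : ∫⁻ x, G x ∂μ ≤ C := by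
  obtain ⟨u, hu⟩ := l.exists_seq_tendsto
  obtain ⟨N, hN⟩ := eventually_atTop.1 (hu.eventually (hm.and hC))
  have hu' := hu.comp (tendsto_add_atTop_nat N)
  have hae : ∀ᵐ x ∂μ, G x = liminf (fun n => F (u (n + N)) x) atTop := by
    filter_upwards [hl] with x hx
    exact (hx.comp hu').liminf_eq.symm
  rw [lintegral_congr_ae hae]
  refine (lintegral_liminf_le' fun n => (hN _ (Nat.le_add_left N n)).1).trans ?_
  exact liminf_le_of_frequently_le'
    (Frequently.of_forall fun n => (hN _ (Nat.le_add_left N n)).2)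

lemma summable_one_sub_pow_sq_mul {a : ℕ → ℂ} (ha : Summable fun n => ‖a n‖ ^ 2) {r : ℝ}
    (hr0 : 0 ≤ r) (hr1 : r < 1) : Summable fun n => (1 - r ^ n) ^ 2 * ‖a n‖ ^ 2 := by
  refine Summable.of_nonneg_of_le (fun _ => by positivity) (fun n => ?_) ha
  have h1 := pow_nonneg hr0 n
  have h2 := pow_le_one₀ hr0 hr1.le (n := n)
  exact mul_le_of_le_one_left (by positivity) (by nlinarith)

lemma norm_circleMap_sub_pos {w : ℂ} (hw : w ∈ Metric.ball (0 : ℂ) 1) (θ : ℝ) :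
    0 < ‖circleMap 0 1 θ - w‖ := by
  rw [mem_ball_zero_iff] at hw
  have h := norm_sub_norm_le (circleMap 0 1 θ) w
  rw [norm_circleMap_zero, abs_one] at h
  linarith

lemma continuous_poissonKernel_circleMap {w : ℂ} (hw : w ∈ Metric.ball (0 : ℂ) 1) :
    Continuous fun θ => poissonKernel 0 w (circleMap 0 1 θ) := by
  simp only [poissonKernel_def, sub_zero]
  refine Continuous.div (by fun_prop) (by fun_prop) fun θ => ?_
  have := norm_circleMap_sub_pos hw θ
  positivity

lemma poissonKernel_circleMap {w : ℂ} (θ : ℝ) :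
    poissonKernel 0 w (circleMap 0 1 θ) = (1 - ‖w‖ ^ 2) / ‖circleMap 0 1 θ - w‖ ^ 2 := by
  simp [poissonKernel_def]

lemma poissonKernel_circleMap_pos {w : ℂ} (hw : w ∈ Metric.ball (0 : ℂ) 1) (θ : ℝ) :
    0 < poissonKernel 0 w (circleMap 0 1 θ) := by
  rw [poissonKernel_circleMap]
  have := norm_circleMap_sub_pos hw θ
  rw [mem_ball_zero_iff] at hw
  have : 0 < 1 - ‖w‖ ^ 2 := by nlinarith [norm_nonneg w]
  positivity

lemma circleAverage_poissonKernel_eq_one {w : ℂ} (hw : w ∈ Metric.ball (0 : ℂ) 1) :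
    Real.circleAverage (poissonKernel 0 w) 0 1 = 1 := by
  have := (diffContOnCl_const (c := (1 : ℂ)) (s := Metric.ball (0 : ℂ) 1)
    (𝕜 := ℂ)).circleAverage_poissonKernel_smul hw
  simp only [Real.circleAverage_def, Pi.smul_apply', intervalIntegral.integral_smul_const] at this ⊢
  have h := congrArg Complex.re this
  simpa using h

namespace IsRadialLimit

variable {a : ℕ → ℂ} {b : ℂ → ℂ}

lemma lintegral_sub_le (hb : IsRadialLimit a b) (ha : Summable fun n => ‖a n‖ ^ 2)
    {r : ℝ} (hr0 : 0 ≤ r) (hr1 : r < 1) :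
    ∫⁻ θ in Set.Ioc 0 (2 * Real.pi),
      ‖b (circleMap 0 1 θ) - powSeries a (r * circleMap 0 1 θ)‖ₑ ^ 2 ≤
      ENNReal.ofReal ((2 * Real.pi) * ∑' n, (1 - r ^ n) ^ 2 * ‖a n‖ ^ 2) := by
  have hd := discSummable_of_summable_sq ha
  refine lintegral_le_of_tendsto (l := 𝓝[<] 1) (F := fun s θ =>
    ‖powSeries a (s * circleMap 0 1 θ) - powSeries a (r * circleMap 0 1 θ)‖ₑ ^ 2) ?_ ?_ ?_
  · filter_upwards [eventually_radius] with s ⟨hs0, hs1⟩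
    exact (((hd.continuous_radial hs0 hs1).sub
      (hd.continuous_radial hr0 hr1)).measurable.enorm.pow_const 2).aemeasurable
  · filter_upwards [ae_restrict_of_ae hb] with θ hθ
    exact ((ENNReal.continuous_pow 2).tendsto _).comp (hθ.sub_const _).enorm
  · filter_upwards [eventually_radius, nhdsWithin_le_nhds (Ioi_mem_nhds hr1)] with s ⟨hs0, hs1⟩ hs
    have hs : r < s := hs
    rw [lintegral_radial_sub_radial hd hr0 hr1 hs0 hs1,
      ENNReal.ofReal_mul (p := 2 * Real.pi) (by positivity),
      ENNReal.ofReal_tsum_of_nonneg (fun n => by positivity)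
        (summable_one_sub_pow_sq_mul ha hr0 hr1)]
    gcongr with n
    rw [ENNReal.ofReal_mul (by positivity), ENNReal.ofReal_pow (norm_nonneg _), ofReal_norm]
    gcongr
    · have := pow_le_pow_left₀ hr0 hs.le n
      linarith
    · exact pow_le_one₀ hs0 hs1.le

lemma aestronglyMeasurable (hb : IsRadialLimit a b) (ha : Summable fun n => ‖a n‖ ^ 2) :
    AEStronglyMeasurable (fun θ => b (circleMap 0 1 θ)) volume := by
  obtain ⟨u, hu⟩ := (𝓝[<] (1 : ℝ)).exists_seq_tendsto
  obtain ⟨N, hN⟩ := eventually_atTop.1 (hu.eventually eventually_radius)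
  have hu' := hu.comp (tendsto_add_atTop_nat N)
  refine aestronglyMeasurable_of_tendsto_ae atTop
    (f := fun n θ => powSeries a (u (n + N) * circleMap 0 1 θ)) (fun n => ?_) ?_
  · have := hN _ (Nat.le_add_left N n)
    exact ((discSummable_of_summable_sq ha).continuous_radial this.1 this.2).aestronglyMeasurable
  · filter_upwards [hb] with θ hθ
    exact hθ.comp hu'

lemma memLp_sub (hb : IsRadialLimit a b) (ha : Summable fun n => ‖a n‖ ^ 2) {r : ℝ} (hr0 : 0 ≤ r)
    (hr1 : r < 1) :
    MemLp (fun θ => b (circleMap 0 1 θ) - powSeries a (r * circleMap 0 1 θ)) 2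
      (volume.restrict (Set.Ioc 0 (2 * Real.pi))) := by
  refine ⟨((hb.aestronglyMeasurable ha).sub ((discSummable_of_summable_sq ha).continuous_radial
    hr0 hr1).aestronglyMeasurable).restrict, ?_⟩
  rw [eLpNorm_lt_top_iff_lintegral_rpow_enorm_lt_top (by simp) (by simp)]
  simp only [ENNReal.toReal_ofNat, ENNReal.rpow_ofNat]
  exact (hb.lintegral_sub_le ha hr0 hr1).trans_lt ENNReal.ofReal_lt_top

lemma memLp (hb : IsRadialLimit a b) (ha : Summable fun n => ‖a n‖ ^ 2) :
    MemLp (fun θ => b (circleMap 0 1 θ)) 2 (volume.restrict (Set.Ioc 0 (2 * Real.pi))) := by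
  have h := (hb.memLp_sub ha le_rfl zero_lt_one).add (memLp_const (powSeries a 0))
  refine h.congr_norm ?_ ?_
  · exact (hb.aestronglyMeasurable ha).restrict
  · simp

lemma tendsto_eLpNorm (hb : IsRadialLimit a b) (ha : Summable fun n => ‖a n‖ ^ 2) :
    Tendsto (fun r : ℝ => ∫⁻ θ in Set.Ioc 0 (2 * Real.pi),
      ‖b (circleMap 0 1 θ) - powSeries a (r * circleMap 0 1 θ)‖ₑ ^ 2) (𝓝[<] 1) (𝓝 0) := by
  have h : Tendsto (fun r : ℝ => ENNReal.ofReal ((2 * Real.pi) * ∑' n, (1 - r ^ n) ^ 2 * ‖a n‖ ^ 2))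
      (𝓝[<] 1) (𝓝 0) := by
    rw [show (0 : ℝ≥0∞) = ENNReal.ofReal ((2 * Real.pi) * ∑' n : ℕ, (0 : ℝ)) by simp]
    refine ENNReal.tendsto_ofReal (Tendsto.const_mul _ ?_)
    refine tendsto_tsum_of_dominated_convergence ha (fun n => ?_) ?_
    · have : Continuous fun r : ℝ => (1 - r ^ n) ^ 2 * ‖a n‖ ^ 2 := by fun_prop
      simpa using (this.tendsto 1).mono_left nhdsWithin_le_nhds
    · filter_upwards [eventually_radius] with r ⟨hr0, hr1⟩ n
      rw [Real.norm_of_nonneg (by positivity)]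
      have h1 := pow_nonneg hr0 n
      have h2 := pow_le_one₀ hr0 hr1.le (n := n)
      exact mul_le_of_le_one_left (by positivity) (by nlinarith)
  refine tendsto_of_tendsto_of_tendsto_of_le_of_le' tendsto_const_nhds h
    (Eventually.of_forall fun _ => zero_le) ?_
  filter_upwards [eventually_radius] with r ⟨hr0, hr1⟩
  exact hb.lintegral_sub_le ha hr0 hr1

lemma tendsto_integral_mul (hb : IsRadialLimit a b) (ha : Summable fun n => ‖a n‖ ^ 2) {P : ℝ → ℝ}
    (hP : Continuous P) :
    Tendsto (fun r : ℝ => ∫ θ in Set.Ioc 0 (2 * Real.pi),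
      P θ • powSeries a (r * circleMap 0 1 θ)) (𝓝[<] 1)
      (𝓝 (∫ θ in Set.Ioc 0 (2 * Real.pi), P θ • b (circleMap 0 1 θ))) := by
  have hd := discSummable_of_summable_sq ha
  refine tendsto_integral_of_L1 _
    (hP.aestronglyMeasurable.smul (hb.aestronglyMeasurable ha)).restrict ?_ ?_
  · filter_upwards [eventually_radius] with r ⟨hr0, hr1⟩
    exact (hP.smul (hd.continuous_radial hr0 hr1)).integrableOn_Ioc
  · set D := ∫⁻ θ in Set.Ioc 0 (2 * Real.pi), ‖P θ‖ₑ ^ (2 : ℝ) with hD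
    have hDfin : D ≠ ⊤ := by
      have : IntegrableOn (fun θ => P θ ^ 2) (Set.Ioc 0 (2 * Real.pi)) :=
        (hP.pow 2).integrableOn_Ioc
      have := this.2
      simp only [HasFiniteIntegral, enorm_pow] at this
      simpa [hD] using this.ne
    have h2 := (ENNReal.Tendsto.const_mul (a := D ^ (1 / 2 : ℝ))
      (((ENNReal.continuous_rpow_const (y := (1 / 2 : ℝ))).tendsto 0).comp
        (hb.tendsto_eLpNorm ha)) (Or.inr (by finiteness)))
    rw [ENNReal.zero_rpow_of_pos (by norm_num), mul_zero] at h2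
    refine tendsto_of_tendsto_of_tendsto_of_le_of_le' tendsto_const_nhds h2
      (Eventually.of_forall fun _ => zero_le) ?_
    filter_upwards [eventually_radius] with r ⟨hr0, hr1⟩
    have hh := ENNReal.lintegral_mul_le_Lp_mul_Lq (volume.restrict (Set.Ioc 0 (2 * Real.pi)))
      (Real.HolderConjugate.two_two) (f := fun θ => ‖P θ‖ₑ)
      (g := fun θ => ‖b (circleMap 0 1 θ) - powSeries a (r * circleMap 0 1 θ)‖ₑ)
      (by fun_prop) (hb.memLp_sub ha hr0 hr1).1.enorm
    refine le_trans (le_of_eq ?_) (hh.trans (le_of_eq ?_))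
    · refine lintegral_congr fun θ => ?_
      rw [Pi.smul_apply', ← smul_sub, enorm_smul, Pi.mul_apply, ← enorm_neg (_ - _), neg_sub]
    · simp [hD]

/-- The Poisson integral formula in terms of radial boundary values. -/
lemma circleAverage_poissonKernel (hb : IsRadialLimit a b) (ha : Summable fun n => ‖a n‖ ^ 2)
    {w : ℂ} (hw : w ∈ Metric.ball (0 : ℂ) 1) :
    Real.circleAverage (poissonKernel 0 w • b) 0 1 = powSeries a w := by
  have hd := discSummable_of_summable_sq ha
  have hpi := Real.two_pi_pos
  have hP := continuous_poissonKernel_circleMap hw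
  have h := (hb.tendsto_integral_mul ha hP).const_smul (2 * Real.pi)⁻¹
  have h2 : Tendsto (fun r : ℝ => powSeries a (r * w)) (𝓝[<] 1) (𝓝 (powSeries a w)) := by
    have h1 : ContinuousAt (powSeries a) (((1 : ℝ) : ℂ) * w) := by
      rw [Complex.ofReal_one, one_mul]
      exact hd.differentiableOn.continuousOn.continuousAt (Metric.isOpen_ball.mem_nhds hw)
    have h3 : Continuous fun r : ℝ => (r : ℂ) * w := by fun_prop
    have := h1.tendsto.comp (h3.tendsto 1)
    rw [Complex.ofReal_one, one_mul] at this
    exact this.mono_left nhdsWithin_le_nhds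
  rw [Real.circleAverage_def, intervalIntegral.integral_of_le hpi.le]
  refine tendsto_nhds_unique h (h2.congr' ?_)
  filter_upwards [eventually_radius] with r ⟨hr0, hr1⟩
  have hdiff : DiffContOnCl ℂ (fun z => powSeries a (r * z)) (Metric.ball 0 1) := by
    have : DifferentiableOn ℂ (fun z => powSeries a (r * z)) (Metric.closedBall 0 1) := by
      refine hd.differentiableOn.comp (by fun_prop) fun z hz => ?_
      rw [mem_closedBall_zero_iff] at hz
      rw [mem_ball_zero_iff, norm_mul, Complex.norm_real, Real.norm_of_nonneg hr0]
      nlinarith [norm_nonneg z]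
    refine DifferentiableOn.diffContOnCl (this.mono ?_)
    exact Metric.closure_ball_subset_closedBall
  rw [← hdiff.circleAverage_poissonKernel_smul hw, Real.circleAverage_def,
    intervalIntegral.integral_of_le hpi.le]
  rfl

lemma circleIntegrable (hb : IsRadialLimit a b) (ha : Summable fun n => ‖a n‖ ^ 2) :
    CircleIntegrable b 0 1 := by
  rw [CircleIntegrable, intervalIntegrable_iff_integrableOn_Ioc_of_le Real.two_pi_pos.le]
  exact (hb.memLp ha).integrable (by norm_num)

lemma circleIntegrable_norm_sq (hb : IsRadialLimit a b) (ha : Summable fun n => ‖a n‖ ^ 2) :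
    CircleIntegrable (fun ζ => ‖b ζ‖ ^ 2) 0 1 := by
  rw [CircleIntegrable, intervalIntegrable_iff_integrableOn_Ioc_of_le Real.two_pi_pos.le]
  exact (memLp_two_iff_integrable_sq_norm (hb.memLp ha).1).1 (hb.memLp ha)

/-- The least harmonic majorant of `|h|²` is the real part of a holomorphic function `K`, and the
Poisson variance about any constant is expressed through it. -/
lemma exists_majorant (hb : IsRadialLimit a b) (ha : Summable fun n => ‖a n‖ ^ 2) :
    ∃ K : ℂ → ℂ, DifferentiableOn ℂ K (Metric.ball 0 1) ∧ ∀ w ∈ Metric.ball (0 : ℂ) 1, ∀ c : ℂ,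
      Real.circleAverage (fun ζ => poissonKernel 0 w ζ * ‖b ζ - c‖ ^ 2) 0 1 =
        (K w).re - ‖powSeries a w‖ ^ 2 + ‖powSeries a w - c‖ ^ 2 := by
  have hi1 := hb.circleIntegrable ha
  have hi2 := hb.circleIntegrable_norm_sq ha
  have hi2c : CircleIntegrable (fun ζ => ((‖b ζ‖ ^ 2 : ℝ) : ℂ)) 0 1 := by
    rw [CircleIntegrable, intervalIntegrable_iff] at hi2 ⊢
    exact hi2.ofReal
  refine ⟨fun w => Real.circleAverage
    (fun ζ => herglotzRieszKernel 0 w ζ • ((‖b ζ‖ ^ 2 : ℝ) : ℂ)) 0 1,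
    differentiableOn_circleAverage_herglotzRieszKernel_smul hi2c, fun w hw c => ?_⟩
  have hP := continuous_poissonKernel_circleMap hw
  rw [re_circleAverage_herglotzRieszKernel_smul hi2 hw, ← poissonKernel_eq_re_herglotzRieszKernel]
  have k1 := hb.circleAverage_poissonKernel ha hw
  have k0 := circleAverage_poissonKernel_eq_one hw
  simp only [Real.circleAverage_def, intervalIntegral.integral_of_le Real.two_pi_pos.le,
    Pi.smul_apply'] at k0 k1 ⊢
  have i1 : IntegrableOn (fun θ => poissonKernel 0 w (circleMap 0 1 θ) • b (circleMap 0 1 θ))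
      (Set.Ioc 0 (2 * Real.pi)) := by
    have := IntervalIntegrable.continuousOn_smul hi1 hP.continuousOn
    rwa [intervalIntegrable_iff_integrableOn_Ioc_of_le Real.two_pi_pos.le] at this
  have i2 : IntegrableOn (fun θ => poissonKernel 0 w (circleMap 0 1 θ) • ‖b (circleMap 0 1 θ)‖ ^ 2)
      (Set.Ioc 0 (2 * Real.pi)) := by
    have := IntervalIntegrable.continuousOn_smul hi2 hP.continuousOn
    rwa [intervalIntegrable_iff_integrableOn_Ioc_of_le Real.two_pi_pos.le] at this
  have i3 : IntegrableOn (fun θ => (starRingEnd ℂ) c *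
      (poissonKernel 0 w (circleMap 0 1 θ) • b (circleMap 0 1 θ))) (Set.Ioc 0 (2 * Real.pi)) :=
    i1.const_mul _
  have e : ∀ θ, poissonKernel 0 w (circleMap 0 1 θ) * ‖b (circleMap 0 1 θ) - c‖ ^ 2 =
      poissonKernel 0 w (circleMap 0 1 θ) • ‖b (circleMap 0 1 θ)‖ ^ 2 -
      2 * ((starRingEnd ℂ) c * (poissonKernel 0 w (circleMap 0 1 θ) • b (circleMap 0 1 θ))).re +
      poissonKernel 0 w (circleMap 0 1 θ) * ‖c‖ ^ 2 := by
    intro θ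
    simp only [← Complex.normSq_eq_norm_sq, Complex.normSq_apply]
    simp
    ring
  have i4 : IntegrableOn (fun θ => 2 * ((starRingEnd ℂ) c *
      (poissonKernel 0 w (circleMap 0 1 θ) • b (circleMap 0 1 θ))).re) (Set.Ioc 0 (2 * Real.pi)) :=
    i3.re.const_mul 2
  have i5 : IntegrableOn (fun θ => poissonKernel 0 w (circleMap 0 1 θ) • ‖b (circleMap 0 1 θ)‖ ^ 2 -
      2 * ((starRingEnd ℂ) c * (poissonKernel 0 w (circleMap 0 1 θ) • b (circleMap 0 1 θ))).re)
      (Set.Ioc 0 (2 * Real.pi)) := i2.sub i4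
  simp_rw [e]
  rw [integral_add i5 (hP.integrableOn_Ioc.mul_const _),
    integral_sub i2 i4, integral_mul_const, integral_const_mul]
  have e3 : ∫ θ in Set.Ioc 0 (2 * Real.pi), ((starRingEnd ℂ) c *
      (poissonKernel 0 w (circleMap 0 1 θ) • b (circleMap 0 1 θ))).re =
      2 * Real.pi * ((starRingEnd ℂ) c * powSeries a w).re := by
    have := integral_re i3
    simp only [RCLike.re_to_complex] at this
    rw [this, integral_const_mul, ← k1]
    rw [Complex.real_smul]
    have := Real.pi_ne_zero
    rw [show (starRingEnd ℂ) c * (((2 * Real.pi)⁻¹ : ℝ) * ∫ θ in Set.Ioc 0 (2 * Real.pi),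
      poissonKernel 0 w (circleMap 0 1 θ) • b (circleMap 0 1 θ)) = (((2 * Real.pi)⁻¹ : ℝ) : ℂ) *
      ((starRingEnd ℂ) c * ∫ θ in Set.Ioc 0 (2 * Real.pi),
      poissonKernel 0 w (circleMap 0 1 θ) • b (circleMap 0 1 θ)) by ring, Complex.re_ofReal_mul]
    field_simp
  have e4 : ‖powSeries a w - c‖ ^ 2 = ‖powSeries a w‖ ^ 2 -
      2 * ((starRingEnd ℂ) c * powSeries a w).re + ‖c‖ ^ 2 := by
    simp only [← Complex.normSq_eq_norm_sq, Complex.normSq_apply]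
    simp
    ring
  rw [smul_eq_mul] at k0
  rw [e3, e4, smul_eq_mul, smul_eq_mul]
  have hpi : (2 * Real.pi)⁻¹ * (2 * Real.pi) = 1 := inv_mul_cancel₀ Real.two_pi_pos.ne'
  linear_combination ‖c‖ ^ 2 * k0 - 2 * ((starRingEnd ℂ) c * powSeries a w).re * hpi

end IsRadialLimit

lemma enorm_add_sq_le (x y : ℂ) : ‖x + y‖ₑ ^ 2 ≤ 2 * ‖x‖ₑ ^ 2 + 2 * ‖y‖ₑ ^ 2 := by
  simp only [← ofReal_norm]
  rw [← ENNReal.ofReal_pow (norm_nonneg _), ← ENNReal.ofReal_pow (norm_nonneg _),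
    ← ENNReal.ofReal_pow (norm_nonneg _), ← ENNReal.ofReal_ofNat 2,
    ← ENNReal.ofReal_mul (by norm_num), ← ENNReal.ofReal_mul (by norm_num),
    ← ENNReal.ofReal_add (by positivity) (by positivity)]
  apply ENNReal.ofReal_le_ofReal
  have h := norm_add_le x y
  nlinarith [norm_nonneg (x + y), sq_nonneg (‖x‖ - ‖y‖)]

lemma lintegral_enorm_sub_sq_le (u : ℝ → ℂ) (c d : ℂ) (s : Set ℝ) :
    ∫⁻ θ in s, ‖u θ - d‖ₑ ^ 2 ≤
      2 * (∫⁻ θ in s, ‖u θ - c‖ₑ ^ 2) + 2 * (volume s * ‖c - d‖ₑ ^ 2) := by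
  calc ∫⁻ θ in s, ‖u θ - d‖ₑ ^ 2
      ≤ ∫⁻ θ in s, (2 * ‖u θ - c‖ₑ ^ 2 + 2 * ‖c - d‖ₑ ^ 2) := by
        refine lintegral_mono fun θ => ?_
        have := enorm_add_sq_le (u θ - c) (c - d)
        rwa [sub_add_sub_cancel] at this
    _ = _ := by
        rw [lintegral_add_right _ measurable_const, lintegral_const_mul' _ _ (by finiteness),
          lintegral_const, Measure.restrict_apply_univ]
        ring

lemma poissonKernel_polar {ρ : ℝ} (hρ0 : 0 ≤ ρ) (θ₀ θ : ℝ) :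
    poissonKernel 0 (ρ * circleMap 0 1 θ₀) (circleMap 0 1 θ) =
      (1 - ρ ^ 2) / ((1 - ρ) ^ 2 + 4 * ρ * Real.sin ((θ - θ₀) / 2) ^ 2) := by
  rw [poissonKernel_circleMap]
  have e1 : ‖(ρ : ℂ) * circleMap 0 1 θ₀‖ = ρ := by simp [abs_of_nonneg hρ0]
  have e2 : ‖circleMap 0 1 θ - ρ * circleMap 0 1 θ₀‖ ^ 2 =
      (1 - ρ) ^ 2 + 4 * ρ * Real.sin ((θ - θ₀) / 2) ^ 2 := by
    have h : Real.sin ((θ - θ₀) / 2) ^ 2 = (1 - Real.cos (θ - θ₀)) / 2 := by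
      rw [Real.sin_sq_eq_half_sub]; ring_nf
    rw [h, Real.cos_sub, ← Complex.normSq_eq_norm_sq, Complex.normSq_apply]
    simp only [circleMap, zero_add, Complex.ofReal_one, one_mul, Complex.sub_re, Complex.sub_im,
      Complex.re_ofReal_mul, Complex.im_ofReal_mul, Complex.exp_ofReal_mul_I_re,
      Complex.exp_ofReal_mul_I_im]
    linear_combination Real.sin_sq_add_cos_sq θ + ρ ^ 2 * Real.sin_sq_add_cos_sq θ₀
  rw [e1, e2]

lemma sum_half_pow_mul_sq_le (n : ℕ) :
    ∑ j ∈ Finset.range n, (1 / 2 : ℝ) ^ j * (2 + 12 * (j : ℝ) ^ 2) ≤ 76 := by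
  have h : ∑ j ∈ Finset.range n, (1 / 2 : ℝ) ^ j * (2 + 12 * (j : ℝ) ^ 2) =
      76 - (1 / 2) ^ n * (24 * (n : ℝ) ^ 2 + 48 * n + 76) := by
    induction n with
    | zero => simp
    | succ n ih => rw [Finset.sum_range_succ, ih]; push_cast; ring
  rw [h]
  have : 0 ≤ (1 / 2 : ℝ) ^ n * (24 * (n : ℝ) ^ 2 + 48 * n + 76) := by positivity
  linarith

/-- Dyadic covering of a centred interval. -/
lemma exists_dyadic_scale (N : ℕ) {x ℓ : ℝ} (hx : |x| ≤ ℓ) :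
    ∃ k ≤ N, |x| ≤ ℓ * (1 / 2) ^ k ∧ (k = N ∨ ℓ * (1 / 2) ^ (k + 1) < |x|) := by
  induction N with
  | zero => exact ⟨0, le_rfl, by simpa using hx, Or.inl rfl⟩
  | succ N ih =>
    obtain ⟨k, hk, h1, h2⟩ := ih
    rcases h2 with rfl | h2
    · by_cases h : |x| ≤ ℓ * (1 / 2) ^ (k + 1)
      · exact ⟨k + 1, le_rfl, h, Or.inl rfl⟩
      · exact ⟨k, hk.trans (Nat.le_succ _), h1, Or.inr (not_le.1 h)⟩
    · exact ⟨k, hk.trans (Nat.le_succ _), h1, Or.inr h2⟩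

lemma poissonKernel_dyadic_le {ρ : ℝ} (hρ0 : 0 ≤ ρ) (hρ1 : ρ < 1) {N : ℕ}
    (hN1 : (1 / 2 : ℝ) ^ (N + 1) < 1 - ρ) (hN2 : 1 - ρ ≤ (1 / 2) ^ N) {x : ℝ}
    (hx : |x| ≤ Real.pi) :
    ∃ k ≤ N, |x| ≤ Real.pi * (1 / 2) ^ k ∧
      (1 - ρ ^ 2) / ((1 - ρ) ^ 2 + 4 * ρ * Real.sin (x / 2) ^ 2) ≤ 4 * (1 / 2) ^ N * 4 ^ k := by
  obtain ⟨k, hk, h1, h2⟩ := exists_dyadic_scale N hx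
  refine ⟨k, hk, h1, ?_⟩
  have hδ : 0 < 1 - ρ := by linarith
  have hden : 0 < (1 - ρ) ^ 2 + 4 * ρ * Real.sin (x / 2) ^ 2 := by positivity
  rw [div_le_iff₀ hden]
  by_cases hkN : k = N
  · subst hkN
    have e : (4 : ℝ) * (1 / 2) ^ k * 4 ^ k = 4 * 2 ^ k := by
      rw [mul_assoc, ← mul_pow]; norm_num
    have e2 : (1 / 2 : ℝ) ^ k * 2 ^ k = 1 := by rw [← mul_pow]; norm_num
    have h3 : 1 < 2 * 2 ^ k * (1 - ρ) := by
      have := mul_lt_mul_of_pos_left hN1 (by positivity : (0 : ℝ) < 2 * 2 ^ k)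
      rw [pow_succ] at this
      nlinarith
    rw [e]
    have h4 : 0 ≤ (4 : ℝ) * 2 ^ k * (4 * ρ * Real.sin (x / 2) ^ 2) := by positivity
    nlinarith
  · replace h2 := h2.resolve_left hkN
    have hN : 1 ≤ N := by omega
    have hρ2 : 1 / 2 ≤ ρ := by
      have : (1 / 2 : ℝ) ^ N ≤ (1 / 2) ^ 1 := pow_le_pow_of_le_one (by norm_num) (by norm_num) hN
      linarith
    have hs : (1 / 2 : ℝ) ^ (k + 1) ≤ |Real.sin (x / 2)| := by
      have := Real.mul_abs_le_abs_sin (x := x / 2) (by rw [abs_div, abs_two]; linarith)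
      refine le_trans ?_ this
      rw [abs_div, abs_two]
      have hpi := Real.pi_pos
      rw [show 2 / Real.pi * (|x| / 2) = |x| / Real.pi by ring, le_div_iff₀ hpi]
      linarith
    have hs2 : ((1 / 2 : ℝ) ^ (k + 1)) ^ 2 ≤ Real.sin (x / 2) ^ 2 := by
      rw [← sq_abs (Real.sin _)]
      gcongr
    have e : (4 : ℝ) ^ k * ((1 / 2 : ℝ) ^ (k + 1)) ^ 2 = 1 / 4 := by
      rw [pow_succ (1 / 2 : ℝ), mul_pow, ← pow_mul, mul_comm k 2, pow_mul, ← mul_assoc, ← mul_pow]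
      norm_num
    have h4 : 1 / 4 ≤ (4 : ℝ) ^ k * Real.sin (x / 2) ^ 2 := by
      rw [← e]; gcongr
    have hp : (0 : ℝ) < (1 / 2) ^ N := by positivity
    calc 1 - ρ ^ 2 ≤ 2 * (1 / 2) ^ N := by nlinarith
      _ ≤ 4 * (1 / 2) ^ N * (4 * ρ * (4 ^ k * Real.sin (x / 2) ^ 2)) := by
        have : 1 / 2 ≤ 4 * ρ * ((4 : ℝ) ^ k * Real.sin (x / 2) ^ 2) := by nlinarith
        nlinarith
      _ ≤ 4 * (1 / 2) ^ N * 4 ^ k * ((1 - ρ) ^ 2 + 4 * ρ * Real.sin (x / 2) ^ 2) := by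
        have : 0 ≤ 4 * (1 / 2 : ℝ) ^ N * 4 ^ k * (1 - ρ) ^ 2 := by positivity
        nlinarith

lemma enorm_sub_sq_le_of_mean_oscillation {u : ℝ → ℂ}
    (hu : AEStronglyMeasurable u volume) {M : ℝ≥0∞} {c d : ℂ} {s t : Set ℝ}
    (hst : s ⊆ t) {v : ℝ≥0∞} (hs : volume s = v) (hv0 : v ≠ 0) (hv : v ≠ ⊤) (ht : volume t = 2 * v)
    (hc : ∫⁻ θ in t, ‖u θ - c‖ₑ ^ 2 ≤ volume t * M)
    (hd : ∫⁻ θ in s, ‖u θ - d‖ₑ ^ 2 ≤ volume s * M) : ‖c - d‖ₑ ^ 2 ≤ 6 * M := by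
  have h1 : v * ‖c - d‖ₑ ^ 2 ≤ v * (6 * M) := by
    calc v * ‖c - d‖ₑ ^ 2 = ∫⁻ θ in s, ‖c - d‖ₑ ^ 2 := by
          rw [lintegral_const, Measure.restrict_apply_univ, hs, mul_comm]
      _ ≤ 2 * (∫⁻ θ in s, ‖u θ - d‖ₑ ^ 2) + 2 * ∫⁻ θ in s, ‖u θ - c‖ₑ ^ 2 := by
          have hd : AEMeasurable (fun θ => 2 * ‖u θ - d‖ₑ ^ 2) (volume.restrict s) :=
            (((hu.sub aestronglyMeasurable_const).enorm.pow_const 2).const_mul 2).restrict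
          rw [← lintegral_const_mul' _ _ (by finiteness), ← lintegral_const_mul' _ _ (by finiteness),
            ← lintegral_add_left' hd]
          refine lintegral_mono fun θ => ?_
          have := enorm_add_sq_le (u θ - d) (c - u θ)
          rwa [show u θ - d + (c - u θ) = c - d by ring, ← enorm_neg (c - u θ), neg_sub] at this
      _ ≤ 2 * (volume s * M) + 2 * (volume t * M) := by
          gcongr
          exact (lintegral_mono_set hst).trans hc
      _ = v * (6 * M) := by rw [hs, ht]; ring
  exact (ENNReal.mul_le_mul_iff_right hv0 hv).1 h1

/-- Garsia-type bound: bounded mean oscillation controls Poisson variances. -/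
lemma lintegral_poissonKernel_le {u : ℝ → ℂ} (hu : AEStronglyMeasurable u volume) {M : ℝ}
    (hM0 : 0 ≤ M)
    (hM : ∀ α β : ℝ, α < β → β - α ≤ 2 * Real.pi →
      ∃ c : ℂ, ∫⁻ θ in Set.Icc α β, ‖u θ - c‖ₑ ^ 2 ≤ ENNReal.ofReal ((β - α) * M))
    {ρ : ℝ} (hρ0 : 0 ≤ ρ) (hρ1 : ρ < 1) (θ₀ : ℝ) :
    ∃ c : ℂ, ∫⁻ θ in Set.Icc (θ₀ - Real.pi) (θ₀ + Real.pi),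
      ENNReal.ofReal (poissonKernel 0 (ρ * circleMap 0 1 θ₀) (circleMap 0 1 θ)) *
        ‖u θ - c‖ₑ ^ 2 ≤ ENNReal.ofReal (2 * Real.pi * (304 * M)) := by
  have hpi := Real.pi_pos
  obtain ⟨N, hN1, hN2⟩ := exists_nat_pow_near_of_lt_one (x := 1 - ρ) (by linarith) (by linarith)
    (by norm_num : (0 : ℝ) < 1 / 2) (by norm_num)
  set ℓ : ℕ → ℝ := fun k => Real.pi * (1 / 2) ^ k with hℓ
  have hℓ0 : ∀ k, 0 < ℓ k := fun k => by positivity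
  have hℓs : ∀ k, ℓ (k + 1) = ℓ k / 2 := fun k => by simp only [hℓ, pow_succ]; ring
  have hℓ1 : ∀ k, ℓ k ≤ Real.pi := fun k =>
    mul_le_of_le_one_right hpi.le (pow_le_one₀ (by norm_num) (by norm_num))
  set I : ℕ → Set ℝ := fun k => Set.Icc (θ₀ - ℓ k) (θ₀ + ℓ k) with hI
  have hvol : ∀ k, volume (I k) = ENNReal.ofReal (2 * ℓ k) := fun k => by
    rw [hI, Real.volume_Icc]; congr 1; ring
  have hex : ∀ k, ∃ c : ℂ, ∫⁻ θ in I k, ‖u θ - c‖ₑ ^ 2 ≤ ENNReal.ofReal (2 * ℓ k * M) := fun k => by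
    obtain ⟨c, hc⟩ := hM (θ₀ - ℓ k) (θ₀ + ℓ k) (by linarith [hℓ0 k]) (by linarith [hℓ1 k])
    refine ⟨c, hc.trans (le_of_eq ?_)⟩
    congr 1; ring
  choose c hc using hex
  set m : ℝ := Real.sqrt (6 * M) with hm
  have hm2 : m ^ 2 = 6 * M := Real.sq_sqrt (by positivity)
  have hstep : ∀ k, ‖c k - c (k + 1)‖ ≤ m := by
    intro k
    have h := enorm_sub_sq_le_of_mean_oscillation hu (M := ENNReal.ofReal M) (c := c k)
      (d := c (k + 1)) (s := I (k + 1)) (t := I k)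
      (Set.Icc_subset_Icc ?_ ?_) (hvol _) (by simpa using hℓ0 (k + 1)) ENNReal.ofReal_ne_top
      ?_ ?_ ?_
    · refine Real.le_sqrt_of_sq_le ?_
      rw [← ofReal_norm, ← ENNReal.ofReal_pow (norm_nonneg _), ← ENNReal.ofReal_ofNat 6,
        ← ENNReal.ofReal_mul (by norm_num)] at h
      exact (ENNReal.ofReal_le_ofReal_iff (by positivity)).1 h
    · have := hℓs k; linarith [hℓ0 k]
    · have := hℓs k; linarith [hℓ0 k]
    · rw [hvol, hℓs, ← ENNReal.ofReal_ofNat 2, ← ENNReal.ofReal_mul (by norm_num)]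
      congr 1; ring
    · refine (hc k).trans (le_of_eq ?_)
      rw [hvol, ENNReal.ofReal_mul (by have := hℓ0 k; positivity)]
    · refine (hc (k + 1)).trans (le_of_eq ?_)
      rw [hvol, ENNReal.ofReal_mul (by have := hℓ0 (k + 1); positivity)]
  have hfar : ∀ k ≤ N, ‖c k - c N‖ ≤ (N - k : ℕ) * m := by
    have h : ∀ j k : ℕ, ‖c k - c (k + j)‖ ≤ j * m := by
      intro j k
      induction j with
      | zero => simp
      | succ j ih =>
        have := norm_sub_le_norm_sub_add_norm_sub (c k) (c (k + j)) (c (k + (j + 1)))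
        have := hstep (k + j)
        push_cast
        rw [← add_assoc] at *
        linarith
    intro k hk
    have := h (N - k) k
    rwa [Nat.add_sub_cancel' hk] at this
  have hIc : ∀ k ≤ N, ∫⁻ θ in I k, ‖u θ - c N‖ₑ ^ 2 ≤
      ENNReal.ofReal (2 * ℓ k * (M * (2 + 12 * ((N - k : ℕ) : ℝ) ^ 2))) := by
    intro k hk
    refine (lintegral_enorm_sub_sq_le u (c k) (c N) (I k)).trans ?_
    have hl := hℓ0 k
    have h2 : ‖c k - c N‖ ^ 2 ≤ ((N - k : ℕ) : ℝ) ^ 2 * (6 * M) := by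
      rw [← hm2, ← mul_pow]
      exact pow_le_pow_left₀ (norm_nonneg _) (hfar k hk) 2
    calc _ ≤ 2 * ENNReal.ofReal (2 * ℓ k * M) + 2 * (ENNReal.ofReal (2 * ℓ k) *
          ENNReal.ofReal (((N - k : ℕ) : ℝ) ^ 2 * (6 * M))) := by
          gcongr
          · exact hc k
          · exact (hvol k).le
          · rw [← ofReal_norm, ← ENNReal.ofReal_pow (norm_nonneg _)]
            exact ENNReal.ofReal_le_ofReal h2
      _ = _ := by
          rw [← ENNReal.ofReal_mul (by positivity), ← ENNReal.ofReal_ofNat 2,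
            ← ENNReal.ofReal_mul (by positivity), ← ENNReal.ofReal_mul (by positivity),
            ← ENNReal.ofReal_add (by positivity) (by positivity)]
          congr 1; ring
  refine ⟨c N, ?_⟩
  calc _ ≤ ∫⁻ θ in Set.Icc (θ₀ - Real.pi) (θ₀ + Real.pi), ∑ k ∈ Finset.range (N + 1),
        ENNReal.ofReal (4 * (1 / 2) ^ N * 4 ^ k) * (I k).indicator (fun θ => ‖u θ - c N‖ₑ ^ 2) θ := by
        refine setLIntegral_mono' measurableSet_Icc fun θ hθ => ?_
        obtain ⟨k, hk, h1, h2⟩ := poissonKernel_dyadic_le hρ0 hρ1 hN1 hN2 (x := θ - θ₀)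
          (abs_le.2 ⟨by linarith [hθ.1], by linarith [hθ.2]⟩)
        have hmem : θ ∈ I k := by
          rw [abs_le] at h1
          exact ⟨by linarith [h1.1], by linarith [h1.2]⟩
        refine le_trans ?_ (Finset.single_le_sum (fun i _ => zero_le)
          (Finset.mem_range.2 (Nat.lt_succ_of_le hk)))
        rw [Set.indicator_of_mem hmem, poissonKernel_polar hρ0]
        gcongr
    _ ≤ ∫⁻ θ, ∑ k ∈ Finset.range (N + 1),
        ENNReal.ofReal (4 * (1 / 2) ^ N * 4 ^ k) * (I k).indicator (fun θ => ‖u θ - c N‖ₑ ^ 2) θ :=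
        setLIntegral_le_lintegral _ _
    _ = ∑ k ∈ Finset.range (N + 1), ENNReal.ofReal (4 * (1 / 2) ^ N * 4 ^ k) *
          ∫⁻ θ in I k, ‖u θ - c N‖ₑ ^ 2 := by
        have hmeas : ∀ k ∈ Finset.range (N + 1), AEMeasurable (fun θ =>
            ENNReal.ofReal (4 * (1 / 2) ^ N * 4 ^ k) *
              (I k).indicator (fun θ => ‖u θ - c N‖ₑ ^ 2) θ) volume := fun k _ =>
          AEMeasurable.const_mul (AEMeasurable.indicator
            ((hu.sub aestronglyMeasurable_const).enorm.pow_const 2) measurableSet_Icc) _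
        rw [lintegral_finsetSum' _ hmeas]
        refine Finset.sum_congr rfl fun k _ => ?_
        rw [lintegral_const_mul' _ _ ENNReal.ofReal_ne_top, lintegral_indicator measurableSet_Icc]
    _ ≤ ∑ k ∈ Finset.range (N + 1), ENNReal.ofReal (4 * (1 / 2) ^ N * 4 ^ k *
          (2 * ℓ k * (M * (2 + 12 * ((N - k : ℕ) : ℝ) ^ 2)))) := by
        refine Finset.sum_le_sum fun k hk => ?_
        rw [ENNReal.ofReal_mul (p := 4 * (1 / 2) ^ N * 4 ^ k) (by positivity)]
        gcongr
        exact hIc k (Nat.lt_succ_iff.1 (Finset.mem_range.1 hk))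
    _ ≤ _ := by
        rw [← ENNReal.ofReal_sum_of_nonneg fun k _ => by have := hℓ0 k; positivity]
        apply ENNReal.ofReal_le_ofReal
        have e : ∀ k ∈ Finset.range (N + 1), 4 * (1 / 2 : ℝ) ^ N * 4 ^ k *
            (2 * ℓ k * (M * (2 + 12 * ((N - k : ℕ) : ℝ) ^ 2))) = 8 * Real.pi * M *
            ((1 / 2) ^ (N + 1 - 1 - k) * (2 + 12 * ((N + 1 - 1 - k : ℕ) : ℝ) ^ 2)) := by
          intro k hk
          have hk : k ≤ N := Nat.lt_succ_iff.1 (Finset.mem_range.1 hk)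
          have e1 : (1 / 2 : ℝ) ^ N = (1 / 2) ^ (N - k) * (1 / 2) ^ k := by
            rw [← pow_add, Nat.sub_add_cancel hk]
          have e2 : (1 / 2 : ℝ) ^ k * 4 ^ k * (1 / 2) ^ k = 1 := by
            rw [← mul_pow, ← mul_pow]; norm_num
          rw [Nat.add_sub_cancel, hℓ, e1]
          linear_combination 8 * Real.pi * M * (1 / 2 : ℝ) ^ (N - k) *
            (2 + 12 * ((N - k : ℕ) : ℝ) ^ 2) * e2
        rw [Finset.sum_congr rfl e, ← Finset.mul_sum, Finset.sum_range_reflect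
          (fun j : ℕ => (1 / 2 : ℝ) ^ j * (2 + 12 * (j : ℝ) ^ 2)) (N + 1)]
        have := mul_le_mul_of_nonneg_left (sum_half_pow_mul_sq_le (N + 1))
          (by positivity : 0 ≤ 8 * Real.pi * M)
        linarith

lemma ofReal_mul_norm_sq {x : ℝ} (hx : 0 ≤ x) (z : ℂ) :
    ENNReal.ofReal (x * ‖z‖ ^ 2) = ENNReal.ofReal x * ‖z‖ₑ ^ 2 := by
  rw [ENNReal.ofReal_mul hx, ENNReal.ofReal_pow (norm_nonneg _), ofReal_norm]

lemma ofReal_norm_sq {E : Type*} [SeminormedAddGroup E] (z : E) :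
    ENNReal.ofReal (‖z‖ ^ 2) = ‖z‖ₑ ^ 2 := by
  rw [ENNReal.ofReal_pow (norm_nonneg _), ofReal_norm]

lemma eq_norm_mul_circleMap (w : ℂ) : (‖w‖ : ℂ) * circleMap 0 1 w.arg = w := by
  simp [circleMap, Complex.norm_mul_exp_arg_mul_I]

namespace IsRadialLimit

variable {a : ℕ → ℂ} {b : ℂ → ℂ}

lemma circleAverage_le (hb : IsRadialLimit a b) (ha : Summable fun n => ‖a n‖ ^ 2)
    {w : ℂ} (hw : w ∈ Metric.ball (0 : ℂ) 1) {c : ℂ} {R : ℝ} (hR : 0 ≤ R) {θ₀ : ℝ}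
    (h : ∫⁻ θ in Set.Icc (θ₀ - Real.pi) (θ₀ + Real.pi),
      ENNReal.ofReal (poissonKernel 0 w (circleMap 0 1 θ)) * ‖b (circleMap 0 1 θ) - c‖ₑ ^ 2 ≤
        ENNReal.ofReal (2 * Real.pi * R)) :
    Real.circleAverage (fun ζ => poissonKernel 0 w ζ * ‖b ζ - c‖ ^ 2) 0 1 ≤ R := by
  have hpi := Real.pi_pos
  have hu := hb.aestronglyMeasurable ha
  rw [Real.circleAverage_eq_integral_add (θ₀ - Real.pi), intervalIntegral.integral_comp_add_right
    (fun θ => poissonKernel 0 w (circleMap 0 1 θ) * ‖b (circleMap 0 1 θ) - c‖ ^ 2), zero_add,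
    show 2 * Real.pi + (θ₀ - Real.pi) = θ₀ + Real.pi by ring,
    intervalIntegral.integral_of_le (by linarith), ← integral_Icc_eq_integral_Ioc,
    integral_eq_lintegral_of_nonneg_ae]
  · rw [smul_eq_mul, inv_mul_le_iff₀ (by positivity)]
    refine ENNReal.toReal_le_of_le_ofReal (by positivity) ?_
    refine le_trans (le_of_eq ?_) h
    exact lintegral_congr fun θ => ofReal_mul_norm_sq (poissonKernel_circleMap_pos hw θ).le _
  · exact Eventually.of_forall fun θ =>
      mul_nonneg (poissonKernel_circleMap_pos hw θ).le (by positivity)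
  · exact ((continuous_poissonKernel_circleMap hw).aestronglyMeasurable.mul
      ((hu.sub aestronglyMeasurable_const).norm.pow 2)).restrict

/-- Bounded mean oscillation of the boundary function implies the Carleson embedding. -/
lemma lintegral_carleson_le (hb : IsRadialLimit a b) (ha : Summable fun n => ‖a n‖ ^ 2)
    {M : ℝ} (hM0 : 0 ≤ M)
    (hM : ∀ α β : ℝ, α < β → β - α ≤ 2 * Real.pi → ∃ c : ℂ,
      ∫⁻ θ in Set.Icc α β, ‖b (circleMap 0 1 θ) - c‖ₑ ^ 2 ≤ ENNReal.ofReal ((β - α) * M))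
    {c : ℕ → ℂ} (hc : DiscSummable c) :
    ∫⁻ z in Metric.ball (0 : ℂ) 1, ‖powSeries c z‖ₑ ^ 2 * ‖deriv (powSeries a) z‖ₑ ^ 2 *
        ENNReal.ofReal (1 - ‖z‖ ^ 2) ≤
      ENNReal.ofReal ((304 * M + 1) * Real.exp 1 * (2 * Real.pi)) * ∑' n, ‖c n‖ₑ ^ 2 := by
  obtain ⟨K, hK, hKb⟩ := hb.exists_majorant ha
  have hd := discSummable_of_summable_sq ha
  refine lintegral_carleson_powSeries_le hc hd.differentiableOn hK (by positivity)
    (fun w hw => ?_) (fun w hw => ?_)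
  · have h1 := hKb w hw (powSeries a w)
    have h2 : 0 ≤ Real.circleAverage
        (fun ζ => poissonKernel 0 w ζ * ‖b ζ - powSeries a w‖ ^ 2) 0 1 := by
      rw [Real.circleAverage_def, smul_eq_mul]
      refine mul_nonneg (by positivity) (intervalIntegral.integral_nonneg (by positivity) ?_)
      exact fun θ _ => mul_nonneg (poissonKernel_circleMap_pos hw θ).le (by positivity)
    rw [sub_self, norm_zero] at h1
    linarith
  · rw [← eq_norm_mul_circleMap w] at hw
    have hw' := mem_ball_zero_iff.1 hw
    rw [eq_norm_mul_circleMap] at hw'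
    obtain ⟨d, hd⟩ := lintegral_poissonKernel_le (hb.aestronglyMeasurable ha) hM0 hM
      (norm_nonneg w) hw' w.arg
    have h1 := hb.circleAverage_le ha hw (by positivity) hd
    rw [hKb _ hw, eq_norm_mul_circleMap] at h1
    nlinarith [sq_nonneg ‖powSeries a w - d‖]

end IsRadialLimit

/-- The involutive disc automorphism exchanging `0` and `w`. -/
noncomputable def mobius (w z : ℂ) : ℂ := (w - z) / (1 - (starRingEnd ℂ) w * z)

lemma lintegral_image_holomorphic {s : Set ℂ} (hs : MeasurableSet s) {f f' : ℂ → ℂ}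
    (hf' : ∀ z ∈ s, HasDerivAt f (f' z) z) (hf : Set.InjOn f s) (g : ℂ → ℝ≥0∞) :
    ∫⁻ z in f '' s, g z = ∫⁻ z in s, ‖f' z‖ₑ ^ 2 * g (f z) := by
  rw [lintegral_image_eq_lintegral_abs_det_fderiv_mul volume hs
    (fun z hz => ((hf' z hz).hasFDerivAt.restrictScalars ℝ).hasFDerivWithinAt) hf]
  refine lintegral_congr fun z => ?_
  congr 1
  rw [← ofReal_norm_sq]
  congr 1
  simp [ContinuousLinearMap.det, LinearMap.det_restrictScalars, Algebra.norm_complex_eq,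
    Complex.normSq_eq_norm_sq]

section mobius

variable {w z : ℂ}

lemma one_sub_conj_mul_ne_zero (hw : ‖w‖ < 1) (hz : ‖z‖ ≤ 1) : 1 - (starRingEnd ℂ) w * z ≠ 0 := by
  intro h
  have h1 : ‖(starRingEnd ℂ) w * z‖ = 1 := by rw [← sub_eq_zero.1 h, norm_one]
  rw [norm_mul, RCLike.norm_conj] at h1
  nlinarith [norm_nonneg w, norm_nonneg z]

lemma one_sub_norm_sq_mobius (hw : ‖w‖ < 1) (hz : ‖z‖ ≤ 1) : 1 - ‖mobius w z‖ ^ 2 =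
    (1 - ‖w‖ ^ 2) * (1 - ‖z‖ ^ 2) / ‖1 - (starRingEnd ℂ) w * z‖ ^ 2 := by
  have h := norm_pos_iff.2 (one_sub_conj_mul_ne_zero hw hz)
  rw [mobius, norm_div, div_pow, eq_div_iff (by positivity), sub_mul,
    div_mul_cancel₀ _ (by positivity)]
  simp only [← Complex.normSq_eq_norm_sq, Complex.normSq_apply]
  simp
  ring

lemma norm_mobius_lt_one (hw : ‖w‖ < 1) (hz : ‖z‖ < 1) : ‖mobius w z‖ < 1 := by
  have h := one_sub_norm_sq_mobius hw hz.le
  have h0 := norm_pos_iff.2 (one_sub_conj_mul_ne_zero hw hz.le)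
  have h1 : 0 < 1 - ‖w‖ ^ 2 := by nlinarith [norm_nonneg w]
  have h2 : 0 < 1 - ‖z‖ ^ 2 := by nlinarith [norm_nonneg z]
  have : 0 < 1 - ‖mobius w z‖ ^ 2 := by rw [h]; positivity
  nlinarith [norm_nonneg (mobius w z)]

lemma norm_mobius_le_one (hw : ‖w‖ < 1) (hz : ‖z‖ ≤ 1) : ‖mobius w z‖ ≤ 1 := by
  have h := one_sub_norm_sq_mobius hw hz
  have h1 : 0 ≤ 1 - ‖w‖ ^ 2 := by nlinarith [norm_nonneg w]
  have h2 : 0 ≤ 1 - ‖z‖ ^ 2 := by nlinarith [norm_nonneg z]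
  have : 0 ≤ 1 - ‖mobius w z‖ ^ 2 := by rw [h]; positivity
  nlinarith [norm_nonneg (mobius w z)]

lemma norm_mobius_eq_one (hw : ‖w‖ < 1) (hz : ‖z‖ = 1) : ‖mobius w z‖ = 1 := by
  have h := one_sub_norm_sq_mobius hw hz.le
  rw [hz] at h
  have : ‖mobius w z‖ ^ 2 = 1 := by linear_combination -h
  nlinarith [norm_nonneg (mobius w z)]

lemma mobius_mobius (hw : ‖w‖ < 1) (hz : ‖z‖ ≤ 1) : mobius w (mobius w z) = z := by
  have h1 := one_sub_conj_mul_ne_zero hw hz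
  have h2 := one_sub_conj_mul_ne_zero hw (norm_mobius_le_one hw hz)
  conv_lhs => rw [mobius]
  rw [div_eq_iff h2, mobius]
  generalize (starRingEnd ℂ) w = v at *
  have e : (w - z) / (1 - v * z) * (1 - v * z) = w - z := div_mul_cancel₀ _ h1
  refine mul_right_cancel₀ h1 ?_
  linear_combination (z * v - 1) * e

lemma hasDerivAt_mobius (hw : ‖w‖ < 1) (hz : ‖z‖ ≤ 1) :
    HasDerivAt (mobius w) (-(1 - (starRingEnd ℂ) w * w) / (1 - (starRingEnd ℂ) w * z) ^ 2) z := by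
  have h1 := one_sub_conj_mul_ne_zero hw hz
  have := ((hasDerivAt_id z).const_sub w).div
    (((hasDerivAt_id z).const_mul ((starRingEnd ℂ) w)).const_sub 1) h1
  refine HasDerivAt.congr_deriv this ?_
  simp only [id_eq]
  ring

lemma image_mul_mobius (hw : ‖w‖ < 1) {r : ℝ} (hr : 0 < r) :
    (fun z => (r : ℂ) * mobius w z) '' Metric.ball 0 1 = Metric.ball 0 r := by
  have hr' : (r : ℂ) ≠ 0 := by exact_mod_cast hr.ne'
  ext ζ
  simp only [Set.mem_image, mem_ball_zero_iff]
  constructor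
  · rintro ⟨z, hz, rfl⟩
    rw [norm_mul, Complex.norm_real, Real.norm_of_nonneg hr.le]
    nlinarith [norm_mobius_lt_one hw hz]
  · intro hζ
    have h1 : ‖ζ / r‖ < 1 := by
      rwa [norm_div, Complex.norm_real, Real.norm_of_nonneg hr.le, div_lt_one hr]
    exact ⟨mobius w (ζ / r), norm_mobius_lt_one hw h1, by
      rw [mobius_mobius hw h1.le, mul_div_cancel₀ _ hr']⟩

lemma injOn_mul_mobius (hw : ‖w‖ < 1) {r : ℝ} (hr : 0 < r) :
    Set.InjOn (fun z => (r : ℂ) * mobius w z) (Metric.ball 0 1) := by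
  intro x hx y hy hxy
  rw [mem_ball_zero_iff] at hx hy
  have h := mul_left_cancel₀ (by exact_mod_cast hr.ne' : (r : ℂ) ≠ 0) hxy
  rw [← mobius_mobius hw hx.le, h, mobius_mobius hw hy.le]

end mobius

lemma norm_one_sub_conj_mul_le {w ζ : ℂ} {r : ℝ} (hwr : ‖w‖ ≤ r) (hr : 0 < r) (hr1 : r < 1)
    (hζ : ‖ζ‖ < r) :
    ‖1 - (starRingEnd ℂ) w * ζ‖ ≤ 2 * ‖1 - (starRingEnd ℂ) w * (ζ / r)‖ := by
  have hr' : (r : ℂ) ≠ 0 := by exact_mod_cast hr.ne'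
  have hwn := norm_nonneg w
  have e : 1 - (starRingEnd ℂ) w * ζ = (1 - (starRingEnd ℂ) w * (ζ / r)) +
      (1 - r : ℝ) * ((starRingEnd ℂ) w * (ζ / r)) := by
    push_cast; field_simp; ring
  have h1 : ‖(starRingEnd ℂ) w * (ζ / r)‖ ≤ ‖w‖ := by
    rw [norm_mul, RCLike.norm_conj, norm_div, Complex.norm_real, Real.norm_of_nonneg hr.le]
    exact mul_le_of_le_one_right hwn ((div_le_one hr).2 hζ.le)
  have h2 := norm_sub_norm_le 1 ((starRingEnd ℂ) w * (ζ / r))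
  rw [norm_one] at h2
  rw [e]
  refine (norm_add_le _ _).trans ?_
  rw [norm_mul (((1 - r : ℝ) : ℂ)), Complex.norm_real, Real.norm_of_nonneg (by linarith)]
  nlinarith

lemma lintegral_deriv_comp_mobius_le {h : ℂ → ℂ} (hh : DifferentiableOn ℂ h (Metric.ball 0 1))
    {w : ℂ} {r : ℝ} (hwr : ‖w‖ ≤ r) (hr : 0 < r) (hr1 : r < 1) {C : ℝ}
    (hC : ∫⁻ z in Metric.ball (0 : ℂ) 1, ENNReal.ofReal (1 / ‖1 - (starRingEnd ℂ) w * z‖ ^ 2) *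
      ‖deriv h z‖ₑ ^ 2 * ENNReal.ofReal (1 - ‖z‖ ^ 2) ≤ ENNReal.ofReal (C / (1 - ‖w‖ ^ 2))) :
    ∫⁻ z in Metric.ball (0 : ℂ) 1, ‖deriv (fun z => h (r * mobius w z)) z‖ₑ ^ 2 *
      ENNReal.ofReal (1 - ‖z‖ ^ 2) ≤ ENNReal.ofReal (4 * C) := by
  have hw : ‖w‖ < 1 := hwr.trans_lt hr1
  have hw2 : 0 < 1 - ‖w‖ ^ 2 := by nlinarith [norm_nonneg w]
  have hr' : (r : ℂ) ≠ 0 := by exact_mod_cast hr.ne'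
  have hΦ : ∀ z ∈ Metric.ball (0 : ℂ) 1, HasDerivAt (fun z => (r : ℂ) * mobius w z)
      (r * (-(1 - (starRingEnd ℂ) w * w) / (1 - (starRingEnd ℂ) w * z) ^ 2)) z := fun z hz =>
    (hasDerivAt_mobius hw (mem_ball_zero_iff.1 hz).le).const_mul _
  have hsub : Metric.ball (0 : ℂ) r ⊆ Metric.ball 0 1 := Metric.ball_subset_ball hr1.le
  have key := lintegral_image_holomorphic measurableSet_ball hΦ (injOn_mul_mobius hw hr)
    fun ζ => ‖deriv h ζ‖ₑ ^ 2 * ENNReal.ofReal (1 - ‖mobius w (ζ / r)‖ ^ 2)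
  rw [image_mul_mobius hw hr] at key
  calc _ = ∫⁻ ζ in Metric.ball (0 : ℂ) r,
        ‖deriv h ζ‖ₑ ^ 2 * ENNReal.ofReal (1 - ‖mobius w (ζ / r)‖ ^ 2) := by
        rw [key]
        refine setLIntegral_congr_fun measurableSet_ball fun z hz => ?_
        have hz1 := (mem_ball_zero_iff.1 hz).le
        have hm : (r : ℂ) * mobius w z ∈ Metric.ball (0 : ℂ) 1 := by
          apply hsub
          rw [← image_mul_mobius hw hr]
          exact Set.mem_image_of_mem _ hz
        have hd := ((hh.differentiableAt (Metric.isOpen_ball.mem_nhds hm)).hasDerivAt.comp z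
          (hΦ z hz)).deriv
        simp only [Function.comp_def] at hd
        rw [hd, mul_div_cancel_left₀ _ hr', mobius_mobius hw hz1, enorm_mul, mul_pow]
        ring
    _ ≤ ∫⁻ ζ in Metric.ball (0 : ℂ) r, ENNReal.ofReal (4 * (1 - ‖w‖ ^ 2)) *
          (ENNReal.ofReal (1 / ‖1 - (starRingEnd ℂ) w * ζ‖ ^ 2) *
            ‖deriv h ζ‖ₑ ^ 2 * ENNReal.ofReal (1 - ‖ζ‖ ^ 2)) := by
        refine setLIntegral_mono' measurableSet_ball fun ζ hζ => ?_
        have hζ1 := mem_ball_zero_iff.1 hζ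
        have hn : ‖ζ / r‖ = ‖ζ‖ / r := by
          rw [norm_div, Complex.norm_real, Real.norm_of_nonneg hr.le]
        have h1 : ‖ζ / r‖ ≤ 1 := by rw [hn]; exact (div_le_one hr).2 hζ1.le
        have h2 : ‖ζ‖ ≤ ‖ζ / r‖ := by
          rw [hn]; exact le_div_self (norm_nonneg _) hr hr1.le
        have p1 := norm_pos_iff.2 (one_sub_conj_mul_ne_zero hw h1)
        have p2 := norm_pos_iff.2 (one_sub_conj_mul_ne_zero hw (hζ1.le.trans hr1.le))
        have h3 := norm_one_sub_conj_mul_le hwr hr hr1 hζ1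
        have h4 : 0 ≤ 1 - ‖ζ‖ ^ 2 := by nlinarith [norm_nonneg ζ]
        rw [mul_comm (ENNReal.ofReal (1 / _)), mul_assoc, mul_left_comm]
        gcongr
        rw [← ENNReal.ofReal_mul (by positivity), ← ENNReal.ofReal_mul (by positivity),
          one_sub_norm_sq_mobius hw h1]
        apply ENNReal.ofReal_le_ofReal
        have h5 : 1 / ‖1 - (starRingEnd ℂ) w * (ζ / r)‖ ^ 2 ≤
            4 * (1 / ‖1 - (starRingEnd ℂ) w * ζ‖ ^ 2) := by
          rw [mul_one_div, div_le_div_iff₀ (by positivity) (by positivity)]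
          nlinarith
        have h6 : 1 - ‖ζ / r‖ ^ 2 ≤ 1 - ‖ζ‖ ^ 2 := by nlinarith [norm_nonneg ζ]
        calc (1 - ‖w‖ ^ 2) * (1 - ‖ζ / r‖ ^ 2) / ‖1 - (starRingEnd ℂ) w * (ζ / r)‖ ^ 2
            = (1 - ‖w‖ ^ 2) * (1 - ‖ζ / r‖ ^ 2) *
              (1 / ‖1 - (starRingEnd ℂ) w * (ζ / r)‖ ^ 2) := by ring
          _ ≤ (1 - ‖w‖ ^ 2) * (1 - ‖ζ‖ ^ 2) * (4 * (1 / ‖1 - (starRingEnd ℂ) w * ζ‖ ^ 2)) := by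
              gcongr
          _ = _ := by ring
    _ ≤ ENNReal.ofReal (4 * (1 - ‖w‖ ^ 2)) * ENNReal.ofReal (C / (1 - ‖w‖ ^ 2)) := by
        rw [lintegral_const_mul' _ _ ENNReal.ofReal_ne_top]
        gcongr
        exact (lintegral_mono_set hsub).trans hC
    _ = _ := by
        rw [← ENNReal.ofReal_mul (by positivity)]
        congr 1
        field_simp

lemma hasDerivAt_mobius_circleMap {w : ℂ} (hw : ‖w‖ < 1) (θ : ℝ) :
    HasDerivAt (fun θ => mobius w (circleMap 0 1 θ))
      (Complex.I * poissonKernel 0 w (circleMap 0 1 θ) * mobius w (circleMap 0 1 θ)) θ := by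
  have hz : ‖circleMap 0 1 θ‖ = 1 := by simp
  have h := (hasDerivAt_mobius hw hz.le).comp θ (hasDerivAt_circleMap 0 1 θ)
  refine h.congr_deriv ?_
  have h1 := one_sub_conj_mul_ne_zero hw hz.le
  have h2 : circleMap 0 1 θ - w ≠ 0 :=
    norm_pos_iff.1 (norm_circleMap_sub_pos (mem_ball_zero_iff.2 hw) θ)
  have h3 : ((poissonKernel 0 w (circleMap 0 1 θ) : ℝ) : ℂ) *
      ((circleMap 0 1 θ - w) * (1 - (starRingEnd ℂ) w * circleMap 0 1 θ)) =
      (1 - (starRingEnd ℂ) w * w) * circleMap 0 1 θ := by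
    have h4 : ((starRingEnd ℂ) (circleMap 0 1 θ)) * circleMap 0 1 θ = 1 := by
      rw [Complex.conj_mul', hz]; simp
    have h5 : 1 - (starRingEnd ℂ) w * circleMap 0 1 θ =
        (starRingEnd ℂ) (circleMap 0 1 θ - w) * circleMap 0 1 θ := by
      rw [map_sub, sub_mul, h4]
    have h6 : ((‖circleMap 0 1 θ - w‖ : ℂ)) ≠ 0 := by simpa using h2
    rw [h5, ← mul_assoc (circleMap 0 1 θ - w), Complex.mul_conj', poissonKernel_circleMap,
      Complex.conj_mul']
    push_cast
    field_simp
  rw [mobius]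
  field_simp
  linear_combination h3

lemma exists_mobius_circleMap_eq {w : ℂ} (hw : ‖w‖ < 1) : ∃ τ : ℝ, ∀ θ : ℝ,
    mobius w (circleMap 0 1 θ) =
      circleMap 0 1 ((∫ t in 0..θ, poissonKernel 0 w (circleMap 0 1 t)) + τ) := by
  have hP := continuous_poissonKernel_circleMap (mem_ball_zero_iff.2 hw)
  set ψ : ℝ → ℝ := fun θ => ∫ t in 0..θ, poissonKernel 0 w (circleMap 0 1 t) with hψ
  have hd : ∀ θ, HasDerivAt ψ (poissonKernel 0 w (circleMap 0 1 θ)) θ := fun θ =>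
    (hP.integral_hasStrictDerivAt 0 θ).hasDerivAt
  set E : ℝ → ℂ := fun θ => mobius w (circleMap 0 1 θ) * Complex.exp (-(ψ θ * Complex.I)) with hE
  have hE0 : ∀ θ, HasDerivAt E 0 θ := by
    intro θ
    have := (hasDerivAt_mobius_circleMap hw θ).mul
      (((hd θ).ofReal_comp.mul_const Complex.I).neg.cexp)
    refine this.congr_deriv ?_
    ring
  have hc : ∀ θ, E θ = E 0 := fun θ => is_const_of_deriv_eq_zero
    (fun x => (hE0 x).differentiableAt) (fun x => (hE0 x).deriv) θ 0
  have h0 : ‖E 0‖ = 1 := by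
    simp only [hE, norm_mul, norm_mobius_eq_one hw (show ‖circleMap 0 1 0‖ = 1 by simp), one_mul]
    rw [← neg_mul, ← Complex.ofReal_neg, Complex.norm_exp_ofReal_mul_I]
  refine ⟨(E 0).arg, fun θ => ?_⟩
  have h1 := eq_norm_mul_circleMap (E 0)
  rw [h0, Complex.ofReal_one, one_mul, ← hc θ] at h1
  have h2 : mobius w (circleMap 0 1 θ) = E θ * Complex.exp (ψ θ * Complex.I) := by
    rw [hE, mul_assoc, ← Complex.exp_add]; simp
  change _ = circleMap 0 1 (ψ θ + _)
  rw [h2, ← h1, hc θ]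
  generalize ψ θ = t
  simp only [circleMap, zero_add, Complex.ofReal_one, one_mul, Complex.ofReal_add, add_mul,
    Complex.exp_add]
  rw [mul_comm]

/-- Change of variables by a disc automorphism on the unit circle. -/
lemma integral_comp_mobius_mul {w : ℂ} (hw : ‖w‖ < 1) {F : ℂ → ℝ}
    (hF : Continuous fun θ : ℝ => F (circleMap 0 1 θ)) :
    ∫ θ in 0..2 * Real.pi, F (mobius w (circleMap 0 1 θ)) * poissonKernel 0 w (circleMap 0 1 θ) =
      ∫ θ in 0..2 * Real.pi, F (circleMap 0 1 θ) := by
  have hw' := mem_ball_zero_iff.2 hw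
  have hP := continuous_poissonKernel_circleMap hw'
  obtain ⟨τ, hτ⟩ := exists_mobius_circleMap_eq hw
  have h2 : ∫ t in 0..2 * Real.pi, poissonKernel 0 w (circleMap 0 1 t) = 2 * Real.pi := by
    have h := circleAverage_poissonKernel_eq_one hw'
    rwa [Real.circleAverage_def, smul_eq_mul, inv_mul_eq_one₀ Real.two_pi_pos.ne', eq_comm] at h
  have h := intervalIntegral.integral_comp_mul_deriv (a := 0) (b := 2 * Real.pi)
    (f := fun θ => (∫ t in 0..θ, poissonKernel 0 w (circleMap 0 1 t)) + τ)
    (fun θ _ => (hP.integral_hasStrictDerivAt 0 θ).hasDerivAt.add_const τ) hP.continuousOn hF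
  simp only [Function.comp_def, ← hτ] at h
  rw [h, intervalIntegral.integral_same, h2, zero_add, add_comm (2 * Real.pi)]
  have hper : (fun θ => F (circleMap 0 1 θ)).Periodic (2 * Real.pi) := fun x => by
    simp only [periodic_circleMap 0 1 x]
  have := hper.intervalIntegral_add_eq τ 0
  rwa [zero_add] at this

lemma lintegral_poissonKernel_radial_le {h : ℂ → ℂ}
    (hh : DifferentiableOn ℂ h (Metric.ball 0 1)) {w : ℂ} {r : ℝ} (hwr : ‖w‖ ≤ r) (hr : 0 < r)
    (hr1 : r < 1) {C : ℝ}
    (hC : ∫⁻ z in Metric.ball (0 : ℂ) 1, ENNReal.ofReal (1 / ‖1 - (starRingEnd ℂ) w * z‖ ^ 2) *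
      ‖deriv h z‖ₑ ^ 2 * ENNReal.ofReal (1 - ‖z‖ ^ 2) ≤ ENNReal.ofReal (C / (1 - ‖w‖ ^ 2))) :
    ∫⁻ θ in Set.Ioc 0 (2 * Real.pi), ENNReal.ofReal (poissonKernel 0 w (circleMap 0 1 θ)) *
      ‖h (r * circleMap 0 1 θ) - h (r * w)‖ₑ ^ 2 ≤ ENNReal.ofReal (16 * C) := by
  have hw : ‖w‖ < 1 := hwr.trans_lt hr1
  have hpi := Real.two_pi_pos
  have hP := continuous_poissonKernel_circleMap (mem_ball_zero_iff.2 hw)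
  have hmem : ∀ z : ℂ, ‖z‖ ≤ 1 → (r : ℂ) * mobius w z ∈ Metric.ball (0 : ℂ) 1 := fun z hz => by
    rw [mem_ball_zero_iff, norm_mul, Complex.norm_real, Real.norm_of_nonneg hr.le]
    nlinarith [norm_mobius_le_one hw hz, norm_nonneg (mobius w z)]
  set H : ℂ → ℂ := fun z => h (r * mobius w z) with hH
  have hHd : ∀ z : ℂ, ‖z‖ ≤ 1 → DifferentiableAt ℂ H z := fun z hz =>
    DifferentiableAt.comp z
      (hh.differentiableAt (Metric.isOpen_ball.mem_nhds (hmem z hz)))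
      ((hasDerivAt_mobius hw hz).const_mul (r : ℂ)).differentiableAt
  have hH0 : H 0 = h (r * w) := by simp [hH, mobius]
  have h1 : ∫⁻ θ in Set.Ioc 0 (2 * Real.pi), ‖H (circleMap 0 1 θ) - H 0‖ₑ ^ 2 ≤
      ENNReal.ofReal (16 * C) := by
    have hcont : ∀ s : ℝ, 0 ≤ s ∧ s < 1 → Continuous fun θ : ℝ => H (s * circleMap 0 1 θ) :=
      fun s hs => continuous_iff_continuousAt.2 fun θ => by
        have h2 : ContinuousAt H (s * circleMap 0 1 θ) :=
          (hHd _ (mem_ball_zero_iff.1 (radial_mem_ball hs.1 hs.2 θ)).le).continuousAt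
        exact h2.comp_of_eq (by fun_prop) rfl
    refine lintegral_le_of_tendsto (l := 𝓝[<] 1) (F := fun (s : ℝ) θ =>
      ‖H (s * circleMap 0 1 θ) - H 0‖ₑ ^ 2) ?_ ?_ ?_
    · filter_upwards [eventually_radius] with s hs
      exact (((hcont s hs).sub continuous_const).measurable.enorm.pow_const 2).aemeasurable
    · refine Eventually.of_forall fun θ => ?_
      have h2 : Tendsto (fun s : ℝ => (s : ℂ) * circleMap 0 1 θ) (𝓝[<] 1)
          (𝓝 (circleMap 0 1 θ)) := by
        have h3 : Continuous fun s : ℝ => (s : ℂ) * circleMap 0 1 θ := by fun_prop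
        have := (h3.tendsto 1).mono_left (nhdsWithin_le_nhds (s := Set.Iio 1))
        simpa using this
      have h3 : Tendsto H (𝓝 (circleMap 0 1 θ)) (𝓝 (H (circleMap 0 1 θ))) :=
        (hHd _ (by simp)).continuousAt
      exact ((ENNReal.continuous_pow 2).tendsto _).comp ((h3.comp h2).sub_const _).enorm
    · filter_upwards [eventually_radius] with s hs
      refine (lintegral_circle_sub_le (p := H) (fun z hz =>
        (hHd z (mem_ball_zero_iff.1 hz).le).differentiableWithinAt) hs.1 hs.2).trans ?_
      rw [show 16 * C = 4 * (4 * C) by ring, ENNReal.ofReal_mul (p := 4) (by norm_num),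
        ENNReal.ofReal_ofNat]
      gcongr
      exact lintegral_deriv_comp_mobius_le hh hwr hr hr1 hC
  refine le_trans (le_of_eq ?_) h1
  have hF : Continuous fun θ : ℝ => ‖H (circleMap 0 1 θ) - H 0‖ ^ 2 := by
    refine ((continuous_iff_continuousAt.2 fun θ => ?_).sub continuous_const).norm.pow 2
    exact (hHd _ (by simp)).continuousAt.comp_of_eq (continuous_circleMap 0 1).continuousAt rfl
  have hFr : Continuous fun θ : ℝ => ‖h (r * circleMap 0 1 θ) - h (r * w)‖ ^ 2 *
      poissonKernel 0 w (circleMap 0 1 θ) :=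
    (((hh.continuousOn.comp_continuous (by fun_prop) (radial_mem_ball hr.le hr1)).sub
      continuous_const).norm.pow 2).mul hP
  have key := integral_comp_mobius_mul hw (F := fun z => ‖H z - H 0‖ ^ 2) hF
  rw [intervalIntegral.integral_of_le hpi.le, intervalIntegral.integral_of_le hpi.le] at key
  have e : ∀ θ : ℝ, H (mobius w (circleMap 0 1 θ)) = h (r * circleMap 0 1 θ) := fun θ => by
    rw [hH]; simp only; rw [mobius_mobius hw (by simp)]
  simp only [e, hH0] at key
  have hint : ∀ {f : ℝ → ℝ}, Continuous f → IntegrableOn f (Set.Ioc 0 (2 * Real.pi)) :=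
    fun hf => (hf.integrableOn_Icc).mono_set Set.Ioc_subset_Icc_self
  have key2 := congrArg ENNReal.ofReal key
  rw [hH0] at hF ⊢
  rw [ofReal_integral_eq_lintegral_ofReal (hint hFr) (Eventually.of_forall fun θ =>
      mul_nonneg (by positivity) (poissonKernel_circleMap_pos (mem_ball_zero_iff.2 hw) θ).le),
    ofReal_integral_eq_lintegral_ofReal (hint hF)
      (Eventually.of_forall fun θ => by positivity)] at key2
  simp only [ofReal_norm_sq] at key2
  rw [← key2]
  refine lintegral_congr fun θ => ?_
  rw [mul_comm (‖_‖ ^ 2), ofReal_mul_norm_sq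
    (poissonKernel_circleMap_pos (mem_ball_zero_iff.2 hw) θ).le]

lemma IsRadialLimit.lintegral_poissonKernel_sub_le {a : ℕ → ℂ} {b : ℂ → ℂ}
    (hb : IsRadialLimit a b) (ha : Summable fun n => ‖a n‖ ^ 2) {w : ℂ} (hw : ‖w‖ < 1) {C : ℝ}
    (hC : ∫⁻ z in Metric.ball (0 : ℂ) 1, ENNReal.ofReal (1 / ‖1 - (starRingEnd ℂ) w * z‖ ^ 2) *
      ‖deriv (powSeries a) z‖ₑ ^ 2 * ENNReal.ofReal (1 - ‖z‖ ^ 2) ≤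
        ENNReal.ofReal (C / (1 - ‖w‖ ^ 2))) :
    ∫⁻ θ in Set.Ioc 0 (2 * Real.pi), ENNReal.ofReal (poissonKernel 0 w (circleMap 0 1 θ)) *
      ‖b (circleMap 0 1 θ) - powSeries a w‖ₑ ^ 2 ≤ ENNReal.ofReal (16 * C) := by
  have hd := discSummable_of_summable_sq ha
  have hP := continuous_poissonKernel_circleMap (mem_ball_zero_iff.2 hw)
  refine lintegral_le_of_tendsto (l := 𝓝[<] 1) (F := fun (s : ℝ) θ =>
    ENNReal.ofReal (poissonKernel 0 w (circleMap 0 1 θ)) *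
      ‖powSeries a (s * circleMap 0 1 θ) - powSeries a (s * w)‖ₑ ^ 2) ?_ ?_ ?_
  · filter_upwards [eventually_radius] with s hs
    exact (hP.measurable.ennreal_ofReal.mul (((hd.continuous_radial hs.1 hs.2).sub
      continuous_const).measurable.enorm.pow_const 2)).aemeasurable
  · filter_upwards [ae_restrict_of_ae hb] with θ hθ
    have h2 : Tendsto (fun s : ℝ => powSeries a (s * w)) (𝓝[<] 1) (𝓝 (powSeries a w)) := by
      have h3 : Continuous fun s : ℝ => (s : ℂ) * w := by fun_prop
      have h4 := (h3.tendsto 1).mono_left (nhdsWithin_le_nhds (s := Set.Iio 1))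
      rw [Complex.ofReal_one, one_mul] at h4
      exact (hd.differentiableOn.continuousOn.continuousAt
        (Metric.isOpen_ball.mem_nhds (mem_ball_zero_iff.2 hw))).tendsto.comp h4
    exact ENNReal.Tendsto.const_mul (((ENNReal.continuous_pow 2).tendsto _).comp
      (hθ.sub h2).enorm) (Or.inr ENNReal.ofReal_ne_top)
  · filter_upwards [eventually_radius, nhdsWithin_le_nhds (Ioi_mem_nhds hw),
      nhdsWithin_le_nhds (Ioi_mem_nhds (zero_lt_one (α := ℝ)))] with s hs h1 h0
    exact lintegral_poissonKernel_radial_le hd.differentiableOn (le_of_lt h1) h0 hs.2 hC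

lemma Function.Periodic.lintegral_Ioc_eq {f : ℝ → ℝ≥0∞} {T : ℝ} (hf : Function.Periodic f T)
    (hT : 0 < T) (s t : ℝ) :
    ∫⁻ x in Set.Ioc s (s + T), f x = ∫⁻ x in Set.Ioc t (t + T), f x := by
  refine (isAddFundamentalDomain_Ioc hT s).setLIntegral_eq (isAddFundamentalDomain_Ioc hT t) f ?_
  rintro ⟨g, n, rfl⟩ x
  have := hf.zsmul n x
  simpa [AddSubmonoid.vadd_def, AddSubgroup.vadd_def, add_comm] using this

lemma one_div_le_poissonKernel {α β θ : ℝ} (hαβ : α < β) (h2 : β - α ≤ 2 * Real.pi)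
    (hθ : θ ∈ Set.Icc α β) :
    1 / (4 * (β - α)) ≤ poissonKernel 0
      (((1 - (β - α) / (4 * Real.pi) : ℝ) : ℂ) * circleMap 0 1 ((α + β) / 2))
      (circleMap 0 1 θ) := by
  have hpi := Real.pi_pos
  have hpi3 := Real.pi_gt_three
  have hpi4 := Real.pi_lt_d2
  set t := (β - α) / (4 * Real.pi) with ht
  have ht0 : 0 < t := by have := sub_pos.2 hαβ; positivity
  have ht1 : t ≤ 1 / 2 := by rw [ht, div_le_iff₀ (by positivity)]; linarith
  have hβ : β - α = 4 * Real.pi * t := by rw [ht]; field_simp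
  have hs : Real.sin ((θ - (α + β) / 2) / 2) ^ 2 ≤ (Real.pi * t) ^ 2 := by
    refine (Real.sin_sq_le_sq).trans (sq_le_sq.2 ?_)
    rw [abs_of_pos (by positivity : 0 < Real.pi * t), abs_le]
    constructor <;> linarith [hθ.1, hθ.2]
  rw [poissonKernel_polar (by linarith), hβ]
  have hs0 := sq_nonneg (Real.sin ((θ - (α + β) / 2) / 2))
  set σ := Real.sin ((θ - (α + β) / 2) / 2) ^ 2
  have h1t : 0 < 1 - t := by linarith
  rw [show 1 - (1 - t) = t by ring, div_le_div_iff₀ (by positivity) (by positivity)]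
  have h3 : (1 - t) * σ ≤ (Real.pi * t) ^ 2 := by nlinarith
  have h4 : Real.pi * t ≤ 3.15 * t := by nlinarith
  have h5 : (Real.pi * t) ^ 2 ≤ 3.15 * t * (Real.pi * t) := by
    rw [sq]; exact mul_le_mul_of_nonneg_right h4 (by positivity)
  have h6 : t ≤ 1 - (1 - t) ^ 2 := by nlinarith
  have h7 : t * (Real.pi * t) ≤ (1 - (1 - t) ^ 2) * (Real.pi * t) :=
    mul_le_mul_of_nonneg_right h6 (by positivity)
  nlinarith [mul_pos ht0 ht0, mul_pos hpi (mul_pos ht0 ht0)]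

lemma IsRadialLimit.exists_lintegral_arc_le {a : ℕ → ℂ} {b : ℂ → ℂ}
    (hb : IsRadialLimit a b) (ha : Summable fun n => ‖a n‖ ^ 2) {C : ℝ}
    (hC : ∀ w : ℂ, ‖w‖ < 1 → ∫⁻ z in Metric.ball (0 : ℂ) 1,
      ENNReal.ofReal (1 / ‖1 - (starRingEnd ℂ) w * z‖ ^ 2) *
      ‖deriv (powSeries a) z‖ₑ ^ 2 * ENNReal.ofReal (1 - ‖z‖ ^ 2) ≤
        ENNReal.ofReal (C / (1 - ‖w‖ ^ 2)))
    {α β : ℝ} (hαβ : α < β) (h2 : β - α ≤ 2 * Real.pi) :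
    ∃ c : ℂ, ∫⁻ θ in Set.Icc α β, ‖b (circleMap 0 1 θ) - c‖ₑ ^ 2 ≤
      ENNReal.ofReal ((β - α) * (64 * C)) := by
  have hpi := Real.pi_pos
  have hβ := sub_pos.2 hαβ
  set t := (β - α) / (4 * Real.pi) with ht
  have ht0 : 0 < t := by positivity
  have ht1 : t ≤ 1 / 2 := by rw [ht, div_le_iff₀ (by positivity)]; linarith
  set w : ℂ := ((1 - t : ℝ) : ℂ) * circleMap 0 1 ((α + β) / 2) with hw
  have hw1 : w ∈ Metric.ball (0 : ℂ) 1 := radial_mem_ball (by linarith) (by linarith) _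
  have key := hb.lintegral_poissonKernel_sub_le ha (mem_ball_zero_iff.1 hw1)
    (hC w (mem_ball_zero_iff.1 hw1))
  refine ⟨powSeries a w, ?_⟩
  set g : ℝ → ℝ≥0∞ := fun θ => ENNReal.ofReal (poissonKernel 0 w (circleMap 0 1 θ)) *
    ‖b (circleMap 0 1 θ) - powSeries a w‖ₑ ^ 2 with hg
  have hper : g.Periodic (2 * Real.pi) := fun θ => by
    simp only [hg, periodic_circleMap 0 1 θ]
  calc ∫⁻ θ in Set.Icc α β, ‖b (circleMap 0 1 θ) - powSeries a w‖ₑ ^ 2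
      ≤ ∫⁻ θ in Set.Icc α β, ENNReal.ofReal (4 * (β - α)) * g θ := by
        refine setLIntegral_mono' measurableSet_Icc fun θ hθ => ?_
        rw [hg, ← mul_assoc, ← ENNReal.ofReal_mul (by positivity)]
        refine le_mul_of_one_le_left zero_le (ENNReal.one_le_ofReal.2 ?_)
        have := one_div_le_poissonKernel hαβ h2 hθ
        rwa [div_le_iff₀' (by positivity)] at this
    _ = ENNReal.ofReal (4 * (β - α)) * ∫⁻ θ in Set.Ioc α β, g θ := by
        rw [lintegral_const_mul' _ _ ENNReal.ofReal_ne_top, setLIntegral_congr Ioc_ae_eq_Icc]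
    _ ≤ ENNReal.ofReal (4 * (β - α)) * ∫⁻ θ in Set.Ioc α (α + 2 * Real.pi), g θ := by
        gcongr
        linarith
    _ = ENNReal.ofReal (4 * (β - α)) * ∫⁻ θ in Set.Ioc 0 (0 + 2 * Real.pi), g θ := by
        rw [hper.lintegral_Ioc_eq Real.two_pi_pos α 0]
    _ ≤ ENNReal.ofReal (4 * (β - α)) * ENNReal.ofReal (16 * C) := by
        rw [zero_add]
        gcongr
    _ = _ := by
        rw [← ENNReal.ofReal_mul (by positivity)]
        congr 1; ring

lemma Quaternion.norm_sq_eq (q : ℍ[ℝ]) :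
    ‖q‖ ^ 2 = q.re ^ 2 + q.imI ^ 2 + q.imJ ^ 2 + q.imK ^ 2 := by
  rw [sq, ← Quaternion.normSq_eq_norm_mul_self, Quaternion.normSq_def']

/-- The quaternion with the given components. -/
noncomputable def quat (x y z w : ℝ) : ℍ[ℝ] := ⟨x, y, z, w⟩

section quat

variable (x y z w : ℝ)

@[simp] lemma quat_re : (quat x y z w).re = x := rfl
@[simp] lemma quat_imI : (quat x y z w).imI = y := rfl
@[simp] lemma quat_imJ : (quat x y z w).imJ = z := rfl
@[simp] lemma quat_imK : (quat x y z w).imK = w := rfl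

end quat

/-- A pair of real-linear coordinates `ℍ → ℂ` which intertwine left multiplication by `I` with
multiplication by the complex unit. -/
structure IsSplitting (I : ℍ[ℝ]) (A B : ℍ[ℝ] →L[ℝ] ℂ) : Prop where
  left_mul : ∀ q, A (I * q) = Complex.I * A q
  right_mul : ∀ q, B (I * q) = Complex.I * B q
  norm_sq : ∀ q, ‖q‖ ^ 2 = ‖A q‖ ^ 2 + ‖B q‖ ^ 2

lemma exists_conj_imI {I : ℍ[ℝ]} (hI : I.re = 0) (hI1 : ‖I‖ = 1) :
    ∃ v : ℍ[ℝ], ‖v‖ = 1 ∧ v * I = quat 0 1 0 0 * v := by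
  have hn := Quaternion.norm_sq_eq I
  rw [hI, hI1] at hn
  by_cases h : quat (1 + I.imI) 0 I.imK (-I.imJ) = 0
  · refine ⟨quat 0 0 1 0, ?_, ?_⟩
    · rw [← sq_eq_sq₀ (norm_nonneg _) zero_le_one, Quaternion.norm_sq_eq]; simp
    · have h1 : 1 + I.imI = 0 := by simpa using congrArg QuaternionAlgebra.re h
      have h2 : I.imK = 0 := by simpa using congrArg QuaternionAlgebra.imJ h
      have h3 : -I.imJ = 0 := by simpa using congrArg QuaternionAlgebra.imK h
      ext <;> simp <;> linarith
  · set u := quat (1 + I.imI) 0 I.imK (-I.imJ) with hu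
    have hu0 := norm_ne_zero_iff.2 h
    refine ⟨‖u‖⁻¹ • u, by rw [norm_smul, norm_inv, norm_norm, inv_mul_cancel₀ hu0], ?_⟩
    have : u * I = quat 0 1 0 0 * u := by
      ext <;> simp [hu, hI] <;> linarith
    rw [smul_mul_assoc, this, mul_smul_comm]

lemma exists_isSplitting {I : ℍ[ℝ]} (hI : I.re = 0) (hI1 : ‖I‖ = 1) :
    ∃ A B, IsSplitting I A B := by
  obtain ⟨v, hv, hvI⟩ := exists_conj_imI hI hI1
  let A₀ : ℍ[ℝ] →ₗ[ℝ] ℂ :=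
    { toFun := fun q => ⟨(v * q).re, (v * q).imI⟩
      map_add' := fun x y => by apply Complex.ext <;> simp [mul_add]
      map_smul' := fun c x => by apply Complex.ext <;> simp }
  let B₀ : ℍ[ℝ] →ₗ[ℝ] ℂ :=
    { toFun := fun q => ⟨(v * q).imJ, (v * q).imK⟩
      map_add' := fun x y => by apply Complex.ext <;> simp [mul_add]
      map_smul' := fun c x => by apply Complex.ext <;> simp }
  have hA : ∀ q, A₀ q = ⟨(v * q).re, (v * q).imI⟩ := fun _ => rfl
  have hB : ∀ q, B₀ q = ⟨(v * q).imJ, (v * q).imK⟩ := fun _ => rfl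
  have hm : ∀ q, v * (I * q) = quat 0 1 0 0 * (v * q) := fun q => by
    rw [← mul_assoc, hvI, mul_assoc]
  refine ⟨LinearMap.toContinuousLinearMap A₀, LinearMap.toContinuousLinearMap B₀,
    fun q => ?_, fun q => ?_, fun q => ?_⟩
  · rw [LinearMap.coe_toContinuousLinearMap', hA, hA, hm]
    generalize v * q = p
    apply Complex.ext <;> simp
  · rw [LinearMap.coe_toContinuousLinearMap', hB, hB, hm]
    generalize v * q = p
    apply Complex.ext <;> simp
  · rw [LinearMap.coe_toContinuousLinearMap', LinearMap.coe_toContinuousLinearMap', hA, hB,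
      show ‖q‖ = ‖v * q‖ by rw [norm_mul, hv, one_mul], Quaternion.norm_sq_eq]
    simp only [← Complex.normSq_eq_norm_sq, Complex.normSq_apply]
    ring

/-- The point `x + yI` of the slice through `I` corresponding to `x + yi`. -/
noncomputable def slicePoint (I : ℍ[ℝ]) (z : ℂ) : ℍ[ℝ] := (z.re : ℍ[ℝ]) + z.im • I

lemma norm_slicePoint {I : ℍ[ℝ]} (hI : I.re = 0) (hI1 : ‖I‖ = 1) (z : ℂ) :
    ‖slicePoint I z‖ = ‖z‖ := by
  have hn := Quaternion.norm_sq_eq I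
  rw [hI, hI1] at hn
  rw [← sq_eq_sq₀ (norm_nonneg _) (norm_nonneg _), Quaternion.norm_sq_eq,
    ← Complex.normSq_eq_norm_sq, Complex.normSq_apply]
  simp only [slicePoint, Quaternion.re_add, Quaternion.re_coe, Quaternion.re_smul, hI,
    Quaternion.imI_add, Quaternion.imI_coe, Quaternion.imI_smul, Quaternion.imJ_add,
    Quaternion.imJ_coe, Quaternion.imJ_smul, Quaternion.imK_add, Quaternion.imK_coe,
    Quaternion.imK_smul, smul_eq_mul]
  linear_combination -z.im ^ 2 * hn

lemma summable_slicePoint {I : ℍ[ℝ]} (hI : I.re = 0) (hI1 : ‖I‖ = 1) {c : ℕ → ℍ[ℝ]} {z : ℂ}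
    (hc : Summable fun n => ‖c n‖ * ‖z‖ ^ n) : Summable fun n => slicePoint I z ^ n * c n := by
  refine Summable.of_norm (hc.congr fun n => ?_)
  rw [norm_mul, norm_pow, norm_slicePoint hI hI1, mul_comm]

lemma cullenDeriv_eq_tsum (a : ℕ → ℍ[ℝ]) (q : ℍ[ℝ]) :
    cullenDeriv a q = ∑' n : ℕ, q ^ n * (((n + 1 : ℕ) : ℝ) • a (n + 1)) :=
  tsum_congr fun n => by rw [mul_smul_comm]

lemma summable_cullenDeriv_coeff {a : ℕ → ℍ[ℝ]} (ha : Summable fun n => ‖a n‖ ^ 2) {z : ℂ}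
    (hz : ‖z‖ < 1) : Summable fun n => ‖((n + 1 : ℕ) : ℝ) • a (n + 1)‖ * ‖z‖ ^ n := by
  have hd := discSummable_of_summable_sq (a := fun n => ((‖a n‖ : ℝ) : ℂ)) (by simpa using ha)
  refine (hd.deriv_coeff ‖z‖ (norm_nonneg _) hz).congr fun n => ?_
  rw [norm_smul, norm_mul, Complex.norm_real, norm_norm, Real.norm_natCast, Complex.norm_natCast]

namespace IsSplitting

variable {I : ℍ[ℝ]} {A B : ℍ[ℝ] →L[ℝ] ℂ}

lemma swap (h : IsSplitting I A B) : IsSplitting I B A :=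
  ⟨h.right_mul, h.left_mul, fun q => by rw [h.norm_sq, add_comm]⟩

lemma norm_le (h : IsSplitting I A B) (q : ℍ[ℝ]) : ‖A q‖ ≤ ‖q‖ := by
  have := h.norm_sq q
  nlinarith [norm_nonneg (A q), norm_nonneg q, sq_nonneg ‖B q‖]

lemma enorm_sq (h : IsSplitting I A B) (q : ℍ[ℝ]) : ‖q‖ₑ ^ 2 = ‖A q‖ₑ ^ 2 + ‖B q‖ₑ ^ 2 := by
  rw [← ofReal_norm_sq, ← ofReal_norm_sq, ← ofReal_norm_sq, h.norm_sq,
    ENNReal.ofReal_add (by positivity) (by positivity)]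

lemma summable_sq (h : IsSplitting I A B) {c : ℕ → ℍ[ℝ]} (hc : Summable fun n => ‖c n‖ ^ 2) :
    Summable fun n => ‖A (c n)‖ ^ 2 :=
  Summable.of_nonneg_of_le (fun _ => by positivity)
    (fun n => pow_le_pow_left₀ (norm_nonneg _) (h.norm_le _) 2) hc

lemma map_slicePoint_mul (h : IsSplitting I A B) (z : ℂ) (q : ℍ[ℝ]) :
    A (slicePoint I z * q) = z * A q := by
  rw [slicePoint, add_mul, smul_mul_assoc, map_add, map_smul, h.left_mul, Quaternion.coe_mul_eq_smul,
    map_smul]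
  conv_rhs => rw [← Complex.re_add_im z]
  simp only [Complex.real_smul]
  ring

lemma map_slicePoint_pow_mul (h : IsSplitting I A B) (z : ℂ) (n : ℕ) (q : ℍ[ℝ]) :
    A (slicePoint I z ^ n * q) = z ^ n * A q := by
  induction n with
  | zero => simp
  | succ n ih => rw [pow_succ', mul_assoc, h.map_slicePoint_mul, ih, pow_succ', mul_assoc]

lemma map_tsum (h : IsSplitting I A B) (hI : I.re = 0) (hI1 : ‖I‖ = 1) {c : ℕ → ℍ[ℝ]} {z : ℂ}
    (hc : Summable fun n => ‖c n‖ * ‖z‖ ^ n) :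
    A (∑' n, slicePoint I z ^ n * c n) = powSeries (fun n => A (c n)) z := by
  rw [A.map_tsum (summable_slicePoint hI hI1 hc)]
  exact tsum_congr fun n => by rw [h.map_slicePoint_pow_mul, mul_comm]

lemma map_cullenDeriv (h : IsSplitting I A B) (hI : I.re = 0) (hI1 : ‖I‖ = 1) {a : ℕ → ℍ[ℝ]}
    (ha : Summable fun n => ‖a n‖ ^ 2) {z : ℂ} (hz : ‖z‖ < 1) :
    A (cullenDeriv a (slicePoint I z)) = deriv (powSeries fun n => A (a n)) z := by
  have hd := discSummable_of_summable_sq (h.summable_sq ha)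
  rw [hd.deriv_eq hz, cullenDeriv_eq_tsum, h.map_tsum hI hI1 (summable_cullenDeriv_coeff ha hz)]
  congr 1
  ext n
  rw [map_smul, Complex.real_smul]
  simp

end IsSplitting

lemma summable_mul_pow_of_summable_sq {c : ℕ → ℍ[ℝ]} (hc : Summable fun n => ‖c n‖ ^ 2) {z : ℂ}
    (hz : ‖z‖ < 1) : Summable fun n => ‖c n‖ * ‖z‖ ^ n :=
  (discSummable_of_summable_sq (a := fun n => ((‖c n‖ : ℝ) : ℂ)) (by simpa using hc) ‖z‖
    (norm_nonneg _) hz).congr fun n => by simp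

lemma setLIntegral_disc_eq (F : ℂ → ℝ≥0∞) :
    ∫⁻ p in {p : ℝ × ℝ | p.1 ^ 2 + p.2 ^ 2 < 1}, F ⟨p.1, p.2⟩ =
      ∫⁻ z in Metric.ball (0 : ℂ) 1, F z := by
  rw [← Complex.volume_preserving_equiv_real_prod.setLIntegral_comp_preimage_emb
    Complex.measurableEquivRealProd.measurableEmbedding]
  have : Complex.measurableEquivRealProd ⁻¹' {p : ℝ × ℝ | p.1 ^ 2 + p.2 ^ 2 < 1} =
      Metric.ball (0 : ℂ) 1 := by
    ext z
    rw [mem_ball_zero_iff, ← sq_lt_one_iff₀ (norm_nonneg z), ← Complex.normSq_eq_norm_sq,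
      Complex.normSq_apply]
    simp [Complex.measurableEquivRealProd_apply, sq]
  rw [this]
  rfl

lemma iQ_re (v : EuclideanSpace ℝ (Fin 3)) : (iQ v).re = 0 := rfl

lemma norm_iQ (v : EuclideanSpace ℝ (Fin 3)) : ‖iQ v‖ = ‖v‖ := by
  rw [← sq_eq_sq₀ (norm_nonneg _) (norm_nonneg _), Quaternion.norm_sq_eq,
    EuclideanSpace.norm_sq_eq, Fin.sum_univ_three]
  simp [iQ]

/-- The integral of `|g|² |∂_c f|² (1 - |q|²)` over the slice through `I`, where `f` and `g` have
coefficients `a` and `c`. -/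
noncomputable def sliceEnergy (a c : ℕ → ℍ[ℝ]) (I : ℍ[ℝ]) : ℝ≥0∞ :=
  ∫⁻ z in Metric.ball (0 : ℂ) 1, ‖∑' n, slicePoint I z ^ n * c n‖ₑ ^ 2 *
    ‖cullenDeriv a (slicePoint I z)‖ₑ ^ 2 * ENNReal.ofReal (1 - ‖z‖ ^ 2)

lemma setLIntegral_slice_eq (a c : ℕ → ℍ[ℝ]) (I : ℍ[ℝ]) :
    ∫⁻ p in {p : ℝ × ℝ | p.1 ^ 2 + p.2 ^ 2 < 1},
      (‖∑' n : ℕ, ((p.1 : ℍ[ℝ]) + p.2 • I) ^ n * c n‖₊ : ℝ≥0∞) ^ 2 *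
        (‖cullenDeriv a ((p.1 : ℍ[ℝ]) + p.2 • I)‖₊ : ℝ≥0∞) ^ 2 *
        ENNReal.ofReal (1 - p.1 ^ 2 - p.2 ^ 2) = sliceEnergy a c I := by
  rw [sliceEnergy, ← setLIntegral_disc_eq]
  congr 1
  ext p
  congr 2
  rw [← Complex.normSq_eq_norm_sq, Complex.normSq_apply]
  ring

namespace IsSplitting

variable {I : ℍ[ℝ]} {A B : ℍ[ℝ] →L[ℝ] ℂ}

lemma sliceEnergy_eq (h : IsSplitting I A B) (hI : I.re = 0) (hI1 : ‖I‖ = 1) {a c : ℕ → ℍ[ℝ]}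
    (ha : Summable fun n => ‖a n‖ ^ 2) (hc : Summable fun n => ‖c n‖ ^ 2) :
    sliceEnergy a c I = ∫⁻ z in Metric.ball (0 : ℂ) 1,
      (‖powSeries (fun n => A (c n)) z‖ₑ ^ 2 + ‖powSeries (fun n => B (c n)) z‖ₑ ^ 2) *
      (‖deriv (powSeries fun n => A (a n)) z‖ₑ ^ 2 +
        ‖deriv (powSeries fun n => B (a n)) z‖ₑ ^ 2) * ENNReal.ofReal (1 - ‖z‖ ^ 2) := by
  refine setLIntegral_congr_fun measurableSet_ball fun z hz => ?_
  rw [mem_ball_zero_iff] at hz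
  have hs := summable_mul_pow_of_summable_sq hc hz
  simp only [h.enorm_sq, h.map_tsum hI hI1 hs, h.swap.map_tsum hI hI1 hs,
    h.map_cullenDeriv hI hI1 ha hz, h.swap.map_cullenDeriv hI hI1 ha hz]

lemma injective_prod (h : IsSplitting I A B) :
    Function.Injective (A.prod B : ℍ[ℝ] →ₗ[ℝ] ℂ × ℂ) := by
  rw [← LinearMap.ker_eq_bot, LinearMap.ker_eq_bot']
  intro q hq
  have h1 : A q = 0 := congrArg Prod.fst hq
  have h2 : B q = 0 := congrArg Prod.snd hq
  have := h.norm_sq q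
  rw [h1, h2] at this
  simpa using this

/-- A splitting as a linear equivalence. -/
noncomputable def equiv (h : IsSplitting I A B) : ℍ[ℝ] ≃ₗ[ℝ] ℂ × ℂ :=
  LinearEquiv.ofInjectiveOfFinrankEq (A.prod B : ℍ[ℝ] →ₗ[ℝ] ℂ × ℂ) h.injective_prod
    (by simp [Quaternion.finrank_eq_four])

lemma equiv_apply (h : IsSplitting I A B) (q : ℍ[ℝ]) : h.equiv q = (A q, B q) := rfl

lemma exists_eq (h : IsSplitting I A B) (x y : ℂ) : ∃ q, A q = x ∧ B q = y := by
  refine ⟨h.equiv.symm (x, y), ?_⟩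
  have := h.equiv.apply_symm_apply (x, y)
  rw [h.equiv_apply] at this
  exact ⟨congrArg Prod.fst this, congrArg Prod.snd this⟩

lemma memLp {α : Type*} [MeasurableSpace α] {μ : Measure α} {p : ℝ≥0∞} (h : IsSplitting I A B)
    {F : α → ℍ[ℝ]} (hA : MemLp (fun t => A (F t)) p μ) (hB : MemLp (fun t => B (F t)) p μ) :
    MemLp F p μ := by
  let G : ℂ × ℂ →L[ℝ] ℍ[ℝ] := LinearMap.toContinuousLinearMap (h.equiv.symm : ℂ × ℂ →ₗ[ℝ] ℍ[ℝ])
  have e : ∀ t, (G.comp (ContinuousLinearMap.inl ℝ ℂ ℂ)) (A (F t)) +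
      (G.comp (ContinuousLinearMap.inr ℝ ℂ ℂ)) (B (F t)) = F t := by
    intro t
    rw [ContinuousLinearMap.comp_apply, ContinuousLinearMap.comp_apply, ← map_add]
    have : ContinuousLinearMap.inl ℝ ℂ ℂ (A (F t)) + ContinuousLinearMap.inr ℝ ℂ ℂ (B (F t)) =
        h.equiv (F t) := by simp [equiv_apply]
    rw [this]
    exact h.equiv.symm_apply_apply _
  refine (((G.comp (ContinuousLinearMap.inl ℝ ℂ ℂ)).comp_memLp' hA).add
    ((G.comp (ContinuousLinearMap.inr ℝ ℂ ℂ)).comp_memLp' hB)).ae_eq (ae_of_all _ e)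

lemma exists_isRadialLimit (h : IsSplitting I A B) (hI : I.re = 0) (hI1 : ‖I‖ = 1)
    {a : ℕ → ℍ[ℝ]} (ha : Summable fun n => ‖a n‖ ^ 2) {F : ℝ → ℍ[ℝ]}
    (hF : ∀ᵐ θ ∂(volume : Measure ℝ),
      Tendsto (fun r : ℝ => ∑' n : ℕ, (r • expQ I θ) ^ n * a n) (𝓝[<] (1 : ℝ)) (𝓝 (F θ))) :
    ∃ b : ℂ → ℂ, IsRadialLimit (fun n => A (a n)) b ∧
      ∀ᵐ θ ∂(volume : Measure ℝ), b (circleMap 0 1 θ) = A (F θ) := by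
  have key : ∀ᵐ θ ∂(volume : Measure ℝ), Tendsto
      (fun r : ℝ => powSeries (fun n => A (a n)) (r * circleMap 0 1 θ)) (𝓝[<] (1 : ℝ))
      (𝓝 (A (F θ))) := by
    filter_upwards [hF] with θ hθ
    refine ((A.continuous.tendsto _).comp hθ).congr' ?_
    filter_upwards [eventually_radius] with r hr
    have hz : ‖(r : ℂ) * circleMap 0 1 θ‖ < 1 := by
      simpa using radial_mem_ball hr.1 hr.2 θ
    have e : r • expQ I θ = slicePoint I (r * circleMap 0 1 θ) := by
      rw [slicePoint, expQ, smul_add, smul_smul, smul_smul]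
      congr 1
      · ext <;> simp [circleMap, Complex.exp_ofReal_mul_I_re]
      · simp [circleMap, Complex.exp_ofReal_mul_I_im]
    rw [Function.comp_apply, e, h.map_tsum hI hI1 (summable_mul_pow_of_summable_sq ha hz)]
  refine ⟨fun ζ => limUnder (𝓝[<] (1 : ℝ))
    fun r : ℝ => powSeries (fun n => A (a n)) (r * ζ), ?_, ?_⟩
  · filter_upwards [key] with θ hθ
    rwa [hθ.limUnder_eq]
  · filter_upwards [key] with θ hθ using hθ.limUnder_eq

end IsSplitting

lemma IsRadialLimit.memLp_Ioc {a : ℕ → ℂ} {b : ℂ → ℂ} (hb : IsRadialLimit a b)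
    (ha : Summable fun n => ‖a n‖ ^ 2) {α β : ℝ} (h2 : β - α ≤ 2 * Real.pi) :
    MemLp (fun θ => b (circleMap 0 1 θ)) 2 (volume.restrict (Set.Ioc α β)) := by
  have hm := hb.aestronglyMeasurable ha
  have hp := (hb.memLp ha).2
  have hper : Function.Periodic (fun θ => ‖b (circleMap 0 1 θ)‖ₑ ^ 2) (2 * Real.pi) := fun θ => by
    simp only [periodic_circleMap 0 1 θ]
  have := hper.lintegral_Ioc_eq Real.two_pi_pos α 0
  rw [zero_add] at this
  refine MemLp.mono_measure (μ := volume.restrict (Set.Ioc α (α + 2 * Real.pi)))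
    (Measure.restrict_mono (Set.Ioc_subset_Ioc_right (sub_le_iff_le_add'.1 h2)) le_rfl) ⟨hm.restrict, ?_⟩
  rw [eLpNorm_lt_top_iff_lintegral_rpow_enorm_lt_top (by simp) (by simp)] at hp ⊢
  simp only [ENNReal.toReal_ofNat, ENNReal.rpow_ofNat] at hp ⊢
  rwa [this]

lemma ofReal_intervalIntegral_norm_sub_sq {E : Type*} [NormedAddCommGroup E] {F : ℝ → E}
    {α β : ℝ} (hαβ : α < β) (hF : MemLp F 2 (volume.restrict (Set.Ioc α β))) (q : E) :
    ENNReal.ofReal (∫ θ in α..β, ‖F θ - q‖ ^ 2) = ∫⁻ θ in Set.Ioc α β, ‖F θ - q‖ₑ ^ 2 := by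
  have hm : MemLp (fun θ => F θ - q) 2 (volume.restrict (Set.Ioc α β)) := hF.sub (memLp_const q)
  rw [intervalIntegral.integral_of_le hαβ.le, ofReal_integral_eq_lintegral_ofReal
    ((memLp_two_iff_integrable_sq_norm hm.1).1 hm) (ae_of_all _ fun _ => by positivity)]
  exact lintegral_congr fun θ => ofReal_norm_sq _

section Mean

variable {E : Type*} [NormedAddCommGroup E] [InnerProductSpace ℝ E] [CompleteSpace E]
  {F : ℝ → E} {α β : ℝ}

lemma intervalIntegral_norm_sub_mean_sq_le (hαβ : α < β)
    (hF : MemLp F 2 (volume.restrict (Set.Ioc α β))) (q : E) :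
    ∫ θ in α..β, ‖F θ - (β - α)⁻¹ • ∫ t in α..β, F t‖ ^ 2 ≤ ∫ θ in α..β, ‖F θ - q‖ ^ 2 := by
  set m := (β - α)⁻¹ • ∫ t in α..β, F t with hm
  have hp : 0 < β - α := sub_pos.2 hαβ
  have hi : ∀ p : E, IntervalIntegrable (fun θ => ‖F θ - p‖ ^ 2) volume α β := fun p => by
    have h : MemLp (fun θ => F θ - p) 2 (volume.restrict (Set.Ioc α β)) := hF.sub (memLp_const p)
    rw [intervalIntegrable_iff_integrableOn_Ioc_of_le hαβ.le]
    exact (memLp_two_iff_integrable_sq_norm h.1).1 h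
  have hFi : IntervalIntegrable F volume α β := by
    rw [intervalIntegrable_iff_integrableOn_Ioc_of_le hαβ.le]
    exact hF.integrable (by norm_num)
  have h0 : ∫ θ in α..β, (F θ - m) = 0 := by
    rw [intervalIntegral.integral_sub hFi (by simp), intervalIntegral.integral_const, hm,
      smul_smul, mul_inv_cancel₀ hp.ne', one_smul, sub_self]
  have hin : IntervalIntegrable (fun θ => inner ℝ (m - q) (F θ - m)) volume α β := by
    have := (hFi.sub (_root_.intervalIntegrable_const (c := m)))
    rw [intervalIntegrable_iff_integrableOn_Ioc_of_le hαβ.le] at this ⊢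
    exact (innerSL ℝ (m - q)).integrable_comp this
  have hz : ∫ θ in α..β, inner ℝ (m - q) (F θ - m) = 0 := by
    have := (innerSL ℝ (m - q)).intervalIntegral_comp_comm
      (hFi.sub (_root_.intervalIntegrable_const (c := m)))
    simp only [innerSL_apply_apply] at this
    rw [this, h0, inner_zero_right]
  have e : ∀ θ, ‖F θ - q‖ ^ 2 =
      ‖F θ - m‖ ^ 2 + (2 * inner ℝ (m - q) (F θ - m) + ‖m - q‖ ^ 2) := fun θ => by
    rw [show F θ - q = (F θ - m) + (m - q) by abel, norm_add_sq_real, real_inner_comm]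
    ring
  simp_rw [e]
  rw [intervalIntegral.integral_add (hi m) ((hin.const_mul 2).add (by simp)),
    intervalIntegral.integral_add (hin.const_mul 2) (by simp),
    intervalIntegral.integral_const_mul, hz, intervalIntegral.integral_const]
  simp only [mul_zero, zero_add, smul_eq_mul, le_add_iff_nonneg_right]
  positivity

end Mean

lemma intervalIntegral_le_of_bmoSeminorm_le {g : ℝ → ℍ[ℝ]} {M : ℝ} (hM : 0 ≤ M)
    (h : bmoSeminorm g ≤ ENNReal.ofReal M) {α β : ℝ} (hαβ : α < β) (h2 : β - α ≤ 2 * Real.pi) :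
    ∫ θ in α..β, ‖g θ - (β - α)⁻¹ • ∫ t in α..β, g t‖ ^ 2 ≤ (β - α) * M ^ 2 := by
  simp only [bmoSeminorm, iSup_le_iff] at h
  have h := h α β hαβ h2
  have hp : 0 < β - α := sub_pos.2 hαβ
  have hn : 0 ≤ (β - α)⁻¹ * ∫ θ in α..β, ‖g θ - (β - α)⁻¹ • ∫ t in α..β, g t‖ ^ 2 :=
    mul_nonneg (inv_nonneg.2 hp.le) (intervalIntegral.integral_nonneg hαβ.le fun _ _ => by positivity)
  rw [ENNReal.ofReal_le_ofReal_iff hM, ← Real.sqrt_eq_rpow, Real.sqrt_le_left hM,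
    inv_mul_le_iff₀ hp] at h
  exact h

lemma bmoSeminorm_le {g : ℝ → ℍ[ℝ]} {K : ℝ}
    (h : ∀ α β, α < β → β - α ≤ 2 * Real.pi →
      ∫ θ in α..β, ‖g θ - (β - α)⁻¹ • ∫ t in α..β, g t‖ ^ 2 ≤ (β - α) * K) :
    bmoSeminorm g ≤ ENNReal.ofReal (K ^ (1 / 2 : ℝ)) := by
  refine iSup_le fun α => iSup_le fun β => iSup_le fun hαβ => iSup_le fun h2 => ?_
  have hp : 0 < β - α := sub_pos.2 hαβ
  refine ENNReal.ofReal_le_ofReal (Real.rpow_le_rpow ?_ ?_ (by norm_num))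
  · exact mul_nonneg (inv_nonneg.2 hp.le)
      (intervalIntegral.integral_nonneg hαβ.le fun _ _ => by positivity)
  · rw [inv_mul_le_iff₀ hp]
    exact h α β hαβ h2

lemma ofReal_tsum_norm_sq {E : Type*} [SeminormedAddGroup E] {c : ℕ → E}
    (hc : Summable fun n => ‖c n‖ ^ 2) :
    ENNReal.ofReal (∑' n, ‖c n‖ ^ 2) = ∑' n, ‖c n‖ₑ ^ 2 := by
  rw [ENNReal.ofReal_tsum_of_nonneg (fun _ => by positivity) hc]
  exact tsum_congr fun n => ofReal_norm_sq _

lemma DiscSummable.aemeasurable_enorm_sq {c : ℕ → ℂ} (hc : DiscSummable c) :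
    AEMeasurable (fun z => ‖powSeries c z‖ₑ ^ 2)
      (volume.restrict (Metric.ball (0 : ℂ) 1)) :=
  (hc.differentiableOn.continuousOn.aestronglyMeasurable measurableSet_ball).enorm.pow_const 2

namespace IsSplitting

variable {I : ℍ[ℝ]} {A B : ℍ[ℝ] →L[ℝ] ℂ} {a : ℕ → ℍ[ℝ]} {F : ℝ → ℍ[ℝ]}

lemma memLp_boundary (h : IsSplitting I A B) (hI : I.re = 0) (hI1 : ‖I‖ = 1)
    (ha : Summable fun n => ‖a n‖ ^ 2)
    (hF : ∀ᵐ θ ∂(volume : Measure ℝ),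
      Tendsto (fun r : ℝ => ∑' n : ℕ, (r • expQ I θ) ^ n * a n) (𝓝[<] (1 : ℝ)) (𝓝 (F θ)))
    {α β : ℝ} (h2 : β - α ≤ 2 * Real.pi) : MemLp F 2 (volume.restrict (Set.Ioc α β)) := by
  obtain ⟨b, hb, hbF⟩ := h.exists_isRadialLimit hI hI1 ha hF
  obtain ⟨b', hb', hbF'⟩ := h.swap.exists_isRadialLimit hI hI1 ha hF
  exact h.memLp
    ((hb.memLp_Ioc (h.summable_sq ha) h2).ae_eq (ae_restrict_of_ae hbF))
    ((hb'.memLp_Ioc (h.swap.summable_sq ha) h2).ae_eq (ae_restrict_of_ae hbF'))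

lemma lintegral_map_sub_le (h : IsSplitting I A B) (hI : I.re = 0) (hI1 : ‖I‖ = 1)
    (ha : Summable fun n => ‖a n‖ ^ 2)
    (hF : ∀ᵐ θ ∂(volume : Measure ℝ),
      Tendsto (fun r : ℝ => ∑' n : ℕ, (r • expQ I θ) ^ n * a n) (𝓝[<] (1 : ℝ)) (𝓝 (F θ)))
    {M : ℝ} (hM0 : 0 ≤ M) (hM : bmoSeminorm F ≤ ENNReal.ofReal M) {c : ℕ → ℍ[ℝ]}
    {d : ℕ → ℂ} (hd : DiscSummable d) (hdc : ∀ n, ‖d n‖ ≤ ‖c n‖) :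
    ∫⁻ z in Metric.ball (0 : ℂ) 1, ‖powSeries d z‖ₑ ^ 2 *
      ‖deriv (powSeries fun n => A (a n)) z‖ₑ ^ 2 * ENNReal.ofReal (1 - ‖z‖ ^ 2) ≤
    ENNReal.ofReal ((304 * M ^ 2 + 1) * Real.exp 1 * (2 * Real.pi)) * ∑' n, ‖c n‖ₑ ^ 2 := by
  obtain ⟨b, hb, hbF⟩ := h.exists_isRadialLimit hI hI1 ha hF
  refine (hb.lintegral_carleson_le (h.summable_sq ha) (sq_nonneg M) (fun α β hαβ h2 => ?_)
    hd).trans ?_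
  · refine ⟨A ((β - α)⁻¹ • ∫ t in α..β, F t), ?_⟩
    rw [← restrict_Ioc_eq_restrict_Icc]
    calc _ ≤ ∫⁻ θ in Set.Ioc α β, ‖F θ - (β - α)⁻¹ • ∫ t in α..β, F t‖ₑ ^ 2 := by
          refine lintegral_mono_ae ?_
          filter_upwards [ae_restrict_of_ae hbF] with θ hθ
          rw [hθ, ← map_sub, h.enorm_sq (F θ - _)]
          exact le_self_add
      _ ≤ _ := by
          rw [← ofReal_intervalIntegral_norm_sub_sq hαβ (h.memLp_boundary hI hI1 ha hF h2)]
          exact ENNReal.ofReal_le_ofReal (intervalIntegral_le_of_bmoSeminorm_le hM0 hM hαβ h2)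
  · gcongr with n
    exact enorm_le_iff_norm_le.2 (hdc n)

lemma sliceEnergy_le (h : IsSplitting I A B) (hI : I.re = 0) (hI1 : ‖I‖ = 1)
    (ha : Summable fun n => ‖a n‖ ^ 2)
    (hF : ∀ᵐ θ ∂(volume : Measure ℝ),
      Tendsto (fun r : ℝ => ∑' n : ℕ, (r • expQ I θ) ^ n * a n) (𝓝[<] (1 : ℝ)) (𝓝 (F θ)))
    {M : ℝ} (hM0 : 0 ≤ M) (hM : bmoSeminorm F ≤ ENNReal.ofReal M) {c : ℕ → ℍ[ℝ]}
    (hc : Summable fun n => ‖c n‖ ^ 2) :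
    sliceEnergy a c I ≤
      4 * ENNReal.ofReal ((304 * M ^ 2 + 1) * Real.exp 1 * (2 * Real.pi)) * ∑' n, ‖c n‖ₑ ^ 2 := by
  have hdA := discSummable_of_summable_sq (h.summable_sq hc)
  have hdB := discSummable_of_summable_sq (h.swap.summable_sq hc)
  have h11 := h.lintegral_map_sub_le hI hI1 ha hF hM0 hM hdA fun n => h.norm_le (c n)
  have h12 := h.lintegral_map_sub_le hI hI1 ha hF hM0 hM hdB fun n => h.swap.norm_le (c n)
  have h21 := h.swap.lintegral_map_sub_le hI hI1 ha hF hM0 hM hdA fun n => h.norm_le (c n)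
  have h22 := h.swap.lintegral_map_sub_le hI hI1 ha hF hM0 hM hdB fun n => h.swap.norm_le (c n)
  have hw : Measurable fun z : ℂ => ENNReal.ofReal (1 - ‖z‖ ^ 2) := by fun_prop
  have hA : Measurable fun z : ℂ => ‖deriv (powSeries fun n => A (a n)) z‖ₑ ^ 2 :=
    (measurable_deriv _).enorm.pow_const 2
  have hB : Measurable fun z : ℂ => ‖deriv (powSeries fun n => B (a n)) z‖ₑ ^ 2 :=
    (measurable_deriv _).enorm.pow_const 2
  have m1 := hdA.aemeasurable_enorm_sq
  have m2 := hdB.aemeasurable_enorm_sq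
  rw [h.sliceEnergy_eq hI hI1 ha hc]
  simp only [add_mul, mul_add]
  rw [lintegral_add_right' _ (by fun_prop), lintegral_add_right' _ (by fun_prop),
    lintegral_add_right' _ (by fun_prop)]
  refine (add_le_add (add_le_add h11 h12) (add_le_add h21 h22)).trans_eq ?_
  ring_nf

end IsSplitting

lemma exists_carleson_of_bmo {a : ℕ → ℍ[ℝ]} (ha : Summable fun n => ‖a n‖ ^ 2)
    {fstar : ℍ[ℝ] → ℝ → ℍ[ℝ]}
    (hlim : ∀ I : ℍ[ℝ], I.re = 0 → ‖I‖ = 1 → ∀ᵐ θ ∂(volume : Measure ℝ),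
      Tendsto (fun r : ℝ => ∑' n : ℕ, (r • expQ I θ) ^ n * a n) (𝓝[<] (1 : ℝ))
        (𝓝 (fstar I θ)))
    (hfin : (⨆ (I : ℍ[ℝ]) (_ : I.re = 0 ∧ ‖I‖ = 1), bmoSeminorm (fstar I)) < ⊤) :
    ∃ C : ℝ, 0 ≤ C ∧ ∀ c : ℕ → ℍ[ℝ], Summable (fun n => ‖c n‖ ^ 2) →
      ENNReal.ofReal (1 / 4) * ∫⁻ v : Metric.sphere (0 : EuclideanSpace ℝ (Fin 3)) 1,
        sliceEnergy a c (iQ v) ∂((volume : Measure (EuclideanSpace ℝ (Fin 3))).toSphere) ≤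
      ENNReal.ofReal (C * ∑' n : ℕ, ‖c n‖ ^ 2) := by
  set S := ⨆ (I : ℍ[ℝ]) (_ : I.re = 0 ∧ ‖I‖ = 1), bmoSeminorm (fstar I) with hS
  have hM : ∀ I : ℍ[ℝ], I.re = 0 → ‖I‖ = 1 → bmoSeminorm (fstar I) ≤ ENNReal.ofReal S.toReal :=
    fun I hI hI1 => by
      rw [ENNReal.ofReal_toReal hfin.ne]
      exact le_iSup₂_of_le (f := fun (I : ℍ[ℝ]) (_ : I.re = 0 ∧ ‖I‖ = 1) => bmoSeminorm (fstar I))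
        I ⟨hI, hI1⟩ le_rfl
  set K := 4 * ENNReal.ofReal ((304 * S.toReal ^ 2 + 1) * Real.exp 1 * (2 * Real.pi)) with hK
  set σ := (volume : Measure (EuclideanSpace ℝ (Fin 3))).toSphere
  have hfin : K * σ Set.univ ≠ ⊤ := ENNReal.mul_ne_top
    (ENNReal.mul_ne_top (by simp) ENNReal.ofReal_ne_top) (measure_ne_top _ _)
  refine ⟨(K * σ Set.univ).toReal, ENNReal.toReal_nonneg, fun c hc => ?_⟩
  rw [ENNReal.ofReal_mul ENNReal.toReal_nonneg, ENNReal.ofReal_toReal hfin,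
    ofReal_tsum_norm_sq hc]
  calc _ ≤ 1 * ∫⁻ v : Metric.sphere (0 : EuclideanSpace ℝ (Fin 3)) 1,
        K * ∑' n, ‖c n‖ₑ ^ 2 ∂σ := by
        gcongr with v
        · rw [← ENNReal.ofReal_one]; exact ENNReal.ofReal_le_ofReal (by norm_num)
        · have h1 : ‖iQ v‖ = 1 := by rw [norm_iQ]; simp
          obtain ⟨A, B, h⟩ := exists_isSplitting (iQ_re v) h1
          exact h.sliceEnergy_le (iQ_re v) h1 ha (hlim _ (iQ_re v) h1) ENNReal.toReal_nonneg
            (hM _ (iQ_re v) h1) hc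
    _ = _ := by
        rw [lintegral_const]
        ring

section Unit

variable {I : ℍ[ℝ]}

lemma mul_self_of_imaginary_unit (hI : I.re = 0) (hI1 : ‖I‖ = 1) : I * I = -1 := by
  have hn := Quaternion.norm_sq_eq I
  rw [hI, hI1] at hn
  ext <;> simp [hI] <;> linarith

lemma slicePoint_mul (hI : I.re = 0) (hI1 : ‖I‖ = 1) (z w : ℂ) :
    slicePoint I (z * w) = slicePoint I z * slicePoint I w := by
  simp only [slicePoint, Complex.mul_re, Complex.mul_im, add_mul, mul_add, smul_mul_assoc,
    mul_smul_comm, mul_self_of_imaginary_unit hI hI1, Quaternion.coe_mul_eq_smul,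
    Quaternion.mul_coe_eq_smul, smul_smul, Quaternion.coe_sub, Quaternion.coe_mul]
  ext <;> simp [hI] <;> ring

lemma slicePoint_pow (hI : I.re = 0) (hI1 : ‖I‖ = 1) (z : ℂ) (n : ℕ) :
    slicePoint I z ^ n = slicePoint I (z ^ n) := by
  induction n with
  | zero => ext <;> simp [slicePoint]
  | succ n ih => rw [pow_succ, ih, pow_succ, slicePoint_mul hI hI1]

lemma tsum_slicePoint_pow_mul (hI : I.re = 0) (hI1 : ‖I‖ = 1) {c : ℕ → ℍ[ℝ]} {z : ℂ}
    (hc : Summable fun n => ‖c n‖ * ‖z‖ ^ n) :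
    ∑' n, slicePoint I z ^ n * c n =
      ∑' n, (z ^ n).re • c n + I * ∑' n, (z ^ n).im • c n := by
  have h1 : Summable fun n => (z ^ n).re • c n := by
    refine Summable.of_norm_bounded hc fun n => ?_
    rw [norm_smul, mul_comm, ← norm_pow]
    gcongr
    exact Complex.abs_re_le_norm _
  have h2 : Summable fun n => (z ^ n).im • c n := by
    refine Summable.of_norm_bounded hc fun n => ?_
    rw [norm_smul, mul_comm, ← norm_pow]
    gcongr
    exact Complex.abs_im_le_norm _
  rw [← h2.tsum_mul_left, ← h1.tsum_add (h2.mul_left I)]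
  refine tsum_congr fun n => ?_
  rw [slicePoint_pow hI hI1, slicePoint, add_mul, Quaternion.coe_mul_eq_smul, smul_mul_assoc,
    mul_smul_comm]

lemma norm_sq_add_norm_sq_conj (hI : I.re = 0) (hI1 : ‖I‖ = 1) {c : ℕ → ℍ[ℝ]} {z : ℂ}
    (hc : Summable fun n => ‖c n‖ * ‖z‖ ^ n) :
    ‖∑' n, slicePoint I z ^ n * c n‖ ^ 2 +
        ‖∑' n, slicePoint I ((starRingEnd ℂ) z) ^ n * c n‖ ^ 2 =
      2 * (‖∑' n, (z ^ n).re • c n‖ ^ 2 + ‖∑' n, (z ^ n).im • c n‖ ^ 2) := by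
  have hc' : Summable fun n => ‖c n‖ * ‖(starRingEnd ℂ) z‖ ^ n := by simpa using hc
  rw [tsum_slicePoint_pow_mul hI hI1 hc, tsum_slicePoint_pow_mul hI hI1 hc']
  simp only [← map_pow, Complex.conj_re, Complex.conj_im, neg_smul, tsum_neg, mul_neg,
    ← sub_eq_add_neg]
  have := parallelogram_law_with_norm ℝ (∑' n, (z ^ n).re • c n) (I * ∑' n, (z ^ n).im • c n)
  rw [norm_mul I, hI1, one_mul] at this
  linarith

end Unit

lemma norm_powSeries_conj (ρ : ℕ → ℝ) (z : ℂ) :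
    ‖powSeries (fun n => (ρ n : ℂ)) ((starRingEnd ℂ) z)‖ = ‖powSeries (fun n => (ρ n : ℂ)) z‖ := by
  rw [← Complex.norm_conj (powSeries _ z), powSeries, powSeries, starRingEnd_apply,
    starRingEnd_apply, tsum_star]
  congr 1
  refine tsum_congr fun n => ?_
  simp

lemma IsSplitting.enorm_tsum_coe {I : ℍ[ℝ]} {A B : ℍ[ℝ] →L[ℝ] ℂ} (h : IsSplitting I A B)
    (hI : I.re = 0) (hI1 : ‖I‖ = 1) {ρ : ℕ → ℝ} {z : ℂ}
    (hρ : Summable fun n => ‖(ρ n : ℍ[ℝ])‖ * ‖z‖ ^ n) :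
    ‖∑' n, slicePoint I z ^ n * (ρ n : ℍ[ℝ])‖ₑ ^ 2 =
      ‖powSeries (fun n => (ρ n : ℂ)) z‖ₑ ^ 2 := by
  have e : ∀ L : ℍ[ℝ] →L[ℝ] ℂ, powSeries (fun n => L (ρ n : ℍ[ℝ])) z =
      powSeries (fun n => (ρ n : ℂ)) z * L 1 := fun L => by
    rw [powSeries, powSeries, ← tsum_mul_right]
    refine tsum_congr fun n => ?_
    rw [show ((ρ n : ℝ) : ℍ[ℝ]) = ρ n • (1 : ℍ[ℝ]) by ext <;> simp, map_smul, Complex.real_smul]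
    ring
  rw [h.enorm_sq, h.map_tsum hI hI1 hρ, h.swap.map_tsum hI hI1 hρ, e, e, enorm_mul, enorm_mul,
    mul_pow, mul_pow, ← mul_add, ← h.enorm_sq]
  simp

lemma IsSplitting.two_mul_sliceEnergy {I : ℍ[ℝ]} {A B : ℍ[ℝ] →L[ℝ] ℂ} (h : IsSplitting I A B)
    (hI : I.re = 0) (hI1 : ‖I‖ = 1) {a : ℕ → ℍ[ℝ]} (ha : Summable fun n => ‖a n‖ ^ 2)
    {ρ : ℕ → ℝ} (hρ : Summable fun n => ‖(ρ n : ℍ[ℝ])‖ ^ 2) :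
    2 * sliceEnergy a (fun n => (ρ n : ℍ[ℝ])) I = ∫⁻ z in Metric.ball (0 : ℂ) 1,
      ‖powSeries (fun n => (ρ n : ℂ)) z‖ₑ ^ 2 * ENNReal.ofReal (2 *
        (‖∑' n : ℕ, (z ^ n).re • (((n + 1 : ℕ) : ℝ) • a (n + 1))‖ ^ 2 +
          ‖∑' n : ℕ, (z ^ n).im • (((n + 1 : ℕ) : ℝ) • a (n + 1))‖ ^ 2)) *
        ENNReal.ofReal (1 - ‖z‖ ^ 2) := by
  have h1 : sliceEnergy a (fun n => (ρ n : ℍ[ℝ])) I = ∫⁻ z in Metric.ball (0 : ℂ) 1,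
      ‖powSeries (fun n => (ρ n : ℂ)) z‖ₑ ^ 2 * ‖cullenDeriv a (slicePoint I z)‖ₑ ^ 2 *
        ENNReal.ofReal (1 - ‖z‖ ^ 2) := by
    refine setLIntegral_congr_fun measurableSet_ball fun z hz => ?_
    rw [mem_ball_zero_iff] at hz
    simp only [h.enorm_tsum_coe hI hI1 (summable_mul_pow_of_summable_sq hρ hz)]
  have h2 : sliceEnergy a (fun n => (ρ n : ℍ[ℝ])) I = ∫⁻ z in Metric.ball (0 : ℂ) 1,
      ‖powSeries (fun n => (ρ n : ℂ)) z‖ₑ ^ 2 *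
        ‖cullenDeriv a (slicePoint I ((starRingEnd ℂ) z))‖ₑ ^ 2 *
        ENNReal.ofReal (1 - ‖z‖ ^ 2) := by
    rw [h1, ← Complex.conjLIE.measurePreserving.setLIntegral_comp_preimage_emb
      Complex.conjLIE.toHomeomorph.measurableEmbedding]
    have : Complex.conjLIE ⁻¹' Metric.ball (0 : ℂ) 1 = Metric.ball (0 : ℂ) 1 := by
      ext z; simp
    rw [this]
    refine lintegral_congr fun z => ?_
    simp only [Complex.conjLIE_apply, ← ofReal_norm_sq, norm_powSeries_conj, Complex.norm_conj]
  have hm : AEMeasurable (fun z => ‖powSeries (fun n => (ρ n : ℂ)) z‖ₑ ^ 2 *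
      ‖cullenDeriv a (slicePoint I z)‖ₑ ^ 2 * ENNReal.ofReal (1 - ‖z‖ ^ 2))
      (volume.restrict (Metric.ball (0 : ℂ) 1)) := by
    have m1 := (discSummable_of_summable_sq (a := fun n => (ρ n : ℂ))
      (by simpa using hρ)).aemeasurable_enorm_sq
    have hA : Measurable fun z : ℂ => ‖deriv (powSeries fun n => A (a n)) z‖ₑ ^ 2 :=
      (measurable_deriv _).enorm.pow_const 2
    have hB : Measurable fun z : ℂ => ‖deriv (powSeries fun n => B (a n)) z‖ₑ ^ 2 :=
      (measurable_deriv _).enorm.pow_const 2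
    have hw : Measurable fun z : ℂ => ENNReal.ofReal (1 - ‖z‖ ^ 2) := by fun_prop
    refine ((m1.mul (hA.add hB).aemeasurable).mul hw.aemeasurable).congr ?_
    filter_upwards [ae_restrict_mem measurableSet_ball] with z hz
    rw [mem_ball_zero_iff] at hz
    simp only [Pi.mul_apply, Pi.add_apply, h.enorm_sq (cullenDeriv _ _),
      h.map_cullenDeriv hI hI1 ha hz, h.swap.map_cullenDeriv hI hI1 ha hz]
  rw [two_mul]
  nth_rw 1 [h1]
  rw [h2, ← lintegral_add_left' hm]
  refine setLIntegral_congr_fun measurableSet_ball fun z hz => ?_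
  rw [mem_ball_zero_iff] at hz
  rw [← add_mul, ← mul_add, ← norm_sq_add_norm_sq_conj hI hI1 (summable_cullenDeriv_coeff ha hz),
    ENNReal.ofReal_add (by positivity) (by positivity), ofReal_norm_sq, ofReal_norm_sq,
    ← cullenDeriv_eq_tsum, ← cullenDeriv_eq_tsum]

lemma sliceEnergy_coe_eq {I J : ℍ[ℝ]} (hI : I.re = 0) (hI1 : ‖I‖ = 1) (hJ : J.re = 0)
    (hJ1 : ‖J‖ = 1) {a : ℕ → ℍ[ℝ]} (ha : Summable fun n => ‖a n‖ ^ 2)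
    {ρ : ℕ → ℝ} (hρ : Summable fun n => ‖(ρ n : ℍ[ℝ])‖ ^ 2) :
    sliceEnergy a (fun n => (ρ n : ℍ[ℝ])) I = sliceEnergy a (fun n => (ρ n : ℍ[ℝ])) J := by
  obtain ⟨A, B, h⟩ := exists_isSplitting hI hI1
  obtain ⟨A', B', h'⟩ := exists_isSplitting hJ hJ1
  exact (ENNReal.mul_right_inj two_ne_zero ENNReal.ofNat_ne_top).1
    ((h.two_mul_sliceEnergy hI hI1 ha hρ).trans (h'.two_mul_sliceEnergy hJ hJ1 ha hρ).symm)

lemma exists_sliceEnergy_coe_le {a : ℕ → ℍ[ℝ]} (ha : Summable fun n => ‖a n‖ ^ 2) {C : ℝ}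
    (hC0 : 0 ≤ C) (hC : ∀ c : ℕ → ℍ[ℝ], Summable (fun n => ‖c n‖ ^ 2) →
      ENNReal.ofReal (1 / 4) * ∫⁻ v : Metric.sphere (0 : EuclideanSpace ℝ (Fin 3)) 1,
        sliceEnergy a c (iQ v) ∂((volume : Measure (EuclideanSpace ℝ (Fin 3))).toSphere) ≤
      ENNReal.ofReal (C * ∑' n : ℕ, ‖c n‖ ^ 2)) :
    ∃ K : ℝ, 0 ≤ K ∧ ∀ (I : ℍ[ℝ]) (ρ : ℕ → ℝ), I.re = 0 → ‖I‖ = 1 →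
      Summable (fun n => ‖(ρ n : ℍ[ℝ])‖ ^ 2) →
      sliceEnergy a (fun n => (ρ n : ℍ[ℝ])) I ≤
        ENNReal.ofReal (K * ∑' n : ℕ, ‖(ρ n : ℍ[ℝ])‖ ^ 2) := by
  set σ := (volume : Measure (EuclideanSpace ℝ (Fin 3))).toSphere with hσ
  have hσ0 : σ ≠ 0 := Measure.toSphere_ne_zero _
  set s := ENNReal.ofReal (1 / 4) * σ Set.univ with hs
  have hs0 : s ≠ 0 := mul_ne_zero (by simp) (by simpa using hσ0)
  have hst : s ≠ ⊤ := ENNReal.mul_ne_top ENNReal.ofReal_ne_top (measure_ne_top _ _)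
  have hpos := ENNReal.toReal_pos hs0 hst
  refine ⟨C / s.toReal, by positivity, fun I ρ hI hI1 hρ => ?_⟩
  have := hC _ hρ
  rw [lintegral_congr fun v : Metric.sphere (0 : EuclideanSpace ℝ (Fin 3)) 1 =>
    sliceEnergy_coe_eq (iQ_re v) (by rw [norm_iQ]; simp) hI hI1 ha hρ, lintegral_const,
    mul_comm _ (σ _),
    ← mul_assoc, ← hs] at this
  rw [div_mul_eq_mul_div, ENNReal.ofReal_div_of_pos hpos, ENNReal.ofReal_toReal hst,
    ENNReal.le_div_iff_mul_le (Or.inl hs0) (Or.inl hst), mul_comm]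
  exact this

lemma enorm_geometric_sq_le {w z : ℂ} (hw : ‖w‖ < 1) (hz : ‖z‖ < 1) :
    ENNReal.ofReal (1 / ‖1 - (starRingEnd ℂ) w * z‖ ^ 2) ≤
      2 * ‖powSeries (fun n => (((starRingEnd ℂ) w ^ n).re : ℂ)) z‖ₑ ^ 2 +
        2 * ‖powSeries (fun n => (((starRingEnd ℂ) w ^ n).im : ℂ)) z‖ₑ ^ 2 := by
  set v := (starRingEnd ℂ) w with hv
  have hv1 : ‖v‖ < 1 := by simpa [hv] using hw
  have hg : Summable fun n : ℕ => ‖z‖ ^ n := summable_geometric_of_lt_one (norm_nonneg _) hz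
  have hb : ∀ n : ℕ, ‖v ^ n‖ ≤ 1 := fun n => by
    rw [norm_pow]; exact pow_le_one₀ (norm_nonneg _) hv1.le
  have h1 : Summable fun n : ℕ => ((v ^ n).re : ℂ) * z ^ n := by
    refine Summable.of_norm_bounded hg fun n => ?_
    rw [norm_mul, norm_pow, Complex.norm_real]
    exact mul_le_of_le_one_left (by positivity) ((Complex.abs_re_le_norm _).trans (hb n))
  have h2 : Summable fun n : ℕ => ((v ^ n).im : ℂ) * z ^ n := by
    refine Summable.of_norm_bounded hg fun n => ?_
    rw [norm_mul, norm_pow, Complex.norm_real]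
    exact mul_le_of_le_one_left (by positivity) ((Complex.abs_im_le_norm _).trans (hb n))
  have e : (1 - v * z)⁻¹ = powSeries (fun n => ((v ^ n).re : ℂ)) z +
      Complex.I * powSeries (fun n => ((v ^ n).im : ℂ)) z := by
    have hvz : ‖v * z‖ < 1 := by
      rw [norm_mul]
      exact mul_lt_one_of_nonneg_of_lt_one_left (norm_nonneg _) hv1 hz.le
    rw [← tsum_geometric_of_norm_lt_one hvz, powSeries, powSeries, ← tsum_mul_left,
      ← h1.tsum_add (h2.mul_left _)]
    refine tsum_congr fun n => ?_
    rw [mul_pow]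
    conv_lhs => rw [← Complex.re_add_im (v ^ n)]
    ring
  rw [one_div, ← inv_pow, ← norm_inv, e, ofReal_norm_sq]
  refine (enorm_add_sq_le _ _).trans_eq ?_
  rw [enorm_mul Complex.I, ← ofReal_norm Complex.I, Complex.norm_I, ENNReal.ofReal_one, one_mul]

lemma tsum_coe_sq_le {w : ℂ} (hw : ‖w‖ < 1) {ρ : ℕ → ℝ} (hρ : ∀ n, |ρ n| ≤ ‖w‖ ^ n) :
    Summable (fun n => ‖(ρ n : ℍ[ℝ])‖ ^ 2) ∧
      ∑' n, ‖(ρ n : ℍ[ℝ])‖ ^ 2 ≤ 1 / (1 - ‖w‖ ^ 2) := by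
  have hw2 : ‖w‖ ^ 2 < 1 := pow_lt_one₀ (norm_nonneg _) hw two_ne_zero
  have hg := summable_geometric_of_lt_one (sq_nonneg ‖w‖) hw2
  have hle : ∀ n, ‖(ρ n : ℍ[ℝ])‖ ^ 2 ≤ (‖w‖ ^ 2) ^ n := fun n => by
    rw [Quaternion.norm_coe, Real.norm_eq_abs, ← pow_mul, mul_comm 2 n, pow_mul]
    exact pow_le_pow_left₀ (abs_nonneg _) (hρ n) 2
  have hs := Summable.of_nonneg_of_le (fun _ => by positivity) hle hg
  refine ⟨hs, (hs.tsum_le_tsum hle hg).trans_eq ?_⟩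
  rw [tsum_geometric_of_lt_one (sq_nonneg ‖w‖) hw2, one_div]

namespace IsSplitting

variable {I : ℍ[ℝ]} {A B : ℍ[ℝ] →L[ℝ] ℂ} {a : ℕ → ℍ[ℝ]} {K : ℝ}

lemma lintegral_coe_le (h : IsSplitting I A B) (hI : I.re = 0) (hI1 : ‖I‖ = 1)
    (ha : Summable fun n => ‖a n‖ ^ 2) {ρ : ℕ → ℝ} (hρ : Summable fun n => ‖(ρ n : ℍ[ℝ])‖ ^ 2) :
    ∫⁻ z in Metric.ball (0 : ℂ) 1, ‖powSeries (fun n => (ρ n : ℂ)) z‖ₑ ^ 2 *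
      ‖deriv (powSeries fun n => A (a n)) z‖ₑ ^ 2 * ENNReal.ofReal (1 - ‖z‖ ^ 2) ≤
      sliceEnergy a (fun n => (ρ n : ℍ[ℝ])) I := by
  refine setLIntegral_mono' measurableSet_ball fun z hz => ?_
  rw [mem_ball_zero_iff] at hz
  rw [h.enorm_tsum_coe hI hI1 (summable_mul_pow_of_summable_sq hρ hz),
    h.enorm_sq (cullenDeriv _ _), h.map_cullenDeriv hI hI1 ha hz]
  gcongr
  exact le_self_add

lemma lintegral_kernel_le (h : IsSplitting I A B) (hI : I.re = 0) (hI1 : ‖I‖ = 1)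
    (ha : Summable fun n => ‖a n‖ ^ 2) (hK0 : 0 ≤ K)
    (hK : ∀ ρ : ℕ → ℝ, Summable (fun n => ‖(ρ n : ℍ[ℝ])‖ ^ 2) →
      sliceEnergy a (fun n => (ρ n : ℍ[ℝ])) I ≤
        ENNReal.ofReal (K * ∑' n : ℕ, ‖(ρ n : ℍ[ℝ])‖ ^ 2)) {w : ℂ} (hw : ‖w‖ < 1) :
    ∫⁻ z in Metric.ball (0 : ℂ) 1, ENNReal.ofReal (1 / ‖1 - (starRingEnd ℂ) w * z‖ ^ 2) *
      ‖deriv (powSeries fun n => A (a n)) z‖ₑ ^ 2 * ENNReal.ofReal (1 - ‖z‖ ^ 2) ≤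
      ENNReal.ofReal (4 * K / (1 - ‖w‖ ^ 2)) := by
  have hn : ∀ n, ‖(starRingEnd ℂ) w ^ n‖ = ‖w‖ ^ n := fun n => by simp
  obtain ⟨s1, t1⟩ := tsum_coe_sq_le hw (ρ := fun n => ((starRingEnd ℂ) w ^ n).re) fun n =>
    (Complex.abs_re_le_norm _).trans_eq (hn n)
  obtain ⟨s2, t2⟩ := tsum_coe_sq_le hw (ρ := fun n => ((starRingEnd ℂ) w ^ n).im) fun n =>
    (Complex.abs_im_le_norm _).trans_eq (hn n)
  have b1 := (h.lintegral_coe_le hI hI1 ha s1).trans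
    ((hK _ s1).trans (ENNReal.ofReal_le_ofReal (mul_le_mul_of_nonneg_left t1 hK0)))
  have b2 := (h.lintegral_coe_le hI hI1 ha s2).trans
    ((hK _ s2).trans (ENNReal.ofReal_le_ofReal (mul_le_mul_of_nonneg_left t2 hK0)))
  have m1 := (discSummable_of_summable_sq
    (a := fun n => (((starRingEnd ℂ) w ^ n).re : ℂ)) (by simpa using s1)).aemeasurable_enorm_sq
  have hA : Measurable fun z : ℂ => ‖deriv (powSeries fun n => A (a n)) z‖ₑ ^ 2 :=
    (measurable_deriv _).enorm.pow_const 2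
  have hw' : Measurable fun z : ℂ => ENNReal.ofReal (1 - ‖z‖ ^ 2) := by fun_prop
  calc _ ≤ ∫⁻ z in Metric.ball (0 : ℂ) 1,
        (2 * (‖powSeries (fun n => (((starRingEnd ℂ) w ^ n).re : ℂ)) z‖ₑ ^ 2 *
          ‖deriv (powSeries fun n => A (a n)) z‖ₑ ^ 2 * ENNReal.ofReal (1 - ‖z‖ ^ 2)) +
        2 * (‖powSeries (fun n => (((starRingEnd ℂ) w ^ n).im : ℂ)) z‖ₑ ^ 2 *
          ‖deriv (powSeries fun n => A (a n)) z‖ₑ ^ 2 * ENNReal.ofReal (1 - ‖z‖ ^ 2))) := by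
        refine setLIntegral_mono' measurableSet_ball fun z hz => ?_
        rw [mem_ball_zero_iff] at hz
        rw [← mul_assoc, ← mul_assoc, ← mul_assoc, ← mul_assoc, ← add_mul, ← add_mul]
        gcongr
        exact enorm_geometric_sq_le hw hz
    _ ≤ 2 * ENNReal.ofReal (K * (1 / (1 - ‖w‖ ^ 2))) +
        2 * ENNReal.ofReal (K * (1 / (1 - ‖w‖ ^ 2))) := by
        rw [lintegral_add_left' (by fun_prop), lintegral_const_mul' _ _ (by simp),
          lintegral_const_mul' _ _ (by simp)]
        gcongr
    _ = _ := by
        rw [← add_mul, show (2 + 2 : ℝ≥0∞) = ENNReal.ofReal 4 by norm_num,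
          ← ENNReal.ofReal_mul (by norm_num)]
        congr 1
        ring

lemma bmoSeminorm_le_of_sliceEnergy_le (h : IsSplitting I A B) (hI : I.re = 0) (hI1 : ‖I‖ = 1)
    (ha : Summable fun n => ‖a n‖ ^ 2) {F : ℝ → ℍ[ℝ]}
    (hF : ∀ᵐ θ ∂(volume : Measure ℝ),
      Tendsto (fun r : ℝ => ∑' n : ℕ, (r • expQ I θ) ^ n * a n) (𝓝[<] (1 : ℝ)) (𝓝 (F θ)))
    (hK0 : 0 ≤ K) (hK : ∀ ρ : ℕ → ℝ, Summable (fun n => ‖(ρ n : ℍ[ℝ])‖ ^ 2) →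
      sliceEnergy a (fun n => (ρ n : ℍ[ℝ])) I ≤
        ENNReal.ofReal (K * ∑' n : ℕ, ‖(ρ n : ℍ[ℝ])‖ ^ 2)) :
    bmoSeminorm F ≤ ENNReal.ofReal ((512 * K) ^ (1 / 2 : ℝ)) := by
  refine bmoSeminorm_le fun α β hαβ h2 => ?_
  have hp : 0 < β - α := sub_pos.2 hαβ
  obtain ⟨b, hb, hbF⟩ := h.exists_isRadialLimit hI hI1 ha hF
  obtain ⟨b', hb', hbF'⟩ := h.swap.exists_isRadialLimit hI hI1 ha hF
  obtain ⟨x, hx⟩ := hb.exists_lintegral_arc_le (h.summable_sq ha)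
    (fun w hw => h.lintegral_kernel_le hI hI1 ha hK0 hK hw) hαβ h2
  obtain ⟨y, hy⟩ := hb'.exists_lintegral_arc_le (h.swap.summable_sq ha)
    (fun w hw => h.swap.lintegral_kernel_le hI hI1 ha hK0 hK hw) hαβ h2
  obtain ⟨q, rfl, rfl⟩ := h.exists_eq x y
  have hm := h.memLp_boundary hI hI1 ha hF h2
  refine (intervalIntegral_norm_sub_mean_sq_le hαβ hm q).trans ?_
  rw [← ENNReal.ofReal_le_ofReal_iff (by positivity), ofReal_intervalIntegral_norm_sub_sq hαβ hm]
  rw [← restrict_Ioc_eq_restrict_Icc] at hx hy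
  have hmb : AEMeasurable (fun θ => ‖b (circleMap 0 1 θ) - A q‖ₑ ^ 2) volume := ((hb.aestronglyMeasurable (h.summable_sq ha)).sub
    (aestronglyMeasurable_const (b := A q))).enorm.pow_const 2
  calc _ = ∫⁻ θ in Set.Ioc α β,
        (‖b (circleMap 0 1 θ) - A q‖ₑ ^ 2 + ‖b' (circleMap 0 1 θ) - B q‖ₑ ^ 2) := by
        refine lintegral_congr_ae ?_
        filter_upwards [ae_restrict_of_ae hbF, ae_restrict_of_ae hbF'] with θ h1 h2
        rw [h.enorm_sq, map_sub, map_sub, h1, h2]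
    _ ≤ ENNReal.ofReal ((β - α) * (64 * (4 * K))) + ENNReal.ofReal ((β - α) * (64 * (4 * K))) := by
        rw [lintegral_add_left' hmb.restrict]
        exact add_le_add hx hy
    _ = _ := by
        rw [← ENNReal.ofReal_add (by positivity) (by positivity)]
        congr 1
        ring

end IsSplitting

lemma bmo_lt_top_of_carleson {a : ℕ → ℍ[ℝ]} (ha : Summable fun n => ‖a n‖ ^ 2)
    {fstar : ℍ[ℝ] → ℝ → ℍ[ℝ]}
    (hlim : ∀ I : ℍ[ℝ], I.re = 0 → ‖I‖ = 1 → ∀ᵐ θ ∂(volume : Measure ℝ),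
      Tendsto (fun r : ℝ => ∑' n : ℕ, (r • expQ I θ) ^ n * a n) (𝓝[<] (1 : ℝ))
        (𝓝 (fstar I θ)))
    {C : ℝ} (hC0 : 0 ≤ C) (hC : ∀ c : ℕ → ℍ[ℝ], Summable (fun n => ‖c n‖ ^ 2) →
      ENNReal.ofReal (1 / 4) * ∫⁻ v : Metric.sphere (0 : EuclideanSpace ℝ (Fin 3)) 1,
        sliceEnergy a c (iQ v) ∂((volume : Measure (EuclideanSpace ℝ (Fin 3))).toSphere) ≤
      ENNReal.ofReal (C * ∑' n : ℕ, ‖c n‖ ^ 2)) :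
    (⨆ (I : ℍ[ℝ]) (_ : I.re = 0 ∧ ‖I‖ = 1), bmoSeminorm (fstar I)) < ⊤ := by
  obtain ⟨K, hK0, hK⟩ := exists_sliceEnergy_coe_le ha hC0 hC
  refine (iSup₂_le fun I hI => ?_).trans_lt
    (ENNReal.ofReal_lt_top (r := (512 * K) ^ (1 / 2 : ℝ)))
  obtain ⟨A, B, h⟩ := exists_isSplitting hI.1 hI.2
  exact h.bmoSeminorm_le_of_sliceEnergy_le hI.1 hI.2 ha (hlim I hI.1 hI.2) hK0
    fun ρ => hK I ρ hI.1 hI.2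

/-- **BMOA is characterized by the Carleson property of `μ_f`.**
Let `f(q) = ∑ₙ qⁿ aₙ ∈ H²(𝔹)` with a.e. radial boundary functions `fstar I` on each
slice. Then `‖f‖_{BMOA(𝔹)} < ∞` if and only if the measure
`dμ_f(q) = |∂_c f(q)|²(1 − |q|²) dVol_𝔹(q)` is a Carleson measure for `H²(𝔹)`. -/
theorem bmoa_iff_carleson (a : ℕ → ℍ[ℝ]) (ha : Summable fun n => ‖a n‖ ^ 2)
    (fstar : ℍ[ℝ] → ℝ → ℍ[ℝ])
    (hlim : ∀ I : ℍ[ℝ], I.re = 0 → ‖I‖ = 1 → ∀ᵐ θ ∂(volume : Measure ℝ),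
      Tendsto (fun r : ℝ => ∑' n : ℕ, (r • expQ I θ) ^ n * a n) (𝓝[<] (1 : ℝ))
        (𝓝 (fstar I θ))) :
    (⨆ (I : ℍ[ℝ]) (_ : I.re = 0 ∧ ‖I‖ = 1), bmoSeminorm (fstar I)) < ⊤ ↔
    (∃ C : ℝ, 0 ≤ C ∧ ∀ c : ℕ → ℍ[ℝ], Summable (fun n => ‖c n‖ ^ 2) →
      ENNReal.ofReal (1 / 4) *
        ∫⁻ I : Metric.sphere (0 : EuclideanSpace ℝ (Fin 3)) 1,
          (∫⁻ p in {p : ℝ × ℝ | p.1 ^ 2 + p.2 ^ 2 < 1},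
            (‖∑' n : ℕ, ((p.1 : ℍ[ℝ]) + p.2 • iQ (I : EuclideanSpace ℝ (Fin 3))) ^ n * c n‖₊ : ℝ≥0∞) ^ 2 *
            (‖cullenDeriv a ((p.1 : ℍ[ℝ]) + p.2 • iQ (I : EuclideanSpace ℝ (Fin 3)))‖₊ : ℝ≥0∞) ^ 2 *
            ENNReal.ofReal (1 - p.1 ^ 2 - p.2 ^ 2) ∂(volume : Measure (ℝ × ℝ)))
          ∂((volume : Measure (EuclideanSpace ℝ (Fin 3))).toSphere)
        ≤ ENNReal.ofReal (C * ∑' n : ℕ, ‖c n‖ ^ 2)) := by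
  simp only [setLIntegral_slice_eq]
  exact ⟨exists_carleson_of_bmo ha hlim, fun ⟨_, hC0, hC⟩ => bmo_lt_top_of_carleson ha hlim hC0 hC⟩
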